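/- Probabilistic local quantum unique ergodicity (uniform model). There exist absolute constants c0, C > 0 with the following property. Let N, d be positive integers with Nd even and d ≥ 3, and let ξ > 0 satisfy ξ·log ξ ≥ c0·(log N)² and D ≥ c0·ξ². Let a : {1,…,N} → ℝ be a deterministic function with Σ_{i=1}^N a_i = 0, and let ζ ≥ c0. Then, with probability at least 1 − e^{−ξ log ξ} − e^{−ζ·√(log ζ)} under the uniform model of random d-regular graphs on N vertices, every ℓ²-normalized eigenvector v = (v_i)_{i=1}^N of A satisfies | Σ_{i=1}^N a_i·v_i² | ≤ C·((ξ·ζ)²/N)·( Σ_{i=1}^N a_i² )^{1/2}. -/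

import Mathlib

noncomputable section

/-- The number of elements of a finite type satisfying a predicate. -/
def cardOf {α : Type*} [Fintype α] (p : α → Prop) : ℕ :=
  (@Finset.filter α p (Classical.decPred p) Finset.univ).card

/-- `G` encodes a simple `d`-regular graph on `N` vertices: it is symmetric, has zero
diagonal, and every row has exactly `d` ones. -/
def IsRegGraph (N d : ℕ) (G : Fin N → Fin N → Bool) : Prop :=
  (∀ i j, G i j = G j i) ∧ (∀ i, G i i = false) ∧
    ∀ i, (Finset.univ.filter fun j => G i j = true).card = d

/-- The `{0,1}`-valued adjacency matrix associated to `G`. -/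
def adjOf {N : ℕ} (G : Fin N → Fin N → Bool) : Matrix (Fin N) (Fin N) ℝ :=
  Matrix.of fun i j => if G i j then 1 else 0

/-- The probability of the event `P` under the uniform model of random `d`-regular
graphs on `N` vertices. -/
def unifProb (N d : ℕ) (P : Matrix (Fin N) (Fin N) ℝ → Prop) : ℝ :=
  (cardOf (fun G : Fin N → Fin N → Bool => IsRegGraph N d G ∧ P (adjOf G)) : ℝ) /
  (cardOf (fun G : Fin N → Fin N → Bool => IsRegGraph N d G) : ℝ)

/-- `D := min(d, N²/d³)` for the uniform model. -/
def Dunif (N d : ℕ) : ℝ := min (d : ℝ) ((N : ℝ) ^ 2 / (d : ℝ) ^ 3)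

/-! ### Compressed resolvents -/

section Resolvent

open Matrix Complex

variable {n : Type*} [Fintype n] [DecidableEq n]

/-- `K` is the resolvent at `z` of the compression of `H` to the range of the projection `P`. -/
structure IsCompRes (P H : Matrix n n ℂ) (z : ℂ) (K : Matrix n n ℂ) : Prop where
  proj_mul : P * K = K
  mul_proj : K * P = K
  left_inv : P * (H - z • 1) * K = P
  right_inv : K * (H - z • 1) * P = P

/-- The compressed resolvent. -/
def compRes (P H : Matrix n n ℂ) (z : ℂ) : Matrix n n ℂ := P * (P * H * P - z • 1)⁻¹

lemma isUnit_det_sub_smul {A : Matrix n n ℂ} (hA : A.IsHermitian) {z : ℂ} (hz : 0 < z.im) :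
    IsUnit (A - z • 1).det := by
  rw [isUnit_iff_ne_zero]
  intro h
  obtain ⟨v, hv, h0⟩ := Matrix.exists_mulVec_eq_zero_iff.mpr h
  have h1 : A *ᵥ v = z • v := by
    rw [sub_mulVec, smul_mulVec, one_mulVec, sub_eq_zero] at h0
    exact h0
  have h2 : (star v ⬝ᵥ A *ᵥ v).im = 0 := hA.im_star_dotProduct_mulVec_self v
  rw [h1, dotProduct_smul] at h2
  have h3 : (star v ⬝ᵥ v) = ((∑ i, ‖v i‖ ^ 2 : ℝ) : ℂ) := by
    simp [dotProduct, Complex.conj_mul']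
  rw [h3, smul_eq_mul, Complex.mul_im, Complex.ofReal_im, Complex.ofReal_re, mul_zero,
    zero_add] at h2
  have h4 : (∑ i, ‖v i‖ ^ 2 : ℝ) = 0 := by
    rcases mul_eq_zero.mp h2 with h | h
    · exact absurd h hz.ne'
    · exact h
  apply hv
  funext i
  have := (Finset.sum_eq_zero_iff_of_nonneg (fun i _ => by positivity)).mp h4 i (Finset.mem_univ i)
  simpa using this

lemma compRes_isCompRes {P H : Matrix n n ℂ} (hH : H.IsHermitian) (hP : P.IsHermitian)
    (hPP : P * P = P) {z : ℂ} (hz : 0 < z.im) : IsCompRes P H z (compRes P H z) := by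
  have hA : (P * H * P).IsHermitian := by
    have := isHermitian_conjTranspose_mul_mul P hH
    rwa [hP.eq] at this
  have hu := isUnit_det_sub_smul hA hz
  set M := P * H * P - z • (1 : Matrix n n ℂ) with hM
  have h1 : M * M⁻¹ = 1 := mul_nonsing_inv M hu
  have h2 : M⁻¹ * M = 1 := nonsing_inv_mul M hu
  have hc : P * M = M * P := by
    rw [hM, mul_sub, sub_mul]
    simp only [← mul_assoc, hPP, mul_smul_comm, smul_mul_assoc, mul_one, one_mul]
    rw [mul_assoc (P * H), hPP]
  have hc' : P * M⁻¹ = M⁻¹ * P := by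
    calc P * M⁻¹ = M⁻¹ * M * P * M⁻¹ := by rw [h2, one_mul]
      _ = M⁻¹ * (M * P) * M⁻¹ := by noncomm_ring
      _ = M⁻¹ * P * (M * M⁻¹) := by rw [← hc]; noncomm_ring
      _ = M⁻¹ * P := by rw [h1, mul_one]
  have hPM : P * (H - z • 1) * P = M * P := by
    rw [hM, mul_sub, sub_mul, sub_mul]
    simp only [mul_smul_comm, smul_mul_assoc, mul_one, one_mul, hPP]
    rw [mul_assoc (P * H), hPP]
  refine ⟨?_, ?_, ?_, ?_⟩
  · rw [compRes, ← hM, ← mul_assoc, hPP]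
  · rw [compRes, ← hM, mul_assoc, ← hc', ← mul_assoc, hPP]
  · rw [compRes, ← hM, ← mul_assoc, hPM, mul_assoc, hc', ← mul_assoc, h1, one_mul]
  · rw [compRes, ← hM, hc', mul_assoc, mul_assoc, ← mul_assoc P, hPM, ← mul_assoc, h2, one_mul]

variable {P H H' K K' : Matrix n n ℂ} {z z' : ℂ}

lemma IsCompRes.sub_eq (h : IsCompRes P H z K) (h' : IsCompRes P H' z' K') :
    K - K' = K * ((H' - z' • 1) - (H - z • 1)) * K' := by
  have e1 : K * (H - z • 1) * K' = K' := by
    conv_lhs => rw [← h'.proj_mul, ← mul_assoc, h.right_inv]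
    exact h'.proj_mul
  have e2 : K * (H' - z' • 1) * K' = K := by
    conv_lhs => rw [← h.mul_proj, mul_assoc K, mul_assoc K, h'.left_inv]
    exact h.mul_proj
  rw [mul_sub, sub_mul, e1, e2]

lemma IsCompRes.unique (h : IsCompRes P H z K) (h' : IsCompRes P H z K') : K = K' := by
  have := h.sub_eq h'
  rw [sub_self, mul_zero, zero_mul] at this
  exact sub_eq_zero.mp this

lemma IsCompRes.transpose (h : IsCompRes P H z K) (hH : Hᵀ = H) (hP : Pᵀ = P) : Kᵀ = K := by
  refine IsCompRes.unique (P := P) (H := H) (z := z) ⟨?_, ?_, ?_, ?_⟩ h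
  · conv_rhs => rw [← h.mul_proj, transpose_mul, hP]
  · conv_rhs => rw [← h.proj_mul, transpose_mul, hP]
  · have := congrArg Matrix.transpose h.right_inv
    simpa [transpose_mul, hP, hH, mul_assoc] using this
  · have := congrArg Matrix.transpose h.left_inv
    simpa [transpose_mul, hP, hH, mul_assoc] using this

lemma IsCompRes.conjTranspose (h : IsCompRes P H z K) (hH : Hᴴ = H) (hP : Pᴴ = P) :
    IsCompRes P H (star z) Kᴴ := by
  refine ⟨?_, ?_, ?_, ?_⟩
  · conv_rhs => rw [← h.mul_proj, conjTranspose_mul, hP]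
  · conv_rhs => rw [← h.proj_mul, conjTranspose_mul, hP]
  · have := congrArg Matrix.conjTranspose h.right_inv
    simpa [conjTranspose_mul, hP, hH, mul_assoc] using this
  · have := congrArg Matrix.conjTranspose h.left_inv
    simpa [conjTranspose_mul, hP, hH, mul_assoc] using this

lemma IsCompRes.mul_mul_self (h : IsCompRes P H z K) : K * H * K = z • (K * K) + K := by
  have e : K * (H - z • 1) * K = K := by
    have := h.proj_mul
    conv_lhs => rw [← this, ← mul_assoc, this, h.right_inv]
    exact this
  rw [mul_sub, sub_mul] at e
  simp only [mul_smul_comm, smul_mul_assoc, mul_one] at e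
  rw [← sub_eq_iff_eq_add', e]

lemma IsCompRes.trace_mul (h : IsCompRes P H z K) : (H * K).trace = P.trace + z * K.trace := by
  have e : ((H - z • 1) * K).trace = P.trace := by
    conv_lhs => rw [← h.mul_proj, ← mul_assoc, trace_mul_comm, ← mul_assoc, h.left_inv]
  rw [sub_mul, trace_sub, smul_mul_assoc, one_mul, trace_smul, smul_eq_mul] at e
  rw [← e]; ring

/-- The Ward identity. -/
lemma IsCompRes.ward (h : IsCompRes P H z K) (hH : Hᴴ = H) (hP : Pᴴ = P) (hK : Kᵀ = K)
    {f : n → ℂ} (hf : star f = f) :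
    (f ⬝ᵥ K *ᵥ f).im = z.im * ∑ b, ‖(K *ᵥ f) b‖ ^ 2 := by
  have e := h.sub_eq (h.conjTranspose hH hP)
  have e1 : (H - star z • (1 : Matrix n n ℂ)) - (H - z • 1) = (z - star z) • 1 := by
    rw [sub_smul]; abel
  rw [e1, mul_smul_comm, mul_one, smul_mul_assoc] at e
  have e2 := congrArg (fun M => f ⬝ᵥ M *ᵥ f) e
  have e0 : Kᴴ *ᵥ f = star (K *ᵥ f) := by
    funext a
    have hs : ∀ i, K i a = K a i := fun i => congrFun (congrFun hK a) i
    conv_lhs => rw [← hf]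
    simp [mulVec, dotProduct, hs]
  have e4 : f ⬝ᵥ (K * Kᴴ) *ᵥ f = ((∑ b, ‖(K *ᵥ f) b‖ ^ 2 : ℝ) : ℂ) := by
    rw [← mulVec_mulVec, dotProduct_mulVec, ← mulVec_transpose, hK, e0]
    simp [dotProduct, Complex.mul_conj']
  have e3 : f ⬝ᵥ Kᴴ *ᵥ f = star (f ⬝ᵥ K *ᵥ f) := by
    have hs : ∀ i, star (f i) = f i := fun i => congrFun hf i
    simp only [e0, dotProduct, star_sum, Pi.star_apply, star_mul', hs]
  simp only [sub_mulVec, dotProduct_sub, smul_mulVec, dotProduct_smul] at e2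
  rw [e3, e4] at e2
  have e5 := congrArg Complex.im e2
  simp at e5
  simp only [← Complex.ofReal_pow, Complex.ofReal_re] at e5
  linarith

end Resolvent

/-! ### Increment profiles over a finite set of moves -/

section Profile

/-- Bounds on the size, mean and second moment of an increment over the finite set `E`. -/
structure Prof {ι : Type*} (E : Finset ι) (D : ι → ℂ) (R mn v : ℝ) : Prop where
  sup : ∀ e ∈ E, ‖D e‖ ≤ R
  mean : ‖∑ e ∈ E, D e‖ ≤ E.card * mn
  sq : ∑ e ∈ E, ‖D e‖ ^ 2 ≤ E.card * v

variable {ι : Type*} {E : Finset ι}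

lemma Prof.add {D D' : ι → ℂ} {R mn v R' mn' v' : ℝ} (h : Prof E D R mn v)
    (h' : Prof E D' R' mn' v') :
    Prof E (fun e => D e + D' e) (R + R') (mn + mn') (2 * v + 2 * v') := by
  refine ⟨fun e he => (norm_add_le _ _).trans (add_le_add (h.sup e he) (h'.sup e he)), ?_, ?_⟩
  · rw [Finset.sum_add_distrib, mul_add]
    exact (norm_add_le _ _).trans (add_le_add h.mean h'.mean)
  · have : ∑ e ∈ E, ‖D e + D' e‖ ^ 2 ≤ ∑ e ∈ E, (2 * ‖D e‖ ^ 2 + 2 * ‖D' e‖ ^ 2) := by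
      refine Finset.sum_le_sum fun e _ => ?_
      have h1 := norm_add_le (D e) (D' e)
      nlinarith [sq_nonneg (‖D e‖ - ‖D' e‖), norm_nonneg (D e + D' e), norm_nonneg (D e),
        norm_nonneg (D' e)]
    rw [Finset.sum_add_distrib, ← Finset.mul_sum, ← Finset.mul_sum] at this
    linarith [h.sq, h'.sq]

lemma Prof.smul {D : ι → ℂ} {R mn v : ℝ} (h : Prof E D R mn v) (c : ℝ) :
    Prof E (fun e => (c : ℂ) * D e) (|c| * R) (|c| * mn) (c ^ 2 * v) := by
  refine ⟨fun e he => ?_, ?_, ?_⟩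
  · rw [norm_mul, Complex.norm_real, Real.norm_eq_abs]
    exact mul_le_mul_of_nonneg_left (h.sup e he) (abs_nonneg c)
  · rw [← Finset.mul_sum, norm_mul, Complex.norm_real, Real.norm_eq_abs]
    have := mul_le_mul_of_nonneg_left h.mean (abs_nonneg c)
    linarith
  · simp only [norm_mul, Complex.norm_real, Real.norm_eq_abs, mul_pow, sq_abs]
    rw [← Finset.mul_sum]
    have := mul_le_mul_of_nonneg_left h.sq (sq_nonneg c)
    linarith

lemma Prof.mono {D : ι → ℂ} {R mn v R' mn' v' : ℝ} (h : Prof E D R mn v) (hR : R ≤ R')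
    (hmn : mn ≤ mn') (hv : v ≤ v') : Prof E D R' mn' v' :=
  ⟨fun e he => (h.sup e he).trans hR,
    h.mean.trans (mul_le_mul_of_nonneg_left hmn (Nat.cast_nonneg _)),
    h.sq.trans (mul_le_mul_of_nonneg_left hv (Nat.cast_nonneg _))⟩

lemma Prof.congr {D D' : ι → ℂ} {R mn v : ℝ} (h : Prof E D R mn v)
    (hD : ∀ e ∈ E, D' e = D e) : Prof E D' R mn v := by
  refine ⟨fun e he => ?_, ?_, ?_⟩
  · rw [hD e he]; exact h.sup e he
  · rw [Finset.sum_congr rfl hD]; exact h.mean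
  · rw [Finset.sum_congr rfl fun e he => by rw [hD e he]]; exact h.sq

/-- Averages of increments. -/
lemma Prof.avg {κ : Type*} [Fintype κ] [Nonempty κ] {D : κ → ι → ℂ} {R v mn : ℝ} {μ : κ → ℝ}
    (h : ∀ a, Prof E (D a) R (μ a) v) (hμ : ∑ a, μ a ≤ Fintype.card κ * mn) :
    Prof E (fun e => (Fintype.card κ : ℂ)⁻¹ * ∑ a, D a e) R mn v := by
  have hc : (0 : ℝ) < Fintype.card κ := by exact_mod_cast Fintype.card_pos
  have hn : ∀ x : ℂ, ‖(Fintype.card κ : ℂ)⁻¹ * x‖ = (Fintype.card κ : ℝ)⁻¹ * ‖x‖ := by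
    intro x; simp
  refine ⟨fun e he => ?_, ?_, ?_⟩
  · rw [hn, inv_mul_le_iff₀ hc]
    refine (norm_sum_le _ _).trans ((Finset.sum_le_sum fun a _ => (h a).sup e he).trans ?_)
    simp
  · rw [← Finset.mul_sum, hn, inv_mul_le_iff₀ hc, Finset.sum_comm]
    refine (norm_sum_le _ _).trans ((Finset.sum_le_sum fun a _ => (h a).mean).trans ?_)
    rw [← Finset.mul_sum]
    have := mul_le_mul_of_nonneg_left hμ (Nat.cast_nonneg (α := ℝ) E.card)
    linarith
  · have h1 : ∀ e, ‖(Fintype.card κ : ℂ)⁻¹ * ∑ a, D a e‖ ^ 2 ≤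
        (Fintype.card κ : ℝ)⁻¹ * ∑ a, ‖D a e‖ ^ 2 := by
      intro e
      rw [hn, mul_pow]
      have h2 : ‖∑ a, D a e‖ ^ 2 ≤ (∑ a, ‖D a e‖) ^ 2 :=
        pow_le_pow_left₀ (norm_nonneg _) (norm_sum_le _ _) 2
      have h3 := sq_sum_le_card_mul_sum_sq (s := (Finset.univ : Finset κ))
        (f := fun a => ‖D a e‖)
      rw [Finset.card_univ] at h3
      calc _ ≤ ((Fintype.card κ : ℝ)⁻¹) ^ 2 * (Fintype.card κ * ∑ a, ‖D a e‖ ^ 2) :=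
            mul_le_mul_of_nonneg_left (h2.trans h3) (by positivity)
        _ = _ := by field_simp
    refine (Finset.sum_le_sum fun e _ => h1 e).trans ?_
    rw [← Finset.mul_sum, Finset.sum_comm, inv_mul_le_iff₀ hc]
    refine (Finset.sum_le_sum fun a _ => (h a).sq).trans ?_
    simp

lemma exp_le_quadratic (x : ℝ) : Real.exp x ≤ 1 + x + x ^ 2 * Real.exp |x| := by
  have h := Complex.norm_exp_sub_sum_le_norm_mul_exp (x:ℂ) 2
  simp only [Finset.sum_range_succ, Finset.sum_range_zero, pow_zero, Nat.factorial, pow_one,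
    Complex.norm_real, Real.norm_eq_abs, sq_abs] at h
  have h2 := (Complex.abs_re_le_norm _).trans h
  have h3 : (Complex.exp x - (0 + 1 / ((1 : ℕ) : ℂ) + (x : ℂ) / ((Nat.succ 0 * 1 : ℕ) : ℂ))).re =
      Real.exp x - (1 + x) := by
    simp [Complex.exp_ofReal_re]
  rw [h3] at h2
  linarith [(abs_le.mp h2).2]

/-- Exponential moment bound from an increment profile. -/
lemma Prof.exp_sum_le {D : ι → ℂ} {R mn v : ℝ} (h : Prof E D R mn v) {θ : ℝ} (hθ : 0 ≤ θ)
    {w : ℂ} (hw : ‖w‖ = 1) (c : ℝ) :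
    ∑ e ∈ E, Real.exp (θ * (w * D e).re + c) ≤
      E.card * Real.exp (c + (θ * mn + θ ^ 2 * v * Real.exp (θ * R))) := by
  have hre : ∀ x : ℂ, |(w * x).re| ≤ ‖x‖ := fun x =>
    (Complex.abs_re_le_norm _).trans (by rw [norm_mul, hw, one_mul])
  have h1 : ∀ e ∈ E, Real.exp (θ * (w * D e).re) ≤
      1 + θ * (w * D e).re + θ ^ 2 * Real.exp (θ * R) * ‖D e‖ ^ 2 := by
    intro e he
    refine (exp_le_quadratic _).trans ?_
    have h2 : |θ * (w * D e).re| ≤ θ * R := by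
      rw [abs_mul, abs_of_nonneg hθ]
      exact mul_le_mul_of_nonneg_left ((hre _).trans (h.sup e he)) hθ
    have h3 : (θ * (w * D e).re) ^ 2 ≤ θ ^ 2 * ‖D e‖ ^ 2 := by
      rw [mul_pow]
      refine mul_le_mul_of_nonneg_left ?_ (sq_nonneg θ)
      rw [← sq_abs]
      exact pow_le_pow_left₀ (abs_nonneg _) (hre _) 2
    have h4 := Real.exp_le_exp.mpr h2
    have h5 := mul_le_mul h3 h4 (Real.exp_pos _).le (by positivity)
    linarith
  have h6 : ∑ e ∈ E, Real.exp (θ * (w * D e).re) ≤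
      E.card * Real.exp (θ * mn + θ ^ 2 * v * Real.exp (θ * R)) := by
    refine (Finset.sum_le_sum h1).trans ?_
    rw [Finset.sum_add_distrib, Finset.sum_add_distrib, ← Finset.mul_sum, ← Finset.mul_sum,
      ← Complex.re_sum, ← Finset.mul_sum]
    have h7 : (w * ∑ e ∈ E, D e).re ≤ E.card * mn := (le_abs_self _).trans ((hre _).trans h.mean)
    have h8 := mul_le_mul_of_nonneg_left h7 hθ
    have h9 := mul_le_mul_of_nonneg_left h.sq
      (show 0 ≤ θ ^ 2 * Real.exp (θ * R) by positivity)
    have h10 := mul_le_mul_of_nonneg_left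
      (Real.add_one_le_exp (θ * mn + θ ^ 2 * v * Real.exp (θ * R)))
      (Nat.cast_nonneg (α := ℝ) E.card)
    simp only [Finset.sum_const, nsmul_eq_mul, mul_one]
    linarith
  simp only [Real.exp_add _ c]
  rw [← Finset.sum_mul, Real.exp_add c]
  have := mul_le_mul_of_nonneg_right h6 (Real.exp_pos c).le
  linarith

end Profile

/-! ### Increments of resolvent entries under a switching -/

section Increment

variable {n : Type*} [DecidableEq n]

/-- A vector whose values along the two ends of an edge are bounded, centred and small in mean
square. -/
structure EdgeVec (E : Finset (n × n)) (M r : ℝ) (φ : n → ℂ) : Prop where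
  sup : ∀ a, ‖φ a‖ ≤ M
  sum_fst : ∑ e ∈ E, φ e.1 = 0
  sum_snd : ∑ e ∈ E, φ e.2 = 0
  sq_fst : ∑ e ∈ E, ‖φ e.1‖ ^ 2 ≤ E.card * (M * r) ^ 2
  sq_snd : ∑ e ∈ E, ‖φ e.2‖ ^ 2 ≤ E.card * (M * r) ^ 2

/-- The set of moves `E`, the valid moves `V`, and the scales entering the estimates. -/
structure MoveSetup (E V : Finset (n × n)) (δ r M : ℝ) (K : n → n → ℂ) : Prop where
  sub : V ⊆ E
  δ_pos : 0 < δ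
  δ_le : δ ≤ r
  r_le : r ≤ 1
  one_le : 1 ≤ M
  small : 8 * δ * M ≤ 1
  inv : ((E \ V).card : ℝ) ≤ E.card * (4 * r * δ)
  K_le : ∀ a b, ‖K a b‖ ≤ M
  K_edge : ‖∑ e ∈ E, K e.1 e.2‖ ≤ E.card * (2 * δ * M)

/-- The vector `ψ'` solves the perturbation equation of a switching at `k` along `e`. -/
def SwitchRel (δ : ℝ) (K : n → n → ℂ) (k : n) (ψ ψ' : n → ℂ) (e : n × n) : Prop :=
  ∀ a, ψ' a = ψ a + δ * (K a e.2 * (ψ' e.1 - ψ' k) + (K a e.1 - K a k) * ψ' e.2)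

variable {E V : Finset (n × n)} {δ r M : ℝ} {K : n → n → ℂ} {φ ψ : n → ℂ} {k : n}

lemma sum_norm_le_of_sq {n : Type*} {E : Finset (n × n)} {f : n × n → ℂ} {c : ℝ} (hc : 0 ≤ c)
    (h : ∑ e ∈ E, ‖f e‖ ^ 2 ≤ E.card * c ^ 2) : ∑ e ∈ E, ‖f e‖ ≤ E.card * c := by
  have h1 := sq_sum_le_card_mul_sum_sq (s := E) (f := fun e => ‖f e‖)
  refine abs_le_of_sq_le_sq' ?_ (by positivity) |>.2
  calc _ ≤ _ := h1
    _ ≤ E.card * (E.card * c ^ 2) := mul_le_mul_of_nonneg_left h (Nat.cast_nonneg _)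
    _ = _ := by ring

lemma MoveSetup.norm_le_two_mul [Finite n] (S : MoveSetup E V δ r M K) {ψ' : n → ℂ} {e : n × n}
    (hψ : ∀ a, ‖ψ a‖ ≤ M) (h : SwitchRel δ K k ψ ψ' e) (a : n) : ‖ψ' a‖ ≤ 2 * M := by
  have : Nonempty n := ⟨a⟩
  obtain ⟨b, hb⟩ := Finite.exists_max fun a => ‖ψ' a‖
  refine (hb a).trans ?_
  have hδ := S.δ_pos
  have h1 : ‖ψ' b‖ ≤ M + δ * (M * (‖ψ' b‖ + ‖ψ' b‖) + (M + M) * ‖ψ' b‖) := by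
    conv_lhs => rw [h b]
    refine (norm_add_le _ _).trans (add_le_add (hψ b) ?_)
    rw [norm_mul, Complex.norm_real, Real.norm_eq_abs, abs_of_pos hδ]
    refine mul_le_mul_of_nonneg_left ?_ hδ.le
    refine (norm_add_le _ _).trans (add_le_add ?_ ?_)
    · rw [norm_mul]
      exact mul_le_mul (S.K_le _ _) ((norm_sub_le _ _).trans (add_le_add (hb _) (hb _)))
        (norm_nonneg _) (by linarith [S.one_le])
    · rw [norm_mul]
      exact mul_le_mul ((norm_sub_le _ _).trans (add_le_add (S.K_le _ _) (S.K_le _ _))) (hb _)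
        (norm_nonneg _) (by linarith [S.one_le])
  have h2 : 8 * δ * M * ‖ψ' b‖ ≤ 1 * ‖ψ' b‖ :=
    mul_le_mul_of_nonneg_right S.small (norm_nonneg _)
  nlinarith

lemma MoveSetup.norm_sub_le' [Finite n] (S : MoveSetup E V δ r M K) {ψ' : n → ℂ} {e : n × n}
    (hψ : ∀ a, ‖ψ a‖ ≤ M) (h : SwitchRel δ K k ψ ψ' e) (a : n) :
    ‖ψ' a - ψ a‖ ≤ 8 * δ * M ^ 2 := by
  have hb := S.norm_le_two_mul hψ h
  have hδ := S.δ_pos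
  have hM := S.one_le
  rw [h a, add_sub_cancel_left, norm_mul, Complex.norm_real, Real.norm_eq_abs, abs_of_pos hδ]
  have h1 : ‖K a e.2 * (ψ' e.1 - ψ' k)‖ ≤ M * (2 * M + 2 * M) := by
    rw [norm_mul]
    exact mul_le_mul (S.K_le _ _) ((norm_sub_le _ _).trans (add_le_add (hb _) (hb _)))
      (norm_nonneg _) (by linarith)
  have h2 : ‖(K a e.1 - K a k) * ψ' e.2‖ ≤ (M + M) * (2 * M) := by
    rw [norm_mul]
    exact mul_le_mul ((norm_sub_le _ _).trans (add_le_add (S.K_le _ _) (S.K_le _ _))) (hb _)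
      (norm_nonneg _) (by linarith)
  have h3 := (norm_add_le (K a e.2 * (ψ' e.1 - ψ' k)) ((K a e.1 - K a k) * ψ' e.2)).trans
    (add_le_add h1 h2)
  nlinarith [mul_le_mul_of_nonneg_left h3 hδ.le]

/-- The refined perturbation bound, keeping track of the vector at the edge and at `k`. -/
lemma MoveSetup.norm_sub_le_refined [Finite n] (S : MoveSetup E V δ r M K) {ψ' : n → ℂ}
    {e : n × n} (hψ : ∀ a, ‖ψ a‖ ≤ M) (h : SwitchRel δ K k ψ ψ' e) (a : n) :
    ‖ψ' a - ψ a‖ ≤ δ * M * (‖ψ e.1‖ + ‖ψ k‖ + 2 * ‖ψ e.2‖ + 32 * δ * M ^ 2) := by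
  have hb : ∀ c, ‖ψ' c‖ ≤ ‖ψ c‖ + 8 * δ * M ^ 2 := fun c => by
    have h1 := S.norm_sub_le' hψ h c
    have h2 := norm_add_le (ψ c) (ψ' c - ψ c)
    rw [add_sub_cancel] at h2
    linarith
  have hδ := S.δ_pos
  have hM := S.one_le
  conv_lhs => rw [h a]
  rw [add_sub_cancel_left, norm_mul, Complex.norm_real, Real.norm_eq_abs, abs_of_pos hδ]
  have h1 : ‖K a e.2 * (ψ' e.1 - ψ' k)‖ ≤ M * ((‖ψ e.1‖ + 8 * δ * M ^ 2) +
      (‖ψ k‖ + 8 * δ * M ^ 2)) := by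
    rw [norm_mul]
    exact mul_le_mul (S.K_le _ _) ((norm_sub_le _ _).trans (add_le_add (hb _) (hb _)))
      (norm_nonneg _) (by linarith)
  have h2 : ‖(K a e.1 - K a k) * ψ' e.2‖ ≤ (M + M) * (‖ψ e.2‖ + 8 * δ * M ^ 2) := by
    rw [norm_mul]
    exact mul_le_mul ((norm_sub_le _ _).trans (add_le_add (S.K_le _ _) (S.K_le _ _))) (hb _)
      (norm_nonneg _) (by linarith)
  have h3 := (norm_add_le (K a e.2 * (ψ' e.1 - ψ' k)) ((K a e.1 - K a k) * ψ' e.2)).trans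
    (add_le_add h1 h2)
  nlinarith [mul_le_mul_of_nonneg_left h3 hδ.le]



lemma sum_indicator (S : MoveSetup E V δ r M K) (f : n × n → ℂ) :
    ∑ e ∈ E, (if e ∈ V then f e else 0) = ∑ e ∈ V, f e := by
  rw [← Finset.sum_filter, Finset.filter_mem_eq_inter, Finset.inter_eq_right.mpr S.sub]

/-- Increments supported on the invalid moves. -/
lemma MoveSetup.prof_invalid (S : MoveSetup E V δ r M K) {f : n × n → ℂ} {c : ℝ} (hc : 0 ≤ c)
    (hf : ∀ e ∈ E, ‖f e‖ ≤ c * δ) :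
    Prof E (fun e => if e ∈ V then 0 else f e) (c * δ) (δ ^ 2 * (4 * c * r))
      (4 * c ^ 2 * δ ^ 2 * r ^ 2) := by
  have hδ := S.δ_pos
  have hr : 0 < r := hδ.trans_le S.δ_le
  have key : ∀ g : n × n → ℝ, ∑ e ∈ E, (if e ∈ V then 0 else g e) = ∑ e ∈ E \ V, g e := by
    intro g
    rw [← Finset.filter_notMem_eq_sdiff, Finset.sum_filter]
    exact Finset.sum_congr rfl fun e _ => by by_cases h : e ∈ V <;> simp [h]
  refine ⟨fun e he => ?_, ?_, ?_⟩
  · split_ifs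
    · simp; positivity
    · exact hf e he
  · refine (norm_sum_le _ _).trans ?_
    have : ∀ e, ‖(if e ∈ V then 0 else f e : ℂ)‖ = if e ∈ V then 0 else ‖f e‖ := fun e => by
      split_ifs <;> simp
    simp only [this]
    rw [key]
    refine (Finset.sum_le_card_nsmul _ _ (c * δ)
      fun e he => hf e (Finset.mem_sdiff.mp he).1).trans ?_
    rw [nsmul_eq_mul]
    have := mul_le_mul_of_nonneg_right S.inv (show 0 ≤ c * δ by positivity)
    linarith
  · have : ∀ e, ‖(if e ∈ V then 0 else f e : ℂ)‖ ^ 2 = if e ∈ V then 0 else ‖f e‖ ^ 2 :=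
      fun e => by split_ifs <;> simp
    simp only [this]
    rw [key]
    refine (Finset.sum_le_card_nsmul _ _ ((c * δ) ^ 2)
      fun e he => pow_le_pow_left₀ (norm_nonneg _) (hf e (Finset.mem_sdiff.mp he).1) 2).trans ?_
    rw [nsmul_eq_mul]
    have h1 := mul_le_mul_of_nonneg_right S.inv (show 0 ≤ (c * δ) ^ 2 by positivity)
    refine h1.trans ?_
    have h2 : (E.card : ℝ) * (4 * r * δ) * (c * δ) ^ 2 = E.card * (4 * c ^ 2 * δ ^ 2 * r * δ) := by
      ring
    rw [h2]
    refine mul_le_mul_of_nonneg_left ?_ (Nat.cast_nonneg _)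
    have := mul_le_mul_of_nonneg_left S.δ_le (show 0 ≤ 4 * c ^ 2 * δ ^ 2 * r by positivity)
    linarith

/-- The increment of a bilinear form of the resolvent under a switching. -/
lemma MoveSetup.prof_bilin [Finite n] (S : MoveSetup E V δ r M K) (hφ : EdgeVec E M r φ)
    (hψ : EdgeVec E M r ψ) (h1 : ‖∑ e ∈ E, φ e.2 * ψ e.1‖ ≤ E.card * (2 * δ * M ^ 2 * r ^ 2))
    (h2 : ‖∑ e ∈ E, φ e.1 * ψ e.2‖ ≤ E.card * (2 * δ * M ^ 2 * r ^ 2))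
    {ψ' : n × n → n → ℂ} (hψ' : ∀ e ∈ V, SwitchRel δ K k ψ (ψ' e) e) :
    Prof E (fun e => if e ∈ V then
        δ * (φ e.2 * (ψ' e e.1 - ψ' e k) + (φ e.1 - φ k) * ψ' e e.2) else 0)
      (8 * M ^ 2 * δ) (δ ^ 2 * (80 * M ^ 4 * r + M * ‖φ k‖ * ‖ψ k‖))
      (340 * M ^ 6 * δ ^ 2 * r ^ 2) := by
  have hδ := S.δ_pos
  have hM := S.one_le
  have hM0 : 0 < M := by linarith
  have hr : 0 < r := hδ.trans_le S.δ_le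
  have hδr := S.δ_le
  have nδ : ‖(δ : ℂ)‖ = δ := by rw [Complex.norm_real, Real.norm_eq_abs, abs_of_pos hδ]
  set T : n × n → ℂ := fun e => φ e.2 * (ψ' e e.1 - ψ' e k) + (φ e.1 - φ k) * ψ' e e.2 with hT
  set T0 : n × n → ℂ := fun e => φ e.2 * (ψ e.1 - ψ k) + (φ e.1 - φ k) * ψ e.2 with hT0
  have b1 : ∀ e ∈ V, ∀ a, ‖ψ' e a‖ ≤ 2 * M := fun e he => S.norm_le_two_mul hψ.sup (hψ' e he)
  have b2 : ∀ e ∈ V, ∀ a, ‖ψ' e a - ψ a‖ ≤ 8 * δ * M ^ 2 :=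
    fun e he => S.norm_sub_le' hψ.sup (hψ' e he)
  have b3 : ∀ e ∈ V, ∀ a, ‖ψ' e a - ψ a‖ ≤
      δ * M * (‖ψ e.1‖ + ‖ψ k‖ + 2 * ‖ψ e.2‖ + 32 * δ * M ^ 2) :=
    fun e he => S.norm_sub_le_refined hψ.sup (hψ' e he)
  have tb : ∀ e ∈ V, ‖T e‖ ≤ 4 * M * ‖φ e.2‖ + 2 * M * ‖φ e.1‖ + M * ‖ψ e.2‖ + 8 * δ * M ^ 3 := by
    intro e he
    have e1 : ‖φ e.2 * (ψ' e e.1 - ψ' e k)‖ ≤ ‖φ e.2‖ * (2 * M + 2 * M) := by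
      rw [norm_mul]
      exact mul_le_mul_of_nonneg_left
        ((norm_sub_le _ _).trans (add_le_add (b1 e he _) (b1 e he _))) (norm_nonneg _)
    have e2 : ‖φ e.1 * ψ' e e.2‖ ≤ ‖φ e.1‖ * (2 * M) := by
      rw [norm_mul]
      exact mul_le_mul_of_nonneg_left (b1 e he _) (norm_nonneg _)
    have e4 : ‖ψ' e e.2‖ ≤ ‖ψ e.2‖ + 8 * δ * M ^ 2 := by
      have h2 := norm_add_le (ψ e.2) (ψ' e e.2 - ψ e.2)
      rw [add_sub_cancel] at h2
      linarith [b2 e he e.2]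
    have e3 : ‖φ k * ψ' e e.2‖ ≤ M * (‖ψ e.2‖ + 8 * δ * M ^ 2) := by
      rw [norm_mul]
      exact mul_le_mul (hφ.sup k) e4 (norm_nonneg _) hM0.le
    have e5 : T e = φ e.2 * (ψ' e e.1 - ψ' e k) + (φ e.1 * ψ' e e.2 - φ k * ψ' e e.2) := by
      simp only [hT]; ring
    rw [e5]
    have := (norm_add_le (φ e.2 * (ψ' e e.1 - ψ' e k)) (φ e.1 * ψ' e e.2 - φ k * ψ' e e.2)).trans
      (add_le_add_right (norm_sub_le _ _) _)
    linarith
  have tsup : ∀ e ∈ V, ‖T e‖ ≤ 8 * M ^ 2 := by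
    intro e he
    have h1 := tb e he
    have h2 := hφ.sup e.1
    have h3 := hφ.sup e.2
    have h4 := hψ.sup e.2
    have h5 := mul_le_mul_of_nonneg_right S.small (show 0 ≤ M ^ 2 by positivity)
    nlinarith
  refine ⟨fun e he => ?_, ?_, ?_⟩
  · split_ifs with hv
    · rw [norm_mul, nδ]
      nlinarith [tsup e hv]
    · simp; positivity
  · rw [sum_indicator S, ← Finset.mul_sum, norm_mul, nδ]
    have sφ2 := sum_norm_le_of_sq (f := fun e => φ e.2) (by positivity) hφ.sq_snd
    have sφ1 := sum_norm_le_of_sq (f := fun e => φ e.1) (by positivity) hφ.sq_fst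
    have sψ2 := sum_norm_le_of_sq (f := fun e => ψ e.2) (by positivity) hψ.sq_snd
    have sψ1 := sum_norm_le_of_sq (f := fun e => ψ e.1) (by positivity) hψ.sq_fst
    have d1 : ∀ e ∈ V, ‖T e - T0 e‖ ≤ 16 * δ * M ^ 2 * ‖φ e.2‖ + 8 * δ * M ^ 2 * ‖φ e.1‖ +
        δ * M ^ 2 * ‖ψ e.1‖ + 2 * δ * M ^ 2 * ‖ψ e.2‖ +
        (32 * δ ^ 2 * M ^ 4 + δ * M * ‖φ k‖ * ‖ψ k‖) := by
      intro e he
      have e5 : T e - T0 e = φ e.2 * ((ψ' e e.1 - ψ e.1) - (ψ' e k - ψ k)) +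
          (φ e.1 * (ψ' e e.2 - ψ e.2) - φ k * (ψ' e e.2 - ψ e.2)) := by
        simp only [hT, hT0]; ring
      rw [e5]
      have e1 : ‖φ e.2 * ((ψ' e e.1 - ψ e.1) - (ψ' e k - ψ k))‖ ≤
          ‖φ e.2‖ * (8 * δ * M ^ 2 + 8 * δ * M ^ 2) := by
        rw [norm_mul]
        exact mul_le_mul_of_nonneg_left
          ((norm_sub_le _ _).trans (add_le_add (b2 e he _) (b2 e he _))) (norm_nonneg _)
      have e2 : ‖φ e.1 * (ψ' e e.2 - ψ e.2)‖ ≤ ‖φ e.1‖ * (8 * δ * M ^ 2) := by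
        rw [norm_mul]
        exact mul_le_mul_of_nonneg_left (b2 e he _) (norm_nonneg _)
      have e3 : ‖φ k * (ψ' e e.2 - ψ e.2)‖ ≤
          ‖φ k‖ * (δ * M * (‖ψ e.1‖ + ‖ψ k‖ + 2 * ‖ψ e.2‖ + 32 * δ * M ^ 2)) := by
        rw [norm_mul]
        exact mul_le_mul_of_nonneg_left (b3 e he _) (norm_nonneg _)
      have e4 : ‖φ k‖ * (δ * M * (‖ψ e.1‖ + 2 * ‖ψ e.2‖ + 32 * δ * M ^ 2)) ≤
          M * (δ * M * (‖ψ e.1‖ + 2 * ‖ψ e.2‖ + 32 * δ * M ^ 2)) :=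
        mul_le_mul_of_nonneg_right (hφ.sup k) (by positivity)
      have := (norm_add_le (φ e.2 * ((ψ' e e.1 - ψ e.1) - (ψ' e k - ψ k)))
        (φ e.1 * (ψ' e e.2 - ψ e.2) - φ k * (ψ' e e.2 - ψ e.2))).trans
        (add_le_add_right (norm_sub_le _ _) _)
      linarith
    have d2 : ‖∑ e ∈ V, (T e - T0 e)‖ ≤ E.card * (16 * δ * M ^ 2 * (M * r) +
        8 * δ * M ^ 2 * (M * r) + δ * M ^ 2 * (M * r) + 2 * δ * M ^ 2 * (M * r) +
        (32 * δ ^ 2 * M ^ 4 + δ * M * ‖φ k‖ * ‖ψ k‖)) := by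
      refine (norm_sum_le _ _).trans ((Finset.sum_le_sum d1).trans
        ((Finset.sum_le_sum_of_subset_of_nonneg S.sub fun e _ _ => by positivity).trans ?_))
      simp only [Finset.sum_add_distrib, ← Finset.mul_sum, Finset.sum_const, nsmul_eq_mul]
      have := mul_le_mul_of_nonneg_left sφ2 (show 0 ≤ 16 * δ * M ^ 2 by positivity)
      have := mul_le_mul_of_nonneg_left sφ1 (show 0 ≤ 8 * δ * M ^ 2 by positivity)
      have := mul_le_mul_of_nonneg_left sψ1 (show 0 ≤ δ * M ^ 2 by positivity)
      have := mul_le_mul_of_nonneg_left sψ2 (show 0 ≤ 2 * δ * M ^ 2 by positivity)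
      linarith
    have d3 : ‖∑ e ∈ E, T0 e‖ ≤ E.card * (4 * δ * M ^ 2 * r ^ 2) := by
      have : ∑ e ∈ E, T0 e = ∑ e ∈ E, φ e.2 * ψ e.1 + ∑ e ∈ E, φ e.1 * ψ e.2 := by
        have h3 : ∀ e, T0 e = φ e.2 * ψ e.1 + φ e.1 * ψ e.2 - (φ e.2 * ψ k + φ k * ψ e.2) := by
          intro e; simp only [hT0]; ring
        simp only [h3, Finset.sum_sub_distrib, Finset.sum_add_distrib, ← Finset.mul_sum,
          ← Finset.sum_mul, hφ.sum_snd, hψ.sum_snd]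
        ring
      rw [this]
      refine (norm_add_le _ _).trans ?_
      linarith
    have d4 : ‖∑ e ∈ E \ V, T0 e‖ ≤ E.card * (4 * r * δ) * (4 * M ^ 2) := by
      refine (norm_sum_le _ _).trans ((Finset.sum_le_card_nsmul _ _ (4 * M ^ 2) ?_).trans ?_)
      · intro e _
        have e1 : ‖φ e.2 * (ψ e.1 - ψ k)‖ ≤ M * (M + M) := by
          rw [norm_mul]
          exact mul_le_mul (hφ.sup _) ((norm_sub_le _ _).trans (add_le_add (hψ.sup _) (hψ.sup _)))
            (norm_nonneg _) hM0.le
        have e2 : ‖(φ e.1 - φ k) * ψ e.2‖ ≤ (M + M) * M := by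
          rw [norm_mul]
          exact mul_le_mul ((norm_sub_le _ _).trans (add_le_add (hφ.sup _) (hφ.sup _)))
            (hψ.sup _) (norm_nonneg _) (by linarith)
        refine (norm_add_le _ _).trans ((add_le_add e1 e2).trans (by nlinarith))
      · rw [nsmul_eq_mul]
        exact mul_le_mul_of_nonneg_right S.inv (by positivity)
    have d5 : ∑ e ∈ V, T e = ∑ e ∈ V, (T e - T0 e) + (∑ e ∈ E, T0 e - ∑ e ∈ E \ V, T0 e) := by
      rw [Finset.sum_sub_distrib, ← Finset.sum_sdiff S.sub (f := T0)]
      ring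
    rw [d5]
    have d6 := (norm_add_le (∑ e ∈ V, (T e - T0 e)) (∑ e ∈ E, T0 e - ∑ e ∈ E \ V, T0 e)).trans
        (add_le_add_right (norm_sub_le _ _) _)
    have d7 : ‖∑ e ∈ V, (T e - T0 e) + (∑ e ∈ E, T0 e - ∑ e ∈ E \ V, T0 e)‖ ≤
        E.card * (δ * (80 * M ^ 4 * r + M * ‖φ k‖ * ‖ψ k‖)) := by
      have p1 : M ^ 3 ≤ M ^ 4 := pow_le_pow_right₀ hM (by norm_num)
      have p2 : M ^ 2 ≤ M ^ 4 := pow_le_pow_right₀ hM (by norm_num)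
      have p3 : r ^ 2 ≤ r := by nlinarith [S.r_le]
      have q1 : M ^ 2 * r ^ 2 ≤ M ^ 4 * r := mul_le_mul p2 p3 (by positivity) (by positivity)
      have q2 : M ^ 4 * δ ≤ M ^ 4 * r := mul_le_mul_of_nonneg_left hδr (by positivity)
      have q3 : M ^ 3 * r ≤ M ^ 4 * r := mul_le_mul_of_nonneg_right p1 hr.le
      have q4 : M ^ 2 * r ≤ M ^ 4 * r := mul_le_mul_of_nonneg_right p2 hr.le
      have q5 : 27 * (M ^ 3 * r) + 32 * (M ^ 4 * δ) + 4 * (M ^ 2 * r ^ 2) + 16 * (M ^ 2 * r) +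
          M * ‖φ k‖ * ‖ψ k‖ ≤ 80 * M ^ 4 * r + M * ‖φ k‖ * ‖ψ k‖ := by
        have : 0 ≤ M ^ 4 * r := by positivity
        linarith
      have q6 := mul_le_mul_of_nonneg_left (mul_le_mul_of_nonneg_left q5 hδ.le)
        (Nat.cast_nonneg (α := ℝ) E.card)
      refine (d6.trans (add_le_add d2 (add_le_add d3 d4))).trans ?_
      linarith
    have := mul_le_mul_of_nonneg_left d7 hδ.le
    linarith
  · have e1 : ∀ e, ‖(if e ∈ V then (δ : ℂ) * T e else 0)‖ ^ 2 ≤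
        δ ^ 2 * (4 * (16 * M ^ 2 * ‖φ e.2‖ ^ 2 + 4 * M ^ 2 * ‖φ e.1‖ ^ 2 + M ^ 2 * ‖ψ e.2‖ ^ 2 +
          64 * δ ^ 2 * M ^ 6)) := by
      intro e
      split_ifs with hv
      · rw [norm_mul, nδ, mul_pow]
        refine mul_le_mul_of_nonneg_left ?_ (sq_nonneg δ)
        refine (pow_le_pow_left₀ (norm_nonneg _) (tb e hv) 2).trans ?_
        have key : ∀ a b c d : ℝ, (a + b + c + d) ^ 2 ≤ 4 * (a ^ 2 + b ^ 2 + c ^ 2 + d ^ 2) := by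
          intro a b c d
          nlinarith [sq_nonneg (a - b), sq_nonneg (a - c), sq_nonneg (a - d), sq_nonneg (b - c),
            sq_nonneg (b - d), sq_nonneg (c - d)]
        refine (key _ _ _ _).trans (le_of_eq (by ring))
      · simp; positivity
    refine (Finset.sum_le_sum fun e _ => e1 e).trans ?_
    rw [← Finset.mul_sum, ← Finset.mul_sum]
    simp only [Finset.sum_add_distrib, ← Finset.mul_sum, Finset.sum_const, nsmul_eq_mul]
    have f1 := mul_le_mul_of_nonneg_left hφ.sq_snd (show 0 ≤ 16 * M ^ 2 by positivity)
    have f2 := mul_le_mul_of_nonneg_left hφ.sq_fst (show 0 ≤ 4 * M ^ 2 by positivity)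
    have f3 := mul_le_mul_of_nonneg_left hψ.sq_snd (show 0 ≤ M ^ 2 by positivity)
    have p1 : M ^ 4 * r ^ 2 ≤ M ^ 6 * r ^ 2 :=
      mul_le_mul_of_nonneg_right (pow_le_pow_right₀ hM (by norm_num)) (by positivity)
    have p2 : δ ^ 2 * M ^ 6 ≤ M ^ 6 * r ^ 2 := by
      rw [mul_comm]
      exact mul_le_mul_of_nonneg_left (pow_le_pow_left₀ hδ.le hδr 2) (by positivity)
    have f4 : 84 * (M ^ 4 * r ^ 2) + 256 * (δ ^ 2 * M ^ 6) ≤ 340 * (M ^ 6 * r ^ 2) := by linarith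
    have f5 := mul_le_mul_of_nonneg_left f4 (show 0 ≤ (E.card : ℝ) * δ ^ 2 by positivity)
    have f6 := mul_le_mul_of_nonneg_left (add_le_add (add_le_add f1 f2) f3)
      (show 0 ≤ 4 * δ ^ 2 by positivity)
    linarith

/-- The value at the new neighbour of a resolvent vector after a switching. -/
lemma MoveSetup.prof_new [Finite n] (S : MoveSetup E V δ r M K) (hψ : EdgeVec E M r ψ)
    {ψ' : n × n → n → ℂ} (hψ' : ∀ e ∈ V, SwitchRel δ K k ψ (ψ' e) e) :
    Prof E (fun e => if e ∈ V then δ * ψ' e e.1 else 0)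
      (2 * M * δ) (δ ^ 2 * (50 * M ^ 3 * r)) (130 * M ^ 4 * δ ^ 2 * r ^ 2) := by
  have hδ := S.δ_pos
  have hM := S.one_le
  have hM0 : 0 < M := by linarith
  have hr : 0 < r := hδ.trans_le S.δ_le
  have hδr := S.δ_le
  have nδ : ‖(δ : ℂ)‖ = δ := by rw [Complex.norm_real, Real.norm_eq_abs, abs_of_pos hδ]
  have b1 : ∀ e ∈ V, ∀ a, ‖ψ' e a‖ ≤ 2 * M := fun e he => S.norm_le_two_mul hψ.sup (hψ' e he)
  have b2 : ∀ e ∈ V, ∀ a, ‖ψ' e a - ψ a‖ ≤ 8 * δ * M ^ 2 :=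
    fun e he => S.norm_sub_le' hψ.sup (hψ' e he)
  have b4 : ∀ e ∈ V, ∀ a, ‖ψ' e a‖ ≤ ‖ψ a‖ + 8 * δ * M ^ 2 := fun e he a => by
    have h2 := norm_add_le (ψ a) (ψ' e a - ψ a)
    rw [add_sub_cancel] at h2
    linarith [b2 e he a]
  refine ⟨fun e he => ?_, ?_, ?_⟩
  · split_ifs with hv
    · rw [norm_mul, nδ]
      nlinarith [b1 e hv e.1]
    · simp; positivity
  · rw [sum_indicator S (fun e => δ * ψ' e e.1), ← Finset.mul_sum, norm_mul, nδ]
    have sψ2 := sum_norm_le_of_sq (f := fun e => ψ e.2) (by positivity) hψ.sq_snd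
    have sψ1 := sum_norm_le_of_sq (f := fun e => ψ e.1) (by positivity) hψ.sq_fst
    set T0 : n × n → ℂ := fun e => ψ e.1 - δ * (K e.1 e.2 * ψ k) with hT0
    have d1 : ∀ e ∈ V, ‖ψ' e e.1 - T0 e‖ ≤ δ * M * ‖ψ e.1‖ + 2 * δ * M * ‖ψ e.2‖ +
        32 * δ ^ 2 * M ^ 3 := by
      intro e he
      have e5 : ψ' e e.1 - T0 e = δ * (K e.1 e.2 * (ψ' e e.1 - (ψ' e k - ψ k)) +
          (K e.1 e.1 - K e.1 k) * ψ' e e.2) := by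
        simp only [hT0]
        linear_combination hψ' e he e.1
      rw [e5, norm_mul, nδ]
      have e1 : ‖K e.1 e.2 * (ψ' e e.1 - (ψ' e k - ψ k))‖ ≤
          M * ((‖ψ e.1‖ + 8 * δ * M ^ 2) + 8 * δ * M ^ 2) := by
        rw [norm_mul]
        exact mul_le_mul (S.K_le _ _)
          ((norm_sub_le _ _).trans (add_le_add (b4 e he _) (b2 e he _))) (norm_nonneg _) hM0.le
      have e2 : ‖(K e.1 e.1 - K e.1 k) * ψ' e e.2‖ ≤ (M + M) * (‖ψ e.2‖ + 8 * δ * M ^ 2) := by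
        rw [norm_mul]
        exact mul_le_mul ((norm_sub_le _ _).trans (add_le_add (S.K_le _ _) (S.K_le _ _)))
          (b4 e he _) (norm_nonneg _) (by linarith)
      have := mul_le_mul_of_nonneg_left ((norm_add_le (K e.1 e.2 * (ψ' e e.1 - (ψ' e k - ψ k)))
        ((K e.1 e.1 - K e.1 k) * ψ' e e.2)).trans (add_le_add e1 e2)) hδ.le
      linarith
    have d2 : ‖∑ e ∈ V, (ψ' e e.1 - T0 e)‖ ≤ E.card * (δ * M * (M * r) +
        2 * δ * M * (M * r) + 32 * δ ^ 2 * M ^ 3) := by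
      refine (norm_sum_le _ _).trans ((Finset.sum_le_sum d1).trans
        ((Finset.sum_le_sum_of_subset_of_nonneg S.sub fun e _ _ => by positivity).trans ?_))
      simp only [Finset.sum_add_distrib, ← Finset.mul_sum, Finset.sum_const, nsmul_eq_mul]
      have := mul_le_mul_of_nonneg_left sψ1 (show 0 ≤ δ * M by positivity)
      have := mul_le_mul_of_nonneg_left sψ2 (show 0 ≤ 2 * δ * M by positivity)
      linarith
    have d3 : ‖∑ e ∈ E, T0 e‖ ≤ E.card * (2 * δ ^ 2 * M ^ 2) := by
      simp only [hT0, Finset.sum_sub_distrib, ← Finset.mul_sum, ← Finset.sum_mul, hψ.sum_fst,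
        zero_sub, norm_neg, norm_mul, nδ]
      have := mul_le_mul S.K_edge (hψ.sup k) (norm_nonneg _) (by positivity)
      have := mul_le_mul_of_nonneg_left this hδ.le
      linarith
    have d4 : ‖∑ e ∈ E \ V, T0 e‖ ≤ E.card * (4 * r * δ) * (2 * M) := by
      refine (norm_sum_le _ _).trans ((Finset.sum_le_card_nsmul _ _ (2 * M) ?_).trans ?_)
      · intro e _
        have e1 : ‖K e.1 e.2 * ψ k‖ ≤ M * M := by
          rw [norm_mul]
          exact mul_le_mul (S.K_le _ _) (hψ.sup _) (norm_nonneg _) hM0.le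
        have e2 : ‖(δ : ℂ) * (K e.1 e.2 * ψ k)‖ ≤ M := by
          rw [norm_mul, nδ]
          nlinarith [S.small]
        refine (norm_sub_le _ _).trans ((add_le_add (hψ.sup _) e2).trans (by linarith))
      · rw [nsmul_eq_mul]
        exact mul_le_mul_of_nonneg_right S.inv (by positivity)
    have d5 : ∑ e ∈ V, ψ' e e.1 =
        ∑ e ∈ V, (ψ' e e.1 - T0 e) + (∑ e ∈ E, T0 e - ∑ e ∈ E \ V, T0 e) := by
      rw [Finset.sum_sub_distrib, ← Finset.sum_sdiff S.sub (f := T0)]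
      ring
    rw [d5]
    have d6 := (norm_add_le (∑ e ∈ V, (ψ' e e.1 - T0 e))
      (∑ e ∈ E, T0 e - ∑ e ∈ E \ V, T0 e)).trans (add_le_add_right (norm_sub_le _ _) _)
    have d7 : ‖∑ e ∈ V, (ψ' e e.1 - T0 e) + (∑ e ∈ E, T0 e - ∑ e ∈ E \ V, T0 e)‖ ≤
        E.card * (δ * (50 * M ^ 3 * r)) := by
      have p1 : M ^ 2 ≤ M ^ 3 := pow_le_pow_right₀ hM (by norm_num)
      have p2 : M ≤ M ^ 3 := le_self_pow₀ hM (by norm_num)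
      have q1 : M ^ 2 * r ≤ M ^ 3 * r := mul_le_mul_of_nonneg_right p1 hr.le
      have q2 : M * r ≤ M ^ 3 * r := mul_le_mul_of_nonneg_right p2 hr.le
      have q3 : M ^ 3 * δ ≤ M ^ 3 * r := mul_le_mul_of_nonneg_left hδr (by positivity)
      have q4 : M ^ 2 * δ ≤ M ^ 3 * r := mul_le_mul p1 hδr hδ.le (by positivity)
      have q5 : 3 * (M ^ 2 * r) + 32 * (M ^ 3 * δ) + 2 * (M ^ 2 * δ) + 8 * (M * r) ≤
          50 * M ^ 3 * r := by
        have : 0 ≤ M ^ 3 * r := by positivity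
        linarith
      have q6 := mul_le_mul_of_nonneg_left (mul_le_mul_of_nonneg_left q5 hδ.le)
        (Nat.cast_nonneg (α := ℝ) E.card)
      refine (d6.trans (add_le_add d2 (add_le_add d3 d4))).trans ?_
      linarith
    have := mul_le_mul_of_nonneg_left d7 hδ.le
    linarith
  · have e1 : ∀ e, ‖(if e ∈ V then (δ : ℂ) * ψ' e e.1 else 0)‖ ^ 2 ≤
        δ ^ 2 * (2 * ‖ψ e.1‖ ^ 2 + 128 * δ ^ 2 * M ^ 4) := by
      intro e
      split_ifs with hv
      · rw [norm_mul, nδ, mul_pow]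
        refine mul_le_mul_of_nonneg_left ?_ (sq_nonneg δ)
        refine (pow_le_pow_left₀ (norm_nonneg _) (b4 e hv e.1) 2).trans ?_
        nlinarith [sq_nonneg (‖ψ e.1‖ - 8 * δ * M ^ 2)]
      · simp; positivity
    refine (Finset.sum_le_sum fun e _ => e1 e).trans ?_
    rw [← Finset.mul_sum]
    simp only [Finset.sum_add_distrib, ← Finset.mul_sum, Finset.sum_const, nsmul_eq_mul]
    have f1 := mul_le_mul_of_nonneg_left hψ.sq_fst (show 0 ≤ δ ^ 2 * 2 by positivity)
    have p1 : M ^ 2 * r ^ 2 ≤ M ^ 4 * r ^ 2 :=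
      mul_le_mul_of_nonneg_right (pow_le_pow_right₀ hM (by norm_num)) (by positivity)
    have p2 : δ ^ 2 * M ^ 4 ≤ M ^ 4 * r ^ 2 := by
      rw [mul_comm]
      exact mul_le_mul_of_nonneg_left (pow_le_pow_left₀ hδ.le hδr 2) (by positivity)
    have f4 : 2 * (M ^ 2 * r ^ 2) + 128 * (δ ^ 2 * M ^ 4) ≤ 130 * (M ^ 4 * r ^ 2) := by linarith
    have f5 := mul_le_mul_of_nonneg_left f4 (show 0 ≤ (E.card : ℝ) * δ ^ 2 by positivity)
    linarith

/-- The diagonal entry at the new neighbour after a switching, compared with the trace. -/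
lemma MoveSetup.prof_diag [Finite n] (S : MoveSetup E V δ r M K) {s : ℂ} (hs : ‖s‖ ≤ M)
    (hsum : ∑ e ∈ E, K e.1 e.1 = E.card * s) {K' : n × n → n → n → ℂ}
    (hK' : ∀ e ∈ V, SwitchRel δ K k (fun a => K a e.1) (fun a => K' e a e.1) e) :
    Prof E (fun e => if e ∈ V then (δ : ℂ) ^ 2 * (K' e e.1 e.1 - s) else 0)
      (3 * M * δ) (δ ^ 2 * (16 * M ^ 2 * r)) (9 * M ^ 2 * δ ^ 2 * r ^ 2) := by
  have hδ := S.δ_pos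
  have hM := S.one_le
  have hM0 : 0 < M := by linarith
  have hr : 0 < r := hδ.trans_le S.δ_le
  have hδr := S.δ_le
  have nδ : ‖(δ : ℂ)‖ = δ := by rw [Complex.norm_real, Real.norm_eq_abs, abs_of_pos hδ]
  have b1 : ∀ e ∈ V, ‖K' e e.1 e.1‖ ≤ 2 * M := fun e he =>
    S.norm_le_two_mul (fun a => S.K_le a e.1) (hK' e he) e.1
  have b2 : ∀ e ∈ V, ‖K' e e.1 e.1 - K e.1 e.1‖ ≤ 8 * δ * M ^ 2 := fun e he =>
    S.norm_sub_le' (fun a => S.K_le a e.1) (hK' e he) e.1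
  have b3 : ∀ e ∈ V, ‖K' e e.1 e.1 - s‖ ≤ 3 * M := fun e he =>
    (norm_sub_le _ _).trans ((add_le_add (b1 e he) hs).trans (by linarith))
  refine ⟨fun e he => ?_, ?_, ?_⟩
  · split_ifs with hv
    · rw [norm_mul, norm_pow, nδ]
      have h1 : δ ^ 2 ≤ δ := by nlinarith [S.r_le]
      have := mul_le_mul h1 (b3 e hv) (norm_nonneg _) hδ.le
      linarith
    · simp; positivity
  · rw [sum_indicator S (fun e => (δ : ℂ) ^ 2 * (K' e e.1 e.1 - s)), ← Finset.mul_sum, norm_mul,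
      norm_pow, nδ]
    have d2 : ‖∑ e ∈ V, (K' e e.1 e.1 - K e.1 e.1)‖ ≤ E.card * (8 * δ * M ^ 2) := by
      refine (norm_sum_le _ _).trans ((Finset.sum_le_sum b2).trans ?_)
      rw [Finset.sum_const, nsmul_eq_mul]
      exact mul_le_mul_of_nonneg_right (by exact_mod_cast Finset.card_le_card S.sub)
        (by positivity)
    have d4 : ‖∑ e ∈ E \ V, (K e.1 e.1 - s)‖ ≤ E.card * (4 * r * δ) * (2 * M) := by
      refine (norm_sum_le _ _).trans ((Finset.sum_le_card_nsmul _ _ (2 * M) ?_).trans ?_)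
      · intro e _
        refine (norm_sub_le _ _).trans ((add_le_add (S.K_le _ _) hs).trans (by linarith))
      · rw [nsmul_eq_mul]
        exact mul_le_mul_of_nonneg_right S.inv (by positivity)
    have d3 : ∑ e ∈ E, (K e.1 e.1 - s) = 0 := by
      rw [Finset.sum_sub_distrib, hsum]; simp
    have d5 : ∑ e ∈ V, (K' e e.1 e.1 - s) =
        ∑ e ∈ V, (K' e e.1 e.1 - K e.1 e.1) - ∑ e ∈ E \ V, (K e.1 e.1 - s) := by
      rw [← Finset.sum_sdiff S.sub] at d3
      rw [eq_neg_of_add_eq_zero_left d3, sub_neg_eq_add, ← Finset.sum_add_distrib]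
      exact Finset.sum_congr rfl fun e _ => by ring
    rw [d5]
    have d6 := (norm_sub_le (∑ e ∈ V, (K' e e.1 e.1 - K e.1 e.1))
      (∑ e ∈ E \ V, (K e.1 e.1 - s))).trans (add_le_add d2 d4)
    have q1 : 8 * δ * M ^ 2 + 4 * r * δ * (2 * M) ≤ 16 * M ^ 2 * r := by
      have h1 : δ * M ^ 2 ≤ M ^ 2 * r := by
        rw [mul_comm]; exact mul_le_mul_of_nonneg_left hδr (by positivity)
      have h2 : r * δ * M ≤ r * 1 * M ^ 2 := by
        refine mul_le_mul ?_ (by nlinarith) hM0.le (by positivity)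
        exact mul_le_mul_of_nonneg_left (by linarith [S.r_le]) hr.le
      linarith
    have := mul_le_mul_of_nonneg_left q1 (Nat.cast_nonneg (α := ℝ) E.card)
    have := mul_le_mul_of_nonneg_left (d6.trans (by linarith :
      _ ≤ E.card * (16 * M ^ 2 * r))) (sq_nonneg δ)
    linarith
  · have e1 : ∀ e ∈ E, ‖(if e ∈ V then (δ : ℂ) ^ 2 * (K' e e.1 e.1 - s) else 0)‖ ^ 2 ≤
        9 * M ^ 2 * δ ^ 2 * r ^ 2 := by
      intro e _
      split_ifs with hv
      · rw [norm_mul, norm_pow, nδ, mul_pow]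
        have h1 := pow_le_pow_left₀ (norm_nonneg _) (b3 e hv) 2
        have h2 : (δ ^ 2) ^ 2 ≤ δ ^ 2 * r ^ 2 := by
          rw [sq (δ ^ 2)]
          exact mul_le_mul_of_nonneg_left (pow_le_pow_left₀ hδ.le hδr 2) (sq_nonneg δ)
        have := mul_le_mul h2 h1 (by positivity) (by positivity)
        linarith
      · simp; positivity
    refine (Finset.sum_le_card_nsmul _ _ _ e1).trans (le_of_eq (by rw [nsmul_eq_mul]))

end Increment

/-! ### Switchings of regular graphs -/

section Switch

variable {N d : ℕ}

/-- The directed edges of `G`. -/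
def edgesOf (G : Fin N → Fin N → Bool) : Finset (Fin N × Fin N) :=
  Finset.univ.filter fun e => G e.1 e.2 = true

/-- Exchange the edges `ok` and `xy` for `ox` and `ky`. -/
def switchGraph (o k x y : Fin N) (G : Fin N → Fin N → Bool) : Fin N → Fin N → Bool :=
  fun i j => xor (G i j)
    (decide (s(i, j) = s(o, k) ∨ s(i, j) = s(x, y) ∨ s(i, j) = s(o, x) ∨ s(i, j) = s(k, y)))

/-- The switching along `e` at the edge `ok` is admissible. -/
def SwitchValid (G : Fin N → Fin N → Bool) (o k : Fin N) (e : Fin N × Fin N) : Prop :=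
  e.1 ≠ o ∧ G o e.1 = false ∧ e.2 ≠ k ∧ G k e.2 = false

instance (G : Fin N → Fin N → Bool) (o k : Fin N) : DecidablePred (SwitchValid G o k) :=
  fun e => by unfold SwitchValid; infer_instance

/-- The directed edges along which the switching is admissible. -/
def validEdges (G : Fin N → Fin N → Bool) (o k : Fin N) : Finset (Fin N × Fin N) :=
  (edgesOf G).filter (SwitchValid G o k)

lemma mem_edgesOf {G : Fin N → Fin N → Bool} {e : Fin N × Fin N} :
    e ∈ edgesOf G ↔ G e.1 e.2 = true := by simp [edgesOf]

lemma mem_validEdges {G : Fin N → Fin N → Bool} {o k : Fin N} {e : Fin N × Fin N} :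
    e ∈ validEdges G o k ↔ G e.1 e.2 = true ∧ SwitchValid G o k e := by
  simp [validEdges, mem_edgesOf]

lemma switchGraph_switchGraph (o k x y : Fin N) (G : Fin N → Fin N → Bool) :
    switchGraph o x k y (switchGraph o k x y G) = G := by
  funext i j
  simp only [switchGraph]
  have : (s(i, j) = s(o, x) ∨ s(i, j) = s(k, y) ∨ s(i, j) = s(o, k) ∨ s(i, j) = s(x, y)) ↔
      (s(i, j) = s(o, k) ∨ s(i, j) = s(x, y) ∨ s(i, j) = s(o, x) ∨ s(i, j) = s(k, y)) := by
    tauto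
  simp only [this]
  simp

/-- The vertices taking part in an admissible switching are distinct. -/
lemma SwitchValid.distinct {G : Fin N → Fin N → Bool} (hG : IsRegGraph N d G) {o k : Fin N}
    (hok : G o k = true) {x y : Fin N} (hxy : G x y = true) (hv : SwitchValid G o k (x, y)) :
    o ≠ k ∧ o ≠ x ∧ o ≠ y ∧ k ≠ x ∧ k ≠ y ∧ x ≠ y := by
  obtain ⟨h1, h2, h3, h4⟩ := hv
  simp only at h1 h2 h3 h4
  have hs := hG.1
  have hd := hG.2.1
  refine ⟨?_, Ne.symm h1, ?_, ?_, Ne.symm h3, ?_⟩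
  · rintro rfl; rw [hd] at hok; exact absurd hok (by simp)
  · rintro rfl; rw [hs, h2] at hxy; exact absurd hxy (by simp)
  · rintro rfl; rw [h2] at hok; exact absurd hok (by simp)
  · rintro rfl; rw [hd] at hxy; exact absurd hxy (by simp)

lemma switchGraph_symm {G : Fin N → Fin N → Bool} (hs : ∀ i j, G i j = G j i)
    (o k x y i j : Fin N) : switchGraph o k x y G i j = switchGraph o k x y G j i := by
  simp only [switchGraph, hs i j, Sym2.eq_swap (a := i) (b := j)]

set_option linter.unusedSimpArgs false in
/-- The change of the adjacency matrix under a switching. -/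
lemma switchGraph_entry {G : Fin N → Fin N → Bool} (hG : IsRegGraph N d G) {o k : Fin N}
    (hok : G o k = true) {x y : Fin N} (hxy : G x y = true) (hv : SwitchValid G o k (x, y))
    (i j : Fin N) :
    (if switchGraph o k x y G i j = true then (1 : ℂ) else 0) = (if G i j = true then 1 else 0) +
      ((if i = o then 1 else 0) - (if i = y then 1 else 0)) *
        ((if j = x then 1 else 0) - (if j = k then 1 else 0)) +
      ((if i = x then 1 else 0) - (if i = k then 1 else 0)) *
        ((if j = o then 1 else 0) - (if j = y then 1 else 0)) := by
  obtain ⟨e1, e2, e3, e4, e5, e6⟩ := hv.distinct hG hok hxy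
  obtain ⟨-, h2, -, h4⟩ := hv
  simp only at h2 h4
  have hs := hG.1
  have g1 : G k o = true := by rw [hs]; exact hok
  have g2 : G y x = true := by rw [hs]; exact hxy
  have g3 : G x o = false := by rw [hs]; exact h2
  have g4 : G y k = false := by rw [hs]; exact h4
  by_cases io : i = o
  · subst io
    by_cases jx : j = x
    · subst jx; simp [switchGraph, *, Ne.symm e2, Ne.symm e4, Ne.symm e6]
    by_cases jk : j = k
    · subst jk; simp [switchGraph, *, Ne.symm e1, Ne.symm e4, Ne.symm e6]
    simp [switchGraph, *]
  by_cases iy : i = y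
  · subst iy
    by_cases jx : j = x
    · subst jx; simp [switchGraph, *, Ne.symm e2, Ne.symm e3, Ne.symm e5, Ne.symm e4, Ne.symm e6]
    by_cases jk : j = k
    · subst jk; simp [switchGraph, *, Ne.symm e1, Ne.symm e3, Ne.symm e5, Ne.symm e4, Ne.symm e6]
    simp [switchGraph, *, Ne.symm e3, Ne.symm e5, Ne.symm e6]
  by_cases ix : i = x
  · subst ix
    by_cases jx : j = o
    · subst jx; simp [switchGraph, *, Ne.symm e2, Ne.symm e3, Ne.symm e5, Ne.symm e4, Ne.symm e6]
    by_cases jk : j = y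
    · subst jk; simp [switchGraph, *, Ne.symm e1, Ne.symm e3, Ne.symm e5, Ne.symm e4, Ne.symm e6]
    simp [switchGraph, *, Ne.symm e2, Ne.symm e4]
  by_cases ik : i = k
  · subst ik
    by_cases jx : j = o
    · subst jx; simp [switchGraph, *]
    by_cases jk : j = y
    · subst jk; simp [switchGraph, *, Ne.symm e1, Ne.symm e3, Ne.symm e5, Ne.symm e4, Ne.symm e6]
    simp [switchGraph, *]
  simp [switchGraph, *]

lemma switchGraph_isRegGraph {G : Fin N → Fin N → Bool} (hG : IsRegGraph N d G) {o k : Fin N}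
    (hok : G o k = true) {x y : Fin N} (hxy : G x y = true) (hv : SwitchValid G o k (x, y)) :
    IsRegGraph N d (switchGraph o k x y G) := by
  obtain ⟨e1, e2, e3, e4, e5, e6⟩ := hv.distinct hG hok hxy
  refine ⟨switchGraph_symm hG.1 o k x y, fun i => ?_, fun i => ?_⟩
  · simp only [switchGraph, hG.2.1 i]
    simp only [Sym2.eq_iff, Bool.false_xor, decide_eq_false_iff_not]
    rintro ((⟨rfl, h⟩ | ⟨rfl, h⟩) | (⟨rfl, h⟩ | ⟨rfl, h⟩) | (⟨rfl, h⟩ | ⟨rfl, h⟩) |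
      (⟨rfl, h⟩ | ⟨rfl, h⟩)) <;> simp_all
  · have h := hG.2.2 i
    have h1 : ∀ G : Fin N → Fin N → Bool,
        (((Finset.univ.filter fun j => G i j = true).card : ℕ) : ℂ) =
          ∑ j, if G i j = true then (1 : ℂ) else 0 := fun G => by simp
    have h2 : (((Finset.univ.filter fun j => switchGraph o k x y G i j = true).card : ℕ) : ℂ) =
        (d : ℂ) := by
      rw [h1, ← h, h1]
      simp only [switchGraph_entry hG hok hxy hv, Finset.sum_add_distrib, ← Finset.mul_sum,
        Finset.sum_sub_distrib]
      simp
    exact_mod_cast h2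

set_option linter.unusedSimpArgs false in
/-- The reverse switching is admissible. -/
lemma switchValid_switchGraph {G : Fin N → Fin N → Bool} (hG : IsRegGraph N d G) {o k : Fin N}
    (hok : G o k = true) {x y : Fin N} (hxy : G x y = true) (hv : SwitchValid G o k (x, y)) :
    switchGraph o k x y G k y = true ∧ switchGraph o k x y G o x = true ∧
      SwitchValid (switchGraph o k x y G) o x (k, y) := by
  obtain ⟨e1, e2, e3, e4, e5, e6⟩ := hv.distinct hG hok hxy
  obtain ⟨-, h2, -, h4⟩ := hv
  simp only at h2 h4
  refine ⟨?_, ?_, Ne.symm e1, ?_, Ne.symm e6, ?_⟩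
  · simp [switchGraph, *, Ne.symm e1, Ne.symm e2, Ne.symm e3, Ne.symm e4]
  · simp [switchGraph, *, Ne.symm e1, Ne.symm e2, Ne.symm e3, Ne.symm e4]
  · simp [switchGraph, *, Ne.symm e1, Ne.symm e2, Ne.symm e3, Ne.symm e4]
  · simp [switchGraph, *, Ne.symm e1, Ne.symm e2, Ne.symm e3, Ne.symm e4]

lemma sum_edgesOf_fst {G : Fin N → Fin N → Bool} (hG : IsRegGraph N d G) {R : Type*}
    [CommSemiring R] (f : Fin N → R) : ∑ e ∈ edgesOf G, f e.1 = d * ∑ a, f a := by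
  rw [edgesOf, Finset.sum_filter, Fintype.sum_prod_type, Finset.mul_sum]
  refine Finset.sum_congr rfl fun a _ => ?_
  dsimp only
  rw [← Finset.sum_filter, Finset.sum_const, hG.2.2 a, nsmul_eq_mul]

lemma sum_edgesOf_snd {G : Fin N → Fin N → Bool} (hG : IsRegGraph N d G) {R : Type*}
    [CommSemiring R] (f : Fin N → R) : ∑ e ∈ edgesOf G, f e.2 = d * ∑ a, f a := by
  rw [edgesOf, Finset.sum_filter, Fintype.sum_prod_type_right, Finset.mul_sum]
  refine Finset.sum_congr rfl fun a _ => ?_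
  dsimp only
  rw [← Finset.sum_filter, Finset.sum_const, nsmul_eq_mul]
  simp only [hG.1 _ a]
  rw [hG.2.2 a]

lemma card_edgesOf {G : Fin N → Fin N → Bool} (hG : IsRegGraph N d G) :
    (edgesOf G).card = N * d := by
  have := sum_edgesOf_fst hG (fun _ => (1 : ℕ))
  simp at this
  rw [this, mul_comm]

lemma sum_edgesOf_eq {G : Fin N → Fin N → Bool} {R : Type*} [AddCommMonoid R]
    (f : Fin N → Fin N → R) :
    ∑ e ∈ edgesOf G, f e.1 e.2 = ∑ a, ∑ b, if G a b = true then f a b else 0 := by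
  rw [edgesOf, Finset.sum_filter, Fintype.sum_prod_type]

/-- The number of inadmissible moves. -/
lemma card_invalid_le {G : Fin N → Fin N → Bool} (hG : IsRegGraph N d G) (hd : 1 ≤ d)
    (o k : Fin N) :
    (edgesOf G \ validEdges G o k).card ≤ 4 * d ^ 2 := by
  have h1 : ∀ a : Fin N, ((edgesOf G).filter fun e => e.1 = a).card = d := by
    intro a
    have := sum_edgesOf_fst hG (fun b => if b = a then (1 : ℕ) else 0)
    rw [Finset.card_filter, this]; simp
  have h2 : ∀ a : Fin N, ((edgesOf G).filter fun e => e.2 = a).card = d := by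
    intro a
    have := sum_edgesOf_snd hG (fun b => if b = a then (1 : ℕ) else 0)
    rw [Finset.card_filter, this]; simp
  have h3 : ∀ a : Fin N, ((edgesOf G).filter fun e => G a e.1 = true).card = d * d := by
    intro a
    have := sum_edgesOf_fst hG (fun b => if G a b = true then (1 : ℕ) else 0)
    rw [Finset.card_filter, this, ← Finset.card_filter, hG.2.2]; simp
  have h4 : ∀ a : Fin N, ((edgesOf G).filter fun e => G a e.2 = true).card = d * d := by
    intro a
    have := sum_edgesOf_snd hG (fun b => if G a b = true then (1 : ℕ) else 0)
    rw [Finset.card_filter, this, ← Finset.card_filter, hG.2.2]; simp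
  have hsub : edgesOf G \ validEdges G o k ⊆
      ((edgesOf G).filter fun e => e.1 = o) ∪ ((edgesOf G).filter fun e => G o e.1 = true) ∪
      (((edgesOf G).filter fun e => e.2 = k) ∪ ((edgesOf G).filter fun e => G k e.2 = true)) := by
    intro e he
    rw [Finset.mem_sdiff, mem_validEdges, mem_edgesOf] at he
    obtain ⟨he1, he2⟩ := he
    simp only [Finset.mem_union, Finset.mem_filter, mem_edgesOf]
    by_contra hc
    apply he2
    refine ⟨he1, ?_, ?_, ?_, ?_⟩ <;> simp_all
  refine (Finset.card_le_card hsub).trans ((Finset.card_union_le _ _).trans ((add_le_add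
    (Finset.card_union_le _ _) (Finset.card_union_le _ _)).trans ?_))
  rw [h1, h2, h3, h4]
  nlinarith

end Switch

/-! ### Resolvents of regular graphs -/

section GraphResolvent

open Matrix

variable {N d : ℕ}

/-- The inverse square root of the degree. -/
def del (d : ℕ) : ℝ := (Real.sqrt d)⁻¹

lemma del_pos (hd : 1 ≤ d) : 0 < del d := inv_pos.mpr (Real.sqrt_pos.mpr (by exact_mod_cast hd))

lemma del_sq (hd : 1 ≤ d) : (d : ℝ) * del d ^ 2 = 1 := by
  have : (0 : ℝ) < d := by exact_mod_cast hd
  rw [del, inv_pow, Real.sq_sqrt this.le, mul_inv_cancel₀ this.ne']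

lemma del_sq_complex (hd : 1 ≤ d) : (d : ℂ) * (del d : ℂ) ^ 2 = 1 := by
  exact_mod_cast congrArg (fun x : ℝ => (x : ℂ)) (del_sq hd)

/-- The rescaled adjacency matrix. -/
def hmat (d : ℕ) (G : Fin N → Fin N → Bool) : Matrix (Fin N) (Fin N) ℂ :=
  of fun i j => (del d : ℂ) * if G i j = true then 1 else 0

/-- The orthogonal projection onto the vectors supported in `S` with mean zero. -/
def prj (S : Finset (Fin N)) : Matrix (Fin N) (Fin N) ℂ :=
  of fun i j => (if i = j ∧ i ∈ S then 1 else 0) - if i ∈ S ∧ j ∈ S then (S.card : ℂ)⁻¹ else 0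

/-- The resolvent of the compression of the rescaled adjacency matrix. -/
def gres (S : Finset (Fin N)) (d : ℕ) (G : Fin N → Fin N → Bool) (z : ℂ) :
    Matrix (Fin N) (Fin N) ℂ := compRes (prj S) (hmat d G) z

lemma hmat_transpose {G : Fin N → Fin N → Bool} (hG : IsRegGraph N d G) :
    (hmat d G)ᵀ = hmat d G := by
  ext i j; simp [hmat, hG.1 i j]

lemma hmat_conjTranspose {G : Fin N → Fin N → Bool} (hG : IsRegGraph N d G) :
    (hmat d G)ᴴ = hmat d G := by
  ext i j
  simp only [hmat, conjTranspose_apply, of_apply, hG.1 j i]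
  split_ifs <;> simp

lemma prj_transpose (S : Finset (Fin N)) : (prj S)ᵀ = prj S := by
  ext i j
  simp only [prj, transpose_apply, of_apply]
  congr 1
  · refine if_congr ⟨?_, ?_⟩ rfl rfl <;> (rintro ⟨rfl, h⟩; exact ⟨rfl, h⟩)
  · exact if_congr and_comm rfl rfl

lemma prj_conjTranspose (S : Finset (Fin N)) : (prj S)ᴴ = prj S := by
  conv_rhs => rw [← prj_transpose]
  ext i j
  simp only [prj, conjTranspose_apply, transpose_apply, of_apply]
  split_ifs <;> simp

lemma prj_mul_apply (S : Finset (Fin N)) (M : Matrix (Fin N) (Fin N) ℂ) (i j : Fin N) :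
    (prj S * M) i j = if i ∈ S then M i j - (S.card : ℂ)⁻¹ * ∑ k ∈ S, M k j else 0 := by
  simp only [mul_apply, prj, of_apply, sub_mul, Finset.sum_sub_distrib]
  by_cases hi : i ∈ S
  · simp only [hi, and_true, true_and, if_true, ite_mul, one_mul, zero_mul, Finset.sum_ite_eq,
      Finset.mem_univ, Finset.mul_sum, sub_right_inj]
    rw [← Finset.sum_filter]
    simp
  · simp [hi]

lemma prj_mul_of {S : Finset (Fin N)} {M : Matrix (Fin N) (Fin N) ℂ}
    (h1 : ∀ j, ∑ i, M i j = 0) (h2 : ∀ i ∉ S, ∀ j, M i j = 0) : prj S * M = M := by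
  ext i j
  rw [prj_mul_apply]
  have : ∑ k ∈ S, M k j = 0 := by
    rw [← h1 j]
    exact Finset.sum_subset (Finset.subset_univ _) fun k _ hk => h2 k hk j
  split_ifs with hi
  · rw [this]; simp
  · rw [h2 i hi]

lemma sum_prj {S : Finset (Fin N)} (hS : S.Nonempty) (j : Fin N) : ∑ i, prj S i j = 0 := by
  have hc : (S.card : ℂ) ≠ 0 := by exact_mod_cast hS.card_pos.ne'
  simp only [prj, of_apply, Finset.sum_sub_distrib]
  by_cases hj : j ∈ S
  · have h1 : ∀ i, (if i = j ∧ i ∈ S then (1 : ℂ) else 0) = if i = j then 1 else 0 := by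
      intro i
      by_cases h : i = j
      · subst h; simp [hj]
      · simp [h]
    simp only [h1, hj, and_true]
    rw [← Finset.sum_filter (p := fun i => i ∈ S)]
    simp [hc]
  · have h1 : ∀ i, (if i = j ∧ i ∈ S then (1 : ℂ) else 0) = 0 := by
      intro i
      by_cases h : i = j
      · subst h; simp [hj]
      · simp [h]
    simp [h1, hj]

lemma prj_eq_zero {S : Finset (Fin N)} {i : Fin N} (hi : i ∉ S) (j : Fin N) : prj S i j = 0 := by
  simp [prj, hi]

lemma prj_mul_prj {S : Finset (Fin N)} (hS : S.Nonempty) : prj S * prj S = prj S :=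
  prj_mul_of (sum_prj hS) fun _ hi j => prj_eq_zero hi j

lemma prj_trace {S : Finset (Fin N)} (hS : S.Nonempty) : (prj S).trace = S.card - 1 := by
  have hc : (S.card : ℂ) ≠ 0 := by exact_mod_cast hS.card_pos.ne'
  simp only [trace, diag, prj, of_apply, Finset.sum_sub_distrib, true_and, and_self]
  rw [← Finset.sum_filter, ← Finset.sum_filter]
  simp [hc]

section

variable {G : Fin N → Fin N → Bool} {S : Finset (Fin N)} {z : ℂ}

lemma gres_spec (hG : IsRegGraph N d G) (hS : S.Nonempty) (hz : 0 < z.im) :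
    IsCompRes (prj S) (hmat d G) z (gres S d G z) :=
  compRes_isCompRes (hmat_conjTranspose hG) (prj_conjTranspose S) (prj_mul_prj hS) hz

lemma gres_transpose (hG : IsRegGraph N d G) (hS : S.Nonempty) (hz : 0 < z.im) :
    (gres S d G z)ᵀ = gres S d G z :=
  (gres_spec hG hS hz).transpose (hmat_transpose hG) (prj_transpose S)

lemma gres_symm (hG : IsRegGraph N d G) (hS : S.Nonempty) (hz : 0 < z.im) (a b : Fin N) :
    gres S d G z a b = gres S d G z b a :=
  congrFun (congrFun (gres_transpose hG hS hz) b) a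

lemma gres_apply_eq_zero (hG : IsRegGraph N d G) (hS : S.Nonempty) (hz : 0 < z.im) {o : Fin N}
    (ho : o ∉ S) (a : Fin N) : gres S d G z o a = 0 := by
  rw [← (gres_spec hG hS hz).proj_mul, prj_mul_apply, if_neg ho]

lemma sum_gres (hG : IsRegGraph N d G) (hS : S.Nonempty) (hz : 0 < z.im) (a : Fin N) :
    ∑ b, gres S d G z b a = 0 := by
  conv_lhs => rw [← (gres_spec hG hS hz).proj_mul]
  simp only [mul_apply]
  rw [Finset.sum_comm]
  simp only [← Finset.sum_mul, sum_prj hS, zero_mul, Finset.sum_const_zero]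

lemma sum_gres_mulVec (hG : IsRegGraph N d G) (hS : S.Nonempty) (hz : 0 < z.im)
    (f : Fin N → ℂ) : ∑ b, (gres S d G z *ᵥ f) b = 0 := by
  simp only [mulVec, dotProduct]
  rw [Finset.sum_comm]
  simp only [← Finset.sum_mul, sum_gres hG hS hz, zero_mul, Finset.sum_const_zero]

lemma gres_ward (hG : IsRegGraph N d G) (hS : S.Nonempty) (hz : 0 < z.im) {f : Fin N → ℂ}
    (hf : star f = f) :
    ∑ b, ‖(gres S d G z *ᵥ f) b‖ ^ 2 = (f ⬝ᵥ gres S d G z *ᵥ f).im / z.im := by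
  rw [(gres_spec hG hS hz).ward (hmat_conjTranspose hG) (prj_conjTranspose S)
    (gres_transpose hG hS hz) hf]
  field_simp

lemma gres_mulVec_single (S : Finset (Fin N)) (a : Fin N) :
    gres S d G z *ᵥ Pi.single a 1 = fun b => gres S d G z b a := by
  funext b; simp

lemma gres_ward_single (hG : IsRegGraph N d G) (hS : S.Nonempty) (hz : 0 < z.im) (a : Fin N) :
    ∑ b, ‖gres S d G z b a‖ ^ 2 = (gres S d G z a a).im / z.im := by
  have := gres_ward hG hS hz (f := Pi.single a 1) (by
    funext b; by_cases h : b = a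
    · subst h; simp
    · simp [h])
  rw [gres_mulVec_single] at this
  rw [this]; simp

lemma sum_edgesOf_hmat (hd : 1 ≤ d) (f : Fin N → Fin N → ℂ) :
    ∑ e ∈ edgesOf G, f e.1 e.2 = d * del d * ∑ a, ∑ b, hmat d G a b * f a b := by
  rw [sum_edgesOf_eq, Finset.mul_sum]
  refine Finset.sum_congr rfl fun a _ => ?_
  rw [Finset.mul_sum]
  refine Finset.sum_congr rfl fun b _ => ?_
  have := del_sq_complex hd
  simp only [hmat, of_apply]
  split_ifs
  · linear_combination (-f a b) * this
  · simp

/-- Correlations of resolvent vectors along edges. -/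
lemma sum_edgesOf_gres (hG : IsRegGraph N d G) (hd : 1 ≤ d) (hS : S.Nonempty) (hz : 0 < z.im)
    (f g : Fin N → ℂ) :
    ∑ e ∈ edgesOf G, (gres S d G z *ᵥ f) e.1 * (gres S d G z *ᵥ g) e.2 =
      d * del d * (z * ∑ b, (gres S d G z *ᵥ f) b * (gres S d G z *ᵥ g) b +
        f ⬝ᵥ gres S d G z *ᵥ g) := by
  rw [sum_edgesOf_hmat hd (fun a b => (gres S d G z *ᵥ f) a * (gres S d G z *ᵥ g) b)]
  congr 1
  have h1 := congrArg (fun M => f ⬝ᵥ M *ᵥ g) (gres_spec hG hS hz).mul_mul_self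
  simp only [add_mulVec, smul_mulVec, dotProduct_add, dotProduct_smul, smul_eq_mul] at h1
  rw [← mulVec_mulVec, ← mulVec_mulVec, dotProduct_mulVec, ← mulVec_transpose,
    gres_transpose hG hS hz, ← mulVec_mulVec, dotProduct_mulVec f, ← mulVec_transpose,
    gres_transpose hG hS hz] at h1
  simp only [dotProduct] at h1 ⊢
  rw [← h1]
  refine Finset.sum_congr rfl fun a _ => ?_
  simp only [mulVec, dotProduct]
  rw [Finset.mul_sum]
  exact Finset.sum_congr rfl fun b _ => by ring

lemma sum_edgesOf_gres_apply (hG : IsRegGraph N d G) (hd : 1 ≤ d) (hS : S.Nonempty)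
    (hz : 0 < z.im) :
    ∑ e ∈ edgesOf G, gres S d G z e.1 e.2 =
      d * del d * (S.card - 1 + z * (gres S d G z).trace) := by
  rw [sum_edgesOf_hmat hd (fun a b => gres S d G z a b), ← prj_trace hS,
    ← (gres_spec hG hS hz).trace_mul]
  congr 1
  simp only [trace, diag, mul_apply]
  refine Finset.sum_congr rfl fun a _ => Finset.sum_congr rfl fun b _ => ?_
  rw [gres_symm hG hS hz]

lemma hmat_switchGraph (hG : IsRegGraph N d G) {o k x y : Fin N}
    (hok : G o k = true) (hxy : G x y = true) (hv : SwitchValid G o k (x, y)) :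
    hmat d (switchGraph o k x y G) = hmat d G + (del d : ℂ) •
      (vecMulVec (Pi.single o 1 - Pi.single y 1) (Pi.single x 1 - Pi.single k 1) +
       vecMulVec (Pi.single x 1 - Pi.single k 1) (Pi.single o 1 - Pi.single y 1)) := by
  ext i j
  have := switchGraph_entry hG hok hxy hv i j
  simp only [hmat, of_apply, Matrix.add_apply, Matrix.smul_apply, vecMulVec_apply, smul_eq_mul,
    this, Pi.sub_apply, Pi.single_apply]
  ring

/-- The resolvent with the row `o` removed after a switching. -/
lemma gres_switchRel (hG : IsRegGraph N d G) (hS : S.Nonempty) (hz : 0 < z.im) {o k x y : Fin N}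
    (ho : o ∉ S) (hok : G o k = true) (hxy : G x y = true) (hv : SwitchValid G o k (x, y))
    (g : Fin N → ℂ) :
    SwitchRel (del d) (gres S d G z) k (gres S d G z *ᵥ g)
      (gres S d (switchGraph o k x y G) z *ᵥ g) (x, y) := by
  have hG' := switchGraph_isRegGraph hG hok hxy hv
  have h := (gres_spec hG hS hz).sub_eq (gres_spec hG' hS hz)
  set K := gres S d G z with hK
  set K' := gres S d (switchGraph o k x y G) z with hK'
  have hs := gres_symm hG hS hz
  have h0 := gres_apply_eq_zero hG hS hz ho
  have h0' := gres_apply_eq_zero hG' hS hz ho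
  rw [← hK] at hs h0
  rw [← hK'] at h0'
  have e1 : (hmat d (switchGraph o k x y G) - z • (1 : Matrix (Fin N) (Fin N) ℂ)) -
      (hmat d G - z • 1) = (del d : ℂ) •
      (vecMulVec (Pi.single o 1 - Pi.single y 1) (Pi.single x 1 - Pi.single k 1) +
       vecMulVec (Pi.single x 1 - Pi.single k 1) (Pi.single o 1 - Pi.single y 1)) := by
    rw [hmat_switchGraph hG hok hxy hv]; abel
  rw [e1] at h
  intro a
  have h2 := congrFun (congrArg (fun M => M *ᵥ g) h) a
  simp only [mul_smul_comm, smul_mul_assoc, mul_add, add_mul, mul_vecMulVec, vecMulVec_mul,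
    sub_mulVec, smul_mulVec, add_mulVec, Pi.sub_apply, Pi.smul_apply, Pi.add_apply, smul_eq_mul,
    vecMulVec_mulVec, mulVec_sub, sub_vecMul, mulVec_single_one, single_one_vecMul] at h2
  have e2 : ∀ c : Fin N, K' c ⬝ᵥ g = (K' *ᵥ g) c := fun c => rfl
  have e3 : (K' *ᵥ g) o = 0 := by
    simp only [mulVec, dotProduct, h0', zero_mul, Finset.sum_const_zero]
  have e4 : K a o = 0 := by rw [hs, h0]
  simp [sub_dotProduct, e2, e3, e4, col_apply, row] at h2
  linear_combination -h2

end

end GraphResolvent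

/-! ### Removing a row -/

section RowRemoval

open Matrix

variable {N d : ℕ} {G : Fin N → Fin N → Bool} {z : ℂ}

/-- The resolvent of the regular graph, orthogonally to the constant vectors. -/
def gfull (d : ℕ) (G : Fin N → Fin N → Bool) (z : ℂ) : Matrix (Fin N) (Fin N) ℂ :=
  gres Finset.univ d G z

/-- The resolvent with the row `o` removed. -/
def grow (o : Fin N) (d : ℕ) (G : Fin N → Fin N → Bool) (z : ℂ) : Matrix (Fin N) (Fin N) ℂ :=
  gres {o}ᶜ d G z

lemma univ_nonempty_of (o : Fin N) : (Finset.univ : Finset (Fin N)).Nonempty :=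
  ⟨o, Finset.mem_univ o⟩

lemma compl_singleton_nonempty (hN : 2 ≤ N) (o : Fin N) : ({o}ᶜ : Finset (Fin N)).Nonempty := by
  rw [← Finset.card_pos, Finset.card_compl]; simp; omega

lemma card_compl_singleton' (hN : 2 ≤ N) (o : Fin N) :
    ((({o}ᶜ : Finset (Fin N)).card : ℕ) : ℂ) = N - 1 := by
  rw [Finset.card_compl]; simp; rw [Nat.cast_sub (by omega)]; simp

lemma sum_hmat_row (hG : IsRegGraph N d G) (a : Fin N) :
    ∑ b, hmat d G a b = d * del d := by
  simp only [hmat, of_apply, ← Finset.mul_sum]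
  rw [← Finset.sum_filter, Finset.sum_const, hG.2.2 a]
  simp [mul_comm]

lemma prj_univ_apply (a b : Fin N) :
    prj Finset.univ a b = (if a = b then 1 else 0) - (N : ℂ)⁻¹ := by
  simp [prj]

lemma prj_univ_mul_hmat (hG : IsRegGraph N d G) :
    prj Finset.univ * hmat d G = hmat d G * prj Finset.univ := by
  ext i j
  rw [prj_mul_apply]
  have h1 : ∀ a, ∑ b, hmat d G b a = d * del d := fun a => by
    rw [← sum_hmat_row hG a]
    exact Finset.sum_congr rfl fun b _ => congrFun (congrFun (hmat_transpose hG) a) b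
  simp only [mul_apply, prj_univ_apply, mul_sub, Finset.sum_sub_distrib, h1, ← Finset.sum_mul,
    sum_hmat_row hG]
  simp [mul_comm]

lemma gfull_eq (hG : IsRegGraph N d G) (o : Fin N) (hz : 0 < z.im) :
    (hmat d G - z • 1) * gfull d G z = prj Finset.univ := by
  have h := gres_spec hG (univ_nonempty_of o) hz
  have h1 := h.left_inv
  rw [mul_sub, prj_univ_mul_hmat hG, mul_smul_comm, mul_one] at h1
  rw [gfull]
  conv_lhs => rw [← h.proj_mul, ← mul_assoc, sub_mul, smul_mul_assoc, one_mul]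
  exact h1

lemma hmat_mul_gfull (hG : IsRegGraph N d G) (o : Fin N) (hz : 0 < z.im)
    (a b : Fin N) :
    ∑ k, hmat d G a k * gfull d G z k b =
      z * gfull d G z a b + ((if a = b then 1 else 0) - (N : ℂ)⁻¹) := by
  have h := congrFun (congrFun (gfull_eq hG o hz) a) b
  rw [sub_mul, smul_mul_assoc, one_mul, Matrix.sub_apply, Matrix.smul_apply, mul_apply,
    prj_univ_apply, smul_eq_mul] at h
  linear_combination h

lemma gfull_symm (hG : IsRegGraph N d G) (hz : 0 < z.im) (a b : Fin N) :
    gfull d G z a b = gfull d G z b a := gres_symm hG (univ_nonempty_of a) hz a b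

lemma grow_symm (hG : IsRegGraph N d G) (hN : 2 ≤ N) (hz : 0 < z.im) (o a b : Fin N) :
    grow o d G z a b = grow o d G z b a :=
  gres_symm hG (compl_singleton_nonempty hN o) hz a b

/-- Schur complement formula. -/
lemma grow_eq (hG : IsRegGraph N d G) (hN : 2 ≤ N) (hz : 0 < z.im) {o : Fin N}
    (h0 : gfull d G z o o ≠ 0) (a b : Fin N) :
    grow o d G z a b =
      gfull d G z a b - gfull d G z a o * gfull d G z o b / gfull d G z o o := by
  set K := gfull d G z with hK
  set M : Matrix (Fin N) (Fin N) ℂ := of fun a b => K a b - K a o * K o b / K o o with hM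
  have hs : ∀ a b, K a b = K b a := gfull_symm hG hz
  have hMs : Mᵀ = M := by
    ext i j
    simp only [hM, transpose_apply, of_apply]
    rw [hs j i, hs j o, hs o i]; ring
  have hPo : prj ({o}ᶜ : Finset (Fin N)) * M = M := by
    refine prj_mul_of (fun j => ?_) fun i hi j => ?_
    · have h1 : ∀ j, ∑ i, K i j = 0 := sum_gres hG (univ_nonempty_of o) hz
      simp only [hM, of_apply, Finset.sum_sub_distrib, h1, mul_div_assoc, ← Finset.sum_mul]
      simp
    · simp only [Finset.mem_compl, Finset.mem_singleton, not_not] at hi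
      subst hi
      simp only [hM, of_apply]
      field_simp
      ring
  have hPU : prj ({o}ᶜ : Finset (Fin N)) * prj Finset.univ = prj ({o}ᶜ : Finset (Fin N)) := by
    ext i j
    rw [prj_mul_apply]
    have hc : ((({o}ᶜ : Finset (Fin N)).card : ℕ) : ℂ) ≠ 0 := by
      exact_mod_cast (compl_singleton_nonempty hN o).card_pos.ne'
    simp only [prj_univ_apply, Finset.sum_sub_distrib, Finset.sum_ite_eq', Finset.sum_const,
      nsmul_eq_mul, mul_sub]
    rw [inv_mul_cancel_left₀ hc]
    simp only [prj, of_apply]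
    by_cases hi : i ∈ ({o}ᶜ : Finset (Fin N)) <;> by_cases hj : j ∈ ({o}ᶜ : Finset (Fin N)) <;>
      simp [hi, hj]
  have hl : prj ({o}ᶜ : Finset (Fin N)) * (hmat d G - z • 1) * M = prj ({o}ᶜ : Finset (Fin N)) := by
    have e1 : (hmat d G - z • 1) * M = of fun a b => prj Finset.univ a b -
        prj Finset.univ a o * (K o b / K o o) := by
      ext i j
      have h := gfull_eq hG o hz
      rw [← hK] at h
      have h2 : M = K - vecMulVec (fun a => K a o) (fun b => K o b / K o o) := by
        ext i j
        simp only [hM, of_apply, Matrix.sub_apply, vecMulVec_apply]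
        ring
      rw [h2, mul_sub, h, mul_vecMulVec]
      simp only [Matrix.sub_apply, vecMulVec_apply, of_apply]
      congr 2
      rw [← h]
      simp [mul_apply, mulVec, dotProduct]
    rw [mul_assoc, e1]
    have e2 : (of fun a b => prj Finset.univ a b - prj Finset.univ a o * (K o b / K o o) :
        Matrix (Fin N) (Fin N) ℂ) = prj Finset.univ - vecMulVec ((prj Finset.univ).col o)
          (fun b => K o b / K o o) := by
      ext i j; simp [vecMulVec_apply]
    rw [e2, mul_sub, hPU, mul_vecMulVec]
    have e3 : prj ({o}ᶜ : Finset (Fin N)) *ᵥ (prj Finset.univ).col o = 0 := by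
      have : (prj Finset.univ).col o = prj Finset.univ *ᵥ (Pi.single o (1 : ℂ)) := by
        simp
      rw [this, mulVec_mulVec, hPU]
      funext i
      simp [prj]
    rw [e3]; simp
  have hspec : IsCompRes (prj ({o}ᶜ : Finset (Fin N))) (hmat d G) z M := by
    refine ⟨hPo, ?_, hl, ?_⟩
    · have := congrArg Matrix.transpose hPo
      rwa [transpose_mul, hMs, prj_transpose] at this
    · have := congrArg Matrix.transpose hl
      simpa [transpose_mul, hMs, prj_transpose, hmat_transpose hG, mul_assoc] using this
  have := (gres_spec hG (compl_singleton_nonempty hN o) hz).unique hspec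
  rw [grow, this]; rfl

/-- The resolvent with the row `o` removed, applied to that row. -/
def hvec (o : Fin N) (d : ℕ) (G : Fin N → Fin N → Bool) (z : ℂ) (b : Fin N) : ℂ :=
  ∑ k, hmat d G o k * grow o d G z k b

/-- The quadratic form of the row `o`. -/
def zfull (o : Fin N) (d : ℕ) (G : Fin N → Fin N → Bool) (z : ℂ) : ℂ :=
  ∑ k, hmat d G o k * hvec o d G z k

lemma hvec_eq (hG : IsRegGraph N d G) (hN : 2 ≤ N) (hz : 0 < z.im) {o : Fin N}
    (h0 : gfull d G z o o ≠ 0) (b : Fin N) :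
    hvec o d G z b = ((if o = b then 1 else 0) - (N : ℂ)⁻¹) -
      (1 - (N : ℂ)⁻¹) * gfull d G z o b / gfull d G z o o := by
  simp only [hvec, grow_eq hG hN hz h0, mul_sub, Finset.sum_sub_distrib]
  rw [hmat_mul_gfull hG o hz]
  have : ∑ k, hmat d G o k * (gfull d G z k o * gfull d G z o b / gfull d G z o o) =
      (∑ k, hmat d G o k * gfull d G z k o) * gfull d G z o b / gfull d G z o o := by
    rw [Finset.sum_mul, Finset.sum_div]
    exact Finset.sum_congr rfl fun k _ => by ring
  rw [this, hmat_mul_gfull hG o hz, if_pos rfl]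
  field_simp
  ring

lemma gfull_off_diag (hG : IsRegGraph N d G) (hN : 2 ≤ N) (hz : 0 < z.im)
    {o : Fin N} (h0 : gfull d G z o o ≠ 0) {b : Fin N} (hb : b ≠ o) :
    (1 - (N : ℂ)⁻¹) * gfull d G z o b = -gfull d G z o o * (hvec o d G z b + (N : ℂ)⁻¹) := by
  rw [hvec_eq hG hN hz h0, if_neg (Ne.symm hb)]
  field_simp
  ring

lemma gfull_diag (hG : IsRegGraph N d G) (hN : 2 ≤ N) (hz : 0 < z.im)
    {o : Fin N} (h0 : gfull d G z o o ≠ 0) :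
    (1 - (N : ℂ)⁻¹) ^ 2 + gfull d G z o o *
      (d * del d / N + z * (1 - (N : ℂ)⁻¹) + zfull o d G z) = 0 := by
  have h1 : zfull o d G z = hmat d G o o - d * del d * (N : ℂ)⁻¹ - (1 - (N : ℂ)⁻¹) *
      (∑ k, hmat d G o k * gfull d G z k o) / gfull d G z o o := by
    have h2 : ∀ k, hmat d G o k * hvec o d G z k = (if o = k then hmat d G o k else 0) -
        hmat d G o k * (N : ℂ)⁻¹ -
        (1 - (N : ℂ)⁻¹) * (hmat d G o k * gfull d G z k o) / gfull d G z o o := by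
      intro k
      rw [hvec_eq hG hN hz h0, gfull_symm hG hz o k]
      split_ifs <;> ring
    simp only [zfull, h2, Finset.sum_sub_distrib, ← Finset.sum_mul, sum_hmat_row hG,
      ← Finset.sum_div, ← Finset.mul_sum]
    simp
  have h3 : hmat d G o o = 0 := by simp [hmat, hG.2.1]
  rw [h1, hmat_mul_gfull hG o hz, if_pos rfl, h3]
  field_simp
  ring

/-- Traces of the full resolvent and of the resolvent with a row removed. -/
lemma norm_trace_gfull_sub_grow_le (hG : IsRegGraph N d G) (hN : 2 ≤ N)
    (hz : 0 < z.im) {o : Fin N} (h0 : gfull d G z o o ≠ 0) :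
    ‖(gfull d G z).trace - (grow o d G z).trace‖ ≤ 1 / z.im := by
  have h1 : (gfull d G z).trace - (grow o d G z).trace =
      (∑ a, gfull d G z a o ^ 2) / gfull d G z o o := by
    simp only [trace, diag, grow_eq hG hN hz h0, Finset.sum_sub_distrib, Finset.sum_div,
      sub_sub_cancel]
    refine Finset.sum_congr rfl fun a _ => ?_
    rw [gfull_symm hG hz o a]; ring
  have h2 := gres_ward_single hG (univ_nonempty_of o) hz o
  rw [h1, norm_div, div_le_iff₀ (norm_pos_iff.mpr h0)]
  refine (norm_sum_le _ _).trans ?_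
  simp only [norm_pow]
  refine h2.le.trans ?_
  rw [div_mul_eq_mul_div, one_mul]
  exact div_le_div_of_nonneg_right ((le_abs_self _).trans (Complex.abs_im_le_norm _)) hz.le

end RowRemoval

/-! ### Reversible chains with killing -/

section Chain

variable {ι κ : Type*} {Ω : Finset ι} {E : ι → Finset κ} {sw : ℕ → ι → κ → ι} {m : ℕ}

/-- A family of moves on `Ω` whose averaging operators are symmetric. -/
structure RevMoves (Ω : Finset ι) (E : ι → Finset κ) (sw : ℕ → ι → κ → ι) (m n : ℕ) : Prop where
  pos : 0 < m
  card : ∀ ω ∈ Ω, (E ω).card = m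
  mem : ∀ μ < n, ∀ ω ∈ Ω, ∀ e ∈ E ω, sw μ ω e ∈ Ω
  symm : ∀ μ < n, ∀ F G : ι → ℝ, ∑ ω ∈ Ω, ∑ e ∈ E ω, F ω * G (sw μ ω e) =
    ∑ ω ∈ Ω, ∑ e ∈ E ω, F (sw μ ω e) * G ω

open scoped Classical in
/-- A bound for the number of bad states through supersolutions of the forward and backward
equations. -/
lemma RevMoves.card_bad_le {n : ℕ} (S : RevMoves Ω E sw m n) {R W Bad : ι → Prop}
    {f g : ℕ → ι → ℝ} {α β : ℝ} (hf0 : ∀ μ ω, 0 ≤ f μ ω) (hg0 : ∀ μ ω, 0 ≤ g μ ω)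
    (hf_end : ∀ ω ∈ Ω, R ω → Bad ω → 1 ≤ f n ω)
    (hf_step : ∀ μ < n, ∀ ω ∈ Ω, R ω → f μ ω < 1 →
      ∑ e ∈ E ω, f (μ + 1) (sw μ ω e) ≤ m * f μ ω)
    (hg_out : ∀ μ ≤ n, ∀ ω ∈ Ω, ¬ R ω → 1 ≤ g μ ω)
    (hg_step : ∀ μ < n, ∀ ω ∈ Ω, R ω → ∑ e ∈ E ω, g μ (sw μ ω e) ≤ m * g (μ + 1) ω)
    (hα : ∀ ω ∈ Ω, f 0 ω ≤ α) (hβ : ∀ ω ∈ Ω, W ω → g n ω ≤ β) (hα0 : 0 ≤ α) (hβ0 : 0 ≤ β)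
    (hWR : ∀ ω ∈ Ω, W ω → R ω) :
    ((Ω.filter fun ω => W ω ∧ Bad ω).card : ℝ) ≤ Ω.card * (α + β) := by
  have hm : (0 : ℝ) < m := by exact_mod_cast S.pos
  let FF : ℕ → ι → ℝ := fun j => Nat.rec (fun ω => if R ω ∧ Bad ω then 1 else 0)
    (fun j F ω => if R ω then (m : ℝ)⁻¹ * ∑ e ∈ E ω, F (sw (n - 1 - j) ω e) else 0) j
  let GG : ℕ → ι → ℝ := fun j => Nat.rec (fun ω => if R ω then 1 else 0)
    (fun j F ω => if R ω then (m : ℝ)⁻¹ * ∑ e ∈ E ω, F (sw j ω e) else 0) j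
  have F0 : FF 0 = fun ω => if R ω ∧ Bad ω then 1 else 0 := rfl
  have FS : ∀ j, FF (j + 1) = fun ω => if R ω then (m : ℝ)⁻¹ *
    ∑ e ∈ E ω, FF j (sw (n - 1 - j) ω e) else 0 := fun j => rfl
  have G0 : GG 0 = fun ω => if R ω then 1 else 0 := rfl
  have GS : ∀ j, GG (j + 1) = fun ω => if R ω then (m : ℝ)⁻¹ *
    ∑ e ∈ E ω, GG j (sw j ω e) else 0 := fun j => rfl
  have avg1 : ∀ ω ∈ Ω, (m : ℝ)⁻¹ * ∑ e ∈ E ω, (1 : ℝ) = 1 := fun ω hω => by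
    rw [Finset.sum_const, S.card ω hω, nsmul_eq_mul, mul_one, inv_mul_cancel₀ hm.ne']
  have FR : ∀ j ω, ¬ R ω → FF j ω = 0 := fun j ω h => by
    cases j with
    | zero => rw [F0]; simp [h]
    | succ j => rw [FS]; simp [h]
  have GR : ∀ j ω, ¬ R ω → GG j ω = 0 := fun j ω h => by
    cases j with
    | zero => rw [G0]; simp [h]
    | succ j => rw [GS]; simp [h]
  -- bounds for `FF`
  have hF : ∀ j ≤ n, ∀ ω ∈ Ω, FF j ω ≤ 1 ∧ FF j ω ≤ f (n - j) ω := by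
    intro j
    induction j with
    | zero =>
      intro _ ω hω
      rw [F0]
      dsimp only
      split_ifs with h
      · exact ⟨le_rfl, hf_end ω hω h.1 h.2⟩
      · exact ⟨zero_le_one, hf0 _ _⟩
    | succ j ih =>
      intro hj ω hω
      have hlt : n - 1 - j < n := by omega
      have e1 : n - (j + 1) = n - 1 - j := by omega
      have e2 : n - j = n - 1 - j + 1 := by omega
      rw [FS]
      dsimp only
      split_ifs with h
      · have h1 : (m : ℝ)⁻¹ * ∑ e ∈ E ω, FF j (sw (n - 1 - j) ω e) ≤ 1 := by
          refine le_trans ?_ (avg1 ω hω).le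
          refine mul_le_mul_of_nonneg_left (Finset.sum_le_sum fun e he => ?_) (by positivity)
          exact (ih (by omega) _ (S.mem _ hlt ω hω e he)).1
        refine ⟨h1, ?_⟩
        by_cases h2 : f (n - (j + 1)) ω < 1
        · rw [e1] at h2 ⊢
          rw [inv_mul_le_iff₀ hm]
          refine le_trans (Finset.sum_le_sum fun e he => ?_) (hf_step _ hlt ω hω h h2)
          rw [← e2]
          exact (ih (by omega) _ (S.mem _ hlt ω hω e he)).2
        · exact h1.trans (not_lt.mp h2)
      · exact ⟨zero_le_one, hf0 _ _⟩
  -- bounds for `GG`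
  have hG : ∀ j ≤ n, ∀ ω ∈ Ω, GG j ω ≤ 1 ∧ 1 - GG j ω ≤ g j ω := by
    intro j
    induction j with
    | zero =>
      intro _ ω hω
      rw [G0]
      dsimp only
      split_ifs with h
      · simpa using hg0 0 ω
      · simpa using hg_out 0 (Nat.zero_le _) ω hω h
    | succ j ih =>
      intro hj ω hω
      have hlt : j < n := by omega
      rw [GS]
      dsimp only
      split_ifs with h
      · constructor
        · refine le_trans ?_ (avg1 ω hω).le
          refine mul_le_mul_of_nonneg_left (Finset.sum_le_sum fun e he => ?_) (by positivity)
          exact (ih (by omega) _ (S.mem _ hlt ω hω e he)).1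
        · conv_lhs => rw [← avg1 ω hω]
          rw [← mul_sub, ← Finset.sum_sub_distrib, inv_mul_le_iff₀ hm]
          refine le_trans (Finset.sum_le_sum fun e he => ?_) (hg_step _ hlt ω hω h)
          exact (ih (by omega) _ (S.mem _ hlt ω hω e he)).2
      · simpa using hg_out (j + 1) hj ω hω h
  have hGnn : ∀ j ω, 0 ≤ GG j ω := by
    intro j
    induction j with
    | zero => intro ω; rw [G0]; dsimp only; split_ifs <;> norm_num
    | succ j ih =>
      intro ω
      rw [GS]; dsimp only
      split_ifs
      · exact mul_nonneg (by positivity) (Finset.sum_nonneg fun e _ => ih _)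
      · exact le_rfl
  -- the pairing is constant
  have hpair : ∀ μ ≤ n, ∑ ω ∈ Ω, FF (n - μ) ω * GG μ ω = ∑ ω ∈ Ω, FF n ω * GG 0 ω := by
    intro μ
    induction μ with
    | zero => intro _; rfl
    | succ μ ih =>
      intro hμ
      rw [← ih (by omega)]
      have e1 : n - μ = (n - (μ + 1)) + 1 := by omega
      have e2 : n - 1 - (n - (μ + 1)) = μ := by omega
      have h1 : ∀ ω, FF (n - (μ + 1)) ω * GG (μ + 1) ω =
          (m : ℝ)⁻¹ * ∑ e ∈ E ω, FF (n - (μ + 1)) ω * GG μ (sw μ ω e) := by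
        intro ω
        by_cases h : R ω
        · rw [GS]; simp only [h, if_true]; rw [← Finset.mul_sum]; ring
        · simp [FR _ _ h]
      have h2 : ∀ ω, FF (n - μ) ω * GG μ ω =
          (m : ℝ)⁻¹ * ∑ e ∈ E ω, FF (n - (μ + 1)) (sw μ ω e) * GG μ ω := by
        intro ω
        by_cases h : R ω
        · rw [e1, FS]; simp only [h, if_true, e2]; rw [← Finset.sum_mul]; ring
        · rw [GR _ _ h]; simp
      simp only [h1, h2]
      rw [← Finset.mul_sum, ← Finset.mul_sum, S.symm μ (by omega)]
  have h3 := hpair n le_rfl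
  rw [Nat.sub_self] at h3
  have h4 : ∑ ω ∈ Ω, FF n ω * GG 0 ω ≤ Ω.card * α := by
    rw [← nsmul_eq_mul, ← Finset.sum_const]
    refine Finset.sum_le_sum fun ω hω => ?_
    have a1 := (hF n le_rfl ω hω).2
    rw [Nat.sub_self] at a1
    rw [G0]
    dsimp only
    split_ifs with h
    · rw [mul_one]; exact a1.trans (hα ω hω)
    · rw [mul_zero]; exact hα0
  rw [Finset.card_filter, Nat.cast_sum, mul_add]
  have h5 : ∑ ω ∈ Ω, (((if W ω ∧ Bad ω then 1 else 0 : ℕ)) : ℝ) ≤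
      ∑ ω ∈ Ω, (FF 0 ω * GG n ω + β) := by
    refine Finset.sum_le_sum fun ω hω => ?_
    split_ifs with h
    · rw [F0]
      simp only [hWR ω hω h.1, h.2, and_self, if_true, one_mul]
      have a1 := (hG n le_rfl ω hω).2
      have a2 := hβ ω hω h.1
      push_cast
      linarith
    · have a3 : 0 ≤ FF 0 ω := by rw [F0]; dsimp only; split_ifs <;> norm_num
      have := mul_nonneg a3 (hGnn n ω)
      push_cast
      linarith
  rw [Finset.sum_add_distrib, h3, Finset.sum_const, nsmul_eq_mul] at h5
  linarith

end Chain

/-! ### The switching chain -/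

section SwitchChain

variable {N d : ℕ}

/-- A regular graph together with an enumeration of the neighbours of `o`. -/
def IsLabelled (d : ℕ) (o : Fin N) (ω : (Fin N → Fin N → Bool) × (Fin d → Fin N)) : Prop :=
  IsRegGraph N d ω.1 ∧ Function.Injective ω.2 ∧ ∀ ν, ω.1 o (ω.2 ν) = true

open scoped Classical in
/-- The set of regular graphs with an enumeration of the neighbours of `o`. -/
def labelled (d : ℕ) (o : Fin N) : Finset ((Fin N → Fin N → Bool) × (Fin d → Fin N)) :=
  Finset.univ.filter (IsLabelled d o)

lemma mem_labelled {o : Fin N} {ω : (Fin N → Fin N → Bool) × (Fin d → Fin N)} :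
    ω ∈ labelled d o ↔ IsLabelled d o ω := by simp [labelled]

/-- One switching at the slot `μ` along the edge `e`. -/
def move (o : Fin N) (μ : Fin d) (ω : (Fin N → Fin N → Bool) × (Fin d → Fin N))
    (e : Fin N × Fin N) : (Fin N → Fin N → Bool) × (Fin d → Fin N) :=
  if SwitchValid ω.1 o (ω.2 μ) e then
    (switchGraph o (ω.2 μ) e.1 e.2 ω.1, Function.update ω.2 μ e.1) else ω

/-- The edge along which a switching is undone. -/
def moveBack (o : Fin N) (μ : Fin d) (ω : (Fin N → Fin N → Bool) × (Fin d → Fin N))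
    (e : Fin N × Fin N) : Fin N × Fin N :=
  if SwitchValid ω.1 o (ω.2 μ) e then (ω.2 μ, e.2) else e

lemma IsLabelled.move {o : Fin N} {ω : (Fin N → Fin N → Bool) × (Fin d → Fin N)}
    (h : IsLabelled d o ω) (μ : Fin d) {e : Fin N × Fin N} (he : e ∈ edgesOf ω.1) :
    IsLabelled d o (move o μ ω e) := by
  unfold _root_.move
  split_ifs with hv
  swap
  · exact h
  obtain ⟨G, σ⟩ := ω
  obtain ⟨x, y⟩ := e
  obtain ⟨hG, hσ, hN⟩ := h
  rw [mem_edgesOf] at he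
  simp only at *
  have hd := hv.distinct hG (hN μ) he
  have hb := switchValid_switchGraph hG (hN μ) he hv
  have hx : ∀ ν, σ ν ≠ x := fun ν hν => by
    have := hN ν
    rw [hν, hv.2.1] at this
    exact absurd this (by simp)
  refine ⟨switchGraph_isRegGraph hG (hN μ) he hv, ?_, fun ν => ?_⟩
  · intro a b hab
    dsimp only at hab
    by_cases ha : a = μ <;> by_cases hb : b = μ
    · rw [ha, hb]
    · subst ha
      rw [Function.update_self, Function.update_of_ne hb] at hab
      exact absurd hab.symm (hx b)
    · subst hb
      rw [Function.update_self, Function.update_of_ne ha] at hab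
      exact absurd hab (hx a)
    · rw [Function.update_of_ne ha, Function.update_of_ne hb] at hab
      exact hσ hab
  · by_cases hν : ν = μ
    · subst hν
      simp only [Function.update_self]
      exact hb.2.1
    · simp only [Function.update_of_ne hν]
      have := switchGraph_entry hG (hN μ) he hv o (σ ν)
      have h1 : σ ν ≠ σ μ := fun h => hν (hσ h)
      simp only [hN ν, hx ν, h1, hd.2.2.1, hd.2.1, hd.1] at this
      by_contra hc
      simp [hc] at this

lemma move_move {o : Fin N} {ω : (Fin N → Fin N → Bool) × (Fin d → Fin N)}
    (h : IsLabelled d o ω) (μ : Fin d) {e : Fin N × Fin N} (he : e ∈ edgesOf ω.1) :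
    moveBack o μ ω e ∈ edgesOf (move o μ ω e).1 ∧
      move o μ (move o μ ω e) (moveBack o μ ω e) = ω ∧
      moveBack o μ (move o μ ω e) (moveBack o μ ω e) = e := by
  obtain ⟨G, σ⟩ := ω
  obtain ⟨x, y⟩ := e
  obtain ⟨hG, hσ, hN⟩ := h
  rw [mem_edgesOf] at he
  simp only at *
  by_cases hv : SwitchValid G o (σ μ) (x, y)
  · have hb := switchValid_switchGraph hG (hN μ) he hv
    have e1 : move o μ (G, σ) (x, y) =
      (switchGraph o (σ μ) x y G, Function.update σ μ x) := by simp [move, hv]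
    have e2 : moveBack o μ (G, σ) (x, y) = (σ μ, y) := by simp [moveBack, hv]
    rw [e1, e2]
    refine ⟨mem_edgesOf.mpr hb.1, ?_, ?_⟩
    · simp [move, hb.2.2, switchGraph_switchGraph]
    · simp [moveBack, hb.2.2]
  · have e1 : move o μ (G, σ) (x, y) = (G, σ) := by simp [move, hv]
    have e2 : moveBack o μ (G, σ) (x, y) = (x, y) := by simp [moveBack, hv]
    rw [e1, e2]
    exact ⟨mem_edgesOf.mpr he, e1, e2⟩

lemma revMoves_move (hN : 0 < N) (hd : 0 < d) (o : Fin N) :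
    RevMoves (labelled d o) (fun ω => edgesOf ω.1)
      (fun μ ω e => if h : μ < d then move o ⟨μ, h⟩ ω e else ω) (N * d) d := by
  refine ⟨Nat.mul_pos hN hd, fun ω hω => card_edgesOf (mem_labelled.mp hω).1, ?_, ?_⟩
  · intro μ hμ ω hω e he
    simp only [hμ, dif_pos]
    exact mem_labelled.mpr ((mem_labelled.mp hω).move _ he)
  · intro μ hμ F G
    simp only [hμ, dif_pos]
    rw [Finset.sum_sigma', Finset.sum_sigma']
    refine Finset.sum_bij' (fun p _ => ⟨move o ⟨μ, hμ⟩ p.1 p.2, moveBack o ⟨μ, hμ⟩ p.1 p.2⟩)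
      (fun p _ => ⟨move o ⟨μ, hμ⟩ p.1 p.2, moveBack o ⟨μ, hμ⟩ p.1 p.2⟩) ?_ ?_ ?_ ?_ ?_
    · intro p hp
      rw [Finset.mem_sigma] at hp ⊢
      have h := mem_labelled.mp hp.1
      exact ⟨mem_labelled.mpr (h.move _ hp.2), (move_move h _ hp.2).1⟩
    · intro p hp
      rw [Finset.mem_sigma] at hp ⊢
      have h := mem_labelled.mp hp.1
      exact ⟨mem_labelled.mpr (h.move _ hp.2), (move_move h _ hp.2).1⟩
    · intro p hp
      rw [Finset.mem_sigma] at hp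
      have := move_move (mem_labelled.mp hp.1) ⟨μ, hμ⟩ hp.2
      simp only [this.2.1, this.2.2]
    · intro p hp
      rw [Finset.mem_sigma] at hp
      have := move_move (mem_labelled.mp hp.1) ⟨μ, hμ⟩ hp.2
      simp only [this.2.1, this.2.2]
    · intro p hp
      rw [Finset.mem_sigma] at hp
      have := move_move (mem_labelled.mp hp.1) ⟨μ, hμ⟩ hp.2
      simp only [this.2.1]

open scoped Classical in
/-- The number of enumerations does not depend on the graph. -/
lemma card_labelled_filter (o : Fin N) (p : (Fin N → Fin N → Bool) → Prop) :
    ((labelled d o).filter fun ω => p ω.1).card =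
      d.factorial * cardOf fun G : Fin N → Fin N → Bool => IsRegGraph N d G ∧ p G := by
  have h1 : ((labelled d o).filter fun ω => p ω.1).card =
      ∑ G ∈ Finset.univ.filter (fun G : Fin N → Fin N → Bool => IsRegGraph N d G ∧ p G),
        (((labelled d o).filter fun ω => p ω.1).filter fun ω => ω.1 = G).card := by
    refine Finset.card_eq_sum_card_fiberwise fun ω hω => ?_
    simp only [Finset.coe_filter, Set.mem_ofPred_eq, mem_labelled] at hω
    simp only [Finset.coe_filter, Set.mem_ofPred_eq, Finset.mem_univ, true_and]
    exact ⟨hω.1.1, hω.2⟩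
  have h2 : ∀ G ∈ Finset.univ.filter (fun G : Fin N → Fin N → Bool => IsRegGraph N d G ∧ p G),
      (((labelled d o).filter fun ω => p ω.1).filter fun ω => ω.1 = G).card = d.factorial := by
    intro G hG
    simp only [Finset.mem_filter, Finset.mem_univ, true_and] at hG
    have hc : Fintype.card (Fin d ↪ {j : Fin N // G o j = true}) = d.factorial := by
      rw [Fintype.card_embedding_eq, Fintype.card_subtype, hG.1.2.2 o]
      simp [Nat.descFactorial_self]
    rw [← hc, ← Finset.card_univ]
    symm
    refine Finset.card_bij (fun φ _ => (G, fun ν => (φ ν : Fin N))) ?_ ?_ ?_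
    · intro φ _
      simp only [Finset.mem_filter, mem_labelled, and_true]
      exact ⟨⟨hG.1, fun a b hab => φ.injective (Subtype.ext hab), fun ν => (φ ν).2⟩, hG.2⟩
    · intro φ _ φ' _ h
      ext ν
      have := congrFun (congrArg Prod.snd h) ν
      exact congrArg Fin.val this
    · rintro ⟨G', σ⟩ h
      simp only [Finset.mem_filter, mem_labelled] at h
      obtain ⟨⟨h1, h2⟩, rfl⟩ := h
      exact ⟨⟨fun ν => ⟨σ ν, h1.2.2 ν⟩, fun a b hab => h1.2.1 (congrArg Subtype.val hab)⟩,
        Finset.mem_univ _, rfl⟩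
  rw [h1, Finset.sum_congr rfl h2, Finset.sum_const, smul_eq_mul, mul_comm, cardOf]
  congr 2
  ext; simp

end SwitchChain

/-! ### Increments of resolvent functionals of regular graphs -/

section GraphIncrement

open Matrix

variable {N d : ℕ} {z : ℂ} {r M A A' : ℝ} {o k : Fin N} {G : Fin N → Fin N → Bool}

/-- The spectral parameter is resolved at the accuracy `r`. -/
structure Scale (N d : ℕ) (z : ℂ) (r : ℝ) : Prop where
  im_pos : 0 < z.im
  two_le : 2 ≤ N
  one_le : 1 ≤ d
  r_pos : 0 < r
  r_le : r ≤ 1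
  im_le : (1 + ‖z‖) / (N * z.im) ≤ r ^ 2
  inv_le : 1 ≤ N * r ^ 2
  del_le : del d ≤ r
  deg_le : d / N ≤ r * del d

/-- Bounds for the entries of the resolvent with the row `o` removed. -/
def InRegion (A A' : ℝ) (o : Fin N) (d : ℕ) (z : ℂ) (G : Fin N → Fin N → Bool) : Prop :=
  (∀ a, (1 + ‖z‖) * ‖grow o d G z a a‖ ≤ A) ∧
    ∀ a b, a ≠ b → (1 + ‖z‖) * ‖grow o d G z a b‖ ≤ A'

lemma InRegion.le (h : InRegion A A' o d z G) (hA : A' ≤ A) (a b : Fin N) :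
    (1 + ‖z‖) * ‖grow o d G z a b‖ ≤ A := by
  by_cases hab : a = b
  · subst hab; exact h.1 a
  · exact (h.2 a b hab).trans hA

lemma InRegion.le' (h : InRegion A A' o d z G) (hA : A' ≤ A) (a b : Fin N) :
    ‖grow o d G z a b‖ ≤ A := by
  refine le_trans ?_ (h.le hA a b)
  nlinarith [norm_nonneg z, norm_nonneg (grow o d G z a b)]

lemma InRegion.norm_trace_le (h : InRegion A A' o d z G) :
    (1 + ‖z‖) * ‖(grow o d G z).trace‖ ≤ N * A := by
  refine (mul_le_mul_of_nonneg_left (norm_sum_le _ _) (by positivity)).trans ?_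
  rw [Finset.mul_sum]
  refine (Finset.sum_le_sum fun a _ => h.1 a).trans ?_
  simp

lemma Scale.moveSetup (S : Scale N d z r) (hG : IsRegGraph N d G)
    (hR : InRegion A A' o d z G) (hA : A' ≤ A) (hA1 : 1 ≤ A) (hM : 2 * A + 2 ≤ M)
    (hs : 8 * del d * M ≤ 1) (k : Fin N) :
    MoveSetup (edgesOf G) (validEdges G o k) (del d) r M (grow o d G z) := by
  have hδ := del_pos S.one_le
  have hN : (0 : ℝ) < N := by exact_mod_cast (by have := S.two_le; omega : 0 < N)
  have hd : (0 : ℝ) < d := by exact_mod_cast S.one_le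
  refine ⟨Finset.filter_subset _ _, hδ, S.del_le, S.r_le, by linarith, hs, ?_,
    fun a b => (hR.le' hA a b).trans (by linarith), ?_⟩
  · have h1 := card_invalid_le hG S.one_le o k
    rw [card_edgesOf hG]
    have h2 : ((edgesOf G \ validEdges G o k).card : ℝ) ≤ 4 * d ^ 2 := by exact_mod_cast h1
    have h3 := S.deg_le
    rw [div_le_iff₀ hN] at h3
    push_cast
    nlinarith
  · rw [card_edgesOf hG, grow, sum_edgesOf_gres_apply hG S.one_le
      (compl_singleton_nonempty S.two_le o) S.im_pos, card_compl_singleton' S.two_le o]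
    have h1 := hR.norm_trace_le
    rw [grow] at h1
    have h2 : ‖((N : ℂ) - 1 - 1 + z * (gres {o}ᶜ d G z).trace)‖ ≤ N + N * A := by
      refine (norm_add_le _ _).trans (add_le_add ?_ ?_)
      · have : ((N : ℂ) - 1 - 1) = ((N - 2 : ℝ) : ℂ) := by push_cast; ring
        rw [this, Complex.norm_real, Real.norm_eq_abs, abs_le]
        have : (2 : ℝ) ≤ N := by exact_mod_cast S.two_le
        constructor <;> linarith
      · rw [norm_mul]
        refine le_trans ?_ h1
        nlinarith [norm_nonneg (gres {o}ᶜ d G z).trace]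
    rw [norm_mul, norm_mul, Complex.norm_natCast, Complex.norm_real, Real.norm_eq_abs,
      abs_of_pos hδ]
    push_cast
    calc (d : ℝ) * del d * _ ≤ d * del d * (N + N * A) := by gcongr
      _ = N * d * del d * (1 + A) := by ring
      _ ≤ N * d * del d * (2 * M) := by gcongr; linarith
      _ = _ := by ring

/-- A real vector whose image under the resolvent is bounded, with a small mean square. -/
structure TestVec (o : Fin N) (d : ℕ) (G : Fin N → Fin N → Bool) (z : ℂ) (r M : ℝ)
    (f : Fin N → ℂ) : Prop where
  real : star f = f
  sup : ∀ a, ‖(grow o d G z *ᵥ f) a‖ ≤ M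
  sq : (1 + ‖z‖) * ∑ b, ‖(grow o d G z *ᵥ f) b‖ ^ 2 ≤ N * (M ^ 2 / 2 * r ^ 2)

lemma testVec_of (S : Scale N d z r) (hG : IsRegGraph N d G) {f : Fin N → ℂ}
    (hf : star f = f) (hsup : ∀ a, ‖(grow o d G z *ᵥ f) a‖ ≤ M)
    (hq : ‖f ⬝ᵥ grow o d G z *ᵥ f‖ ≤ M ^ 2 / 2) : TestVec o d G z r M f := by
  refine ⟨hf, hsup, ?_⟩
  have hN : (0 : ℝ) < N := by exact_mod_cast (by have := S.two_le; omega : 0 < N)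
  rw [grow, gres_ward hG (compl_singleton_nonempty S.two_le o) S.im_pos hf]
  have h1 := (le_abs_self _).trans ((Complex.abs_im_le_norm _).trans hq)
  rw [grow] at h1
  have h2 := S.im_le
  rw [div_le_iff₀ (mul_pos hN S.im_pos)] at h2
  have h4 : (0 : ℝ) ≤ 1 + ‖z‖ := by positivity
  rw [← mul_div_assoc, div_le_iff₀ S.im_pos]
  calc (1 + ‖z‖) * _ ≤ (1 + ‖z‖) * (M ^ 2 / 2) := mul_le_mul_of_nonneg_left h1 h4
    _ ≤ r ^ 2 * (N * z.im) * (M ^ 2 / 2) := mul_le_mul_of_nonneg_right h2 (by positivity)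
    _ = _ := by ring

lemma TestVec.sum_sq_le {f : Fin N → ℂ} (hf : TestVec o d G z r M f) :
    ∑ b, ‖(grow o d G z *ᵥ f) b‖ ^ 2 ≤ N * (M ^ 2 / 2 * r ^ 2) := by
  refine le_trans ?_ hf.sq
  have : 0 ≤ ∑ b, ‖(grow o d G z *ᵥ f) b‖ ^ 2 := by positivity
  nlinarith [norm_nonneg z]

lemma TestVec.edgeVec (S : Scale N d z r) (hG : IsRegGraph N d G) {f : Fin N → ℂ}
    (hf : TestVec o d G z r M f) :
    EdgeVec (edgesOf G) M r (grow o d G z *ᵥ f) := by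
  have h0 : ∑ b, (grow o d G z *ᵥ f) b = 0 :=
    sum_gres_mulVec hG (compl_singleton_nonempty S.two_le o) S.im_pos f
  have hd : (0 : ℝ) < d := by exact_mod_cast S.one_le
  have h1 : (d : ℝ) * ∑ b, ‖(grow o d G z *ᵥ f) b‖ ^ 2 ≤ (N * d : ℝ) * (M * r) ^ 2 := by
    have := mul_le_mul_of_nonneg_left hf.sum_sq_le hd.le
    have h3 : 0 ≤ (N : ℝ) * d * (M * r) ^ 2 := by positivity
    nlinarith
  refine ⟨hf.sup, ?_, ?_, ?_, ?_⟩
  · rw [sum_edgesOf_fst hG, h0, mul_zero]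
  · rw [sum_edgesOf_snd hG, h0, mul_zero]
  · rw [sum_edgesOf_fst hG fun a => ‖(grow o d G z *ᵥ f) a‖ ^ 2, card_edgesOf hG]
    push_cast; exact h1
  · rw [sum_edgesOf_snd hG fun a => ‖(grow o d G z *ᵥ f) a‖ ^ 2, card_edgesOf hG]
    push_cast; exact h1

lemma TestVec.corr (S : Scale N d z r) (hG : IsRegGraph N d G) {f g : Fin N → ℂ}
    (hf : TestVec o d G z r M f) (hg : TestVec o d G z r M g)
    (hfg : ‖f ⬝ᵥ grow o d G z *ᵥ g‖ ≤ M ^ 2 / 2) :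
    ‖∑ e ∈ edgesOf G, (grow o d G z *ᵥ f) e.1 * (grow o d G z *ᵥ g) e.2‖ ≤
      (edgesOf G).card * (2 * del d * M ^ 2 * r ^ 2) := by
  have hδ := del_pos S.one_le
  have hN : (0 : ℝ) < N := by exact_mod_cast (by have := S.two_le; omega : 0 < N)
  have hd : (0 : ℝ) < d := by exact_mod_cast S.one_le
  rw [grow] at hfg ⊢
  rw [sum_edgesOf_gres hG S.one_le (compl_singleton_nonempty S.two_le o) S.im_pos,
    card_edgesOf hG]
  have h1 := hf.sq
  have h2 := hg.sq
  rw [grow] at h1 h2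
  set φ := gres {o}ᶜ d G z *ᵥ f
  set ψ := gres {o}ᶜ d G z *ᵥ g
  have h3 : ‖∑ b, φ b * ψ b‖ ≤ (∑ b, ‖φ b‖ ^ 2 + ∑ b, ‖ψ b‖ ^ 2) / 2 := by
    refine (norm_sum_le _ _).trans ?_
    rw [← Finset.sum_add_distrib, Finset.sum_div]
    refine Finset.sum_le_sum fun b _ => ?_
    rw [norm_mul]
    nlinarith [sq_nonneg (‖φ b‖ - ‖ψ b‖)]
  have h4 : ‖z * ∑ b, φ b * ψ b‖ ≤ N * (M ^ 2 / 2 * r ^ 2) := by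
    rw [norm_mul]
    calc ‖z‖ * _ ≤ (1 + ‖z‖) * ((∑ b, ‖φ b‖ ^ 2 + ∑ b, ‖ψ b‖ ^ 2) / 2) :=
          mul_le_mul (by linarith) h3 (norm_nonneg _) (by positivity)
      _ ≤ _ := by linarith
  have h5 : ‖f ⬝ᵥ ψ‖ ≤ N * (M ^ 2 / 2 * r ^ 2) := by
    refine hfg.trans ?_
    have := mul_le_mul_of_nonneg_left S.inv_le (by positivity : 0 ≤ M ^ 2 / 2)
    linarith
  rw [norm_mul, norm_mul, Complex.norm_natCast, Complex.norm_real, Real.norm_eq_abs,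
    abs_of_pos hδ]
  push_cast
  have h6 := (norm_add_le (z * ∑ b, φ b * ψ b) (f ⬝ᵥ ψ)).trans (add_le_add h4 h5)
  calc (d : ℝ) * del d * _ ≤ d * del d * (N * (M ^ 2 / 2 * r ^ 2) + N * (M ^ 2 / 2 * r ^ 2)) := by
        gcongr
    _ = N * d * (1 * del d * M ^ 2 * r ^ 2) := by ring
    _ ≤ _ := by gcongr; norm_num

/-- The graph after an attempted switching. -/
def moveGraph (o k : Fin N) (G : Fin N → Fin N → Bool) (e : Fin N × Fin N) :
    Fin N → Fin N → Bool :=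
  if SwitchValid G o k e then switchGraph o k e.1 e.2 G else G

lemma grow_switchRel (S : Scale N d z r) (hG : IsRegGraph N d G) (hok : G o k = true)
    {e : Fin N × Fin N} (he : e ∈ validEdges G o k) (g : Fin N → ℂ) :
    SwitchRel (del d) (grow o d G z) k (grow o d G z *ᵥ g)
      (grow o d (moveGraph o k G e) z *ᵥ g) e := by
  rw [mem_validEdges] at he
  rw [moveGraph, if_pos he.2]
  exact gres_switchRel hG (compl_singleton_nonempty S.two_le o) S.im_pos (by simp) hok he.1 he.2 g

lemma dotProduct_grow_moveGraph (S : Scale N d z r) (hG : IsRegGraph N d G) (hok : G o k = true)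
    {e : Fin N × Fin N} (he : e ∈ validEdges G o k) (f g : Fin N → ℂ) :
    f ⬝ᵥ grow o d (moveGraph o k G e) z *ᵥ g - f ⬝ᵥ grow o d G z *ᵥ g =
      del d * ((grow o d G z *ᵥ f) e.2 * ((grow o d (moveGraph o k G e) z *ᵥ g) e.1 -
        (grow o d (moveGraph o k G e) z *ᵥ g) k) +
        ((grow o d G z *ᵥ f) e.1 - (grow o d G z *ᵥ f) k) *
          (grow o d (moveGraph o k G e) z *ᵥ g) e.2) := by
  have h := grow_switchRel (z := z) S hG hok he g
  set ψ := grow o d G z *ᵥ g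
  set ψ' := grow o d (moveGraph o k G e) z *ᵥ g
  have h1 : ∀ c, (grow o d G z *ᵥ f) c = ∑ a, f a * grow o d G z a c := by
    intro c
    simp only [mulVec, dotProduct]
    refine Finset.sum_congr rfl fun a _ => ?_
    rw [grow_symm hG S.two_le S.im_pos o c a, mul_comm]
  have h2 : ∀ a, f a * ψ' a - f a * ψ a = del d * ((f a * grow o d G z a e.2) * (ψ' e.1 - ψ' k) +
      (f a * grow o d G z a e.1 - f a * grow o d G z a k) * ψ' e.2) := by
    intro a
    rw [h a]; ring
  simp only [dotProduct, ← Finset.sum_sub_distrib, h1]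
  simp only [h2, ← Finset.mul_sum, Finset.sum_add_distrib, ← Finset.sum_mul,
    Finset.sum_sub_distrib]

/-- Increments of a bilinear functional of the resolvent. -/
lemma prof_quad (S : Scale N d z r) (hG : IsRegGraph N d G) (hok : G o k = true)
    (hS : MoveSetup (edgesOf G) (validEdges G o k) (del d) r M (grow o d G z))
    {f g : Fin N → ℂ} (hf : TestVec o d G z r M f) (hg : TestVec o d G z r M g)
    (hfg : ‖f ⬝ᵥ grow o d G z *ᵥ g‖ ≤ M ^ 2 / 2) :
    Prof (edgesOf G) (fun e => f ⬝ᵥ grow o d (moveGraph o k G e) z *ᵥ g -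
      f ⬝ᵥ grow o d G z *ᵥ g) (8 * M ^ 2 * del d)
      (del d ^ 2 * (80 * M ^ 4 * r +
        M * ‖(grow o d G z *ᵥ f) k‖ * ‖(grow o d G z *ᵥ g) k‖))
      (340 * M ^ 6 * del d ^ 2 * r ^ 2) := by
  have hgf : ‖g ⬝ᵥ grow o d G z *ᵥ f‖ ≤ M ^ 2 / 2 := by
    rw [dotProduct_mulVec, ← mulVec_transpose, grow,
      gres_transpose hG (compl_singleton_nonempty S.two_le o) S.im_pos, dotProduct_comm]
    exact hfg
  refine (hS.prof_bilin (hf.edgeVec S hG) (hg.edgeVec S hG) ?_ (hf.corr S hG hg hfg)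
    (ψ' := fun e => grow o d (moveGraph o k G e) z *ᵥ g)
    fun e he => grow_switchRel S hG hok he g).congr fun e he => ?_
  · have := hg.corr S hG hf hgf
    simpa only [mul_comm] using this
  · by_cases hv : e ∈ validEdges G o k
    · rw [if_pos hv, dotProduct_grow_moveGraph S hG hok hv]
    · rw [if_neg hv, moveGraph, if_neg fun h => hv (mem_validEdges.mpr ⟨mem_edgesOf.mp he, h⟩),
        sub_self]

end GraphIncrement

/-! ### Increments of the linear and quadratic functionals of a row -/

section RowIncrement

open Matrix

variable {N d : ℕ} {z : ℂ} {r M A A' : ℝ} {o k : Fin N} {G : Fin N → Fin N → Bool}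

lemma moveGraph_of_mem {e : Fin N × Fin N} (he : e ∈ validEdges G o k) :
    SwitchValid G o k e := (mem_validEdges.mp he).2

lemma moveGraph_of_notMem {e : Fin N × Fin N} (he : e ∈ edgesOf G) (hv : e ∉ validEdges G o k) :
    ¬ SwitchValid G o k e := fun h => hv (mem_validEdges.mpr ⟨mem_edgesOf.mp he, h⟩)

/-- The vertex occupying the slot of `k` after an attempted switching. -/
def moveVertex (o k : Fin N) (G : Fin N → Fin N → Bool) (e : Fin N × Fin N) : Fin N :=
  if SwitchValid G o k e then e.1 else k

lemma star_single (a : Fin N) : star (Pi.single a (1 : ℂ) : Fin N → ℂ) = Pi.single a 1 := by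
  funext b
  by_cases h : b = a
  · subst h; simp
  · simp [h]

lemma grow_mulVec_single (G : Fin N → Fin N → Bool) (a b : Fin N) :
    (grow o d G z *ᵥ Pi.single a 1) b = grow o d G z b a := by simp

lemma single_dotProduct_grow (f : Fin N → ℂ) (a : Fin N) :
    (Pi.single a 1 : Fin N → ℂ) ⬝ᵥ grow o d G z *ᵥ f = (grow o d G z *ᵥ f) a := by simp

lemma dotProduct_grow_comm (S : Scale N d z r) (hG : IsRegGraph N d G) (f g : Fin N → ℂ) :
    f ⬝ᵥ grow o d G z *ᵥ g = g ⬝ᵥ grow o d G z *ᵥ f := by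
  rw [dotProduct_mulVec, ← mulVec_transpose, grow,
    gres_transpose hG (compl_singleton_nonempty S.two_le o) S.im_pos, dotProduct_comm]

lemma testVec_single (S : Scale N d z r) (hG : IsRegGraph N d G)
    (hR : InRegion A A' o d z G) (hA : A' ≤ A) (hA1 : 1 ≤ A) (hM : 2 * A + 2 ≤ M) (a : Fin N) :
    TestVec o d G z r M (Pi.single a 1) := by
  refine testVec_of S hG (star_single a) (fun b => ?_) ?_
  · rw [grow_mulVec_single]
    exact (hR.le' hA b a).trans (by linarith)
  · rw [single_dotProduct_grow, grow_mulVec_single]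
    refine (hR.le' hA a a).trans ?_
    nlinarith

lemma moveGraph_isRegGraph (hG : IsRegGraph N d G) (hok : G o k = true) {e : Fin N × Fin N}
    (he : e ∈ edgesOf G) : IsRegGraph N d (moveGraph o k G e) := by
  rw [moveGraph]
  split_ifs with h
  · exact switchGraph_isRegGraph hG hok (mem_edgesOf.mp he) h
  · exact hG

/-- The increment of a linear functional of the row. -/
lemma prof_linear (S : Scale N d z r) (hG : IsRegGraph N d G) (hok : G o k = true)
    (hR : InRegion A A' o d z G) (hA : A' ≤ A) (hA1 : 1 ≤ A) (hM : 2 * A + 2 ≤ M)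
    (hs : 8 * del d * M ≤ 1) {p : Fin N → ℂ} (hp : TestVec o d G z r M p) (b : Fin N) :
    Prof (edgesOf G) (fun e => (p + (del d : ℂ) • Pi.single (moveVertex o k G e) 1) ⬝ᵥ
        grow o d (moveGraph o k G e) z *ᵥ Pi.single b 1 - p ⬝ᵥ grow o d G z *ᵥ Pi.single b 1)
      (40 * M ^ 2 * del d)
      (del d ^ 2 * (400 * M ^ 4 * r + M * ‖(grow o d G z *ᵥ p) k‖ * ‖grow o d G z k b‖))
      (20000 * M ^ 6 * del d ^ 2 * r ^ 2) := by
  have hS := S.moveSetup hG hR hA hA1 hM hs k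
  have hb := testVec_single S hG hR hA hA1 hM b
  have hδ := del_pos S.one_le
  have hM1 : 1 ≤ M := by linarith
  have hr := S.r_pos
  have nδ : ‖(del d : ℂ)‖ = del d := by rw [Complex.norm_real, Real.norm_eq_abs, abs_of_pos hδ]
  have q1 := prof_quad S hG hok hS hp hb (by
    rw [dotProduct_grow_comm S hG, single_dotProduct_grow]
    refine (hp.sup b).trans ?_
    nlinarith)
  have q2 := hS.prof_new (hb.edgeVec S hG)
    (ψ' := fun e => grow o d (moveGraph o k G e) z *ᵥ Pi.single b 1)
    fun e he => grow_switchRel S hG hok he _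
  have q3 := hS.prof_invalid (f := fun _ => (del d : ℂ) * grow o d G z k b) (c := M) (by linarith)
    fun e _ => by
      rw [norm_mul, nδ, mul_comm]
      exact mul_le_mul_of_nonneg_right (hS.K_le _ _) hδ.le
  have hM2 : M ≤ M ^ 2 := by nlinarith
  have hM4 : M ^ 3 ≤ M ^ 4 := pow_le_pow_right₀ hM1 (by norm_num)
  have hM14 : M ≤ M ^ 4 := le_self_pow₀ hM1 (by norm_num)
  have hM46 : M ^ 4 ≤ M ^ 6 := pow_le_pow_right₀ hM1 (by norm_num)
  have hM26 : M ^ 2 ≤ M ^ 6 := pow_le_pow_right₀ hM1 (by norm_num)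
  refine (((q1.add q2).add q3).mono ?_ ?_ ?_).congr fun e he => ?_
  · nlinarith
  · rw [grow_mulVec_single]
    have : 80 * M ^ 4 * r + 50 * M ^ 3 * r + 4 * M * r ≤ 400 * M ^ 4 * r := by nlinarith
    nlinarith [mul_le_mul_of_nonneg_left this (sq_nonneg (del d))]
  · have : 2 * (2 * (340 * M ^ 6) + 2 * (130 * M ^ 4)) + 2 * (4 * M ^ 2) ≤ 20000 * M ^ 6 := by
      nlinarith
    have h2 := mul_le_mul_of_nonneg_right this (by positivity : 0 ≤ del d ^ 2 * r ^ 2)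
    nlinarith
  · by_cases hv : e ∈ validEdges G o k
    · have h := moveGraph_of_mem hv
      simp only [hv, if_true, moveVertex, h, add_dotProduct, smul_dotProduct,
        single_dotProduct_grow, smul_eq_mul]
      ring
    · have h := moveGraph_of_notMem he hv
      simp only [hv, if_false, moveVertex, moveGraph, h, add_dotProduct, smul_dotProduct,
        single_dotProduct_grow, smul_eq_mul, grow_mulVec_single]
      ring

/-- The increment of the trace. -/
lemma prof_trace (S : Scale N d z r) (hG : IsRegGraph N d G) (hok : G o k = true)
    (hR : InRegion A A' o d z G) (hA : A' ≤ A) (hA1 : 1 ≤ A) (hM : 2 * A + 2 ≤ M)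
    (hs : 8 * del d * M ≤ 1) :
    Prof (edgesOf G) (fun e => (grow o d (moveGraph o k G e) z).trace / N -
        (grow o d G z).trace / N)
      (8 * M ^ 2 * del d) (del d ^ 2 * (81 * M ^ 4 * r)) (340 * M ^ 6 * del d ^ 2 * r ^ 2) := by
  have hS := S.moveSetup hG hR hA hA1 hM hs k
  have hb := testVec_single S hG hR hA hA1 hM
  have hM1 : 1 ≤ M := by linarith
  have hr := S.r_pos
  have : Nonempty (Fin N) := ⟨o⟩
  have q : ∀ a, Prof (edgesOf G) (fun e => grow o d (moveGraph o k G e) z a a -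
      grow o d G z a a) (8 * M ^ 2 * del d)
      (del d ^ 2 * (80 * M ^ 4 * r + M * ‖grow o d G z k a‖ * ‖grow o d G z k a‖))
      (340 * M ^ 6 * del d ^ 2 * r ^ 2) := by
    intro a
    have := prof_quad S hG hok hS (hb a) (hb a) (by
      rw [single_dotProduct_grow, grow_mulVec_single]
      refine (hR.le' hA a a).trans ?_
      nlinarith)
    simpa only [single_dotProduct_grow, grow_mulVec_single] using this
  refine (Prof.avg (mn := del d ^ 2 * (81 * M ^ 4 * r)) q ?_).congr fun e _ => ?_
  · rw [← Finset.mul_sum, Finset.sum_add_distrib, Finset.sum_const, Finset.card_univ,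
      Fintype.card_fin, nsmul_eq_mul]
    have h1 : ∑ a, M * ‖grow o d G z k a‖ * ‖grow o d G z k a‖ ≤ N * (M ^ 4 * r) := by
      have h2 := (hb k).sum_sq_le
      have h3 : ∀ a, M * ‖grow o d G z k a‖ * ‖grow o d G z k a‖ =
          M * ‖(grow o d G z *ᵥ Pi.single k 1) a‖ ^ 2 := by
        intro a
        rw [grow_mulVec_single, grow_symm hG S.two_le S.im_pos o k a]; ring
      simp only [h3, ← Finset.mul_sum]
      have h4 : M * (M ^ 2 / 2 * r ^ 2) ≤ M ^ 4 * r := by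
        have h5 : r ^ 2 ≤ r := by nlinarith [S.r_le]
        have h6 : M ^ 3 ≤ M ^ 4 := pow_le_pow_right₀ hM1 (by norm_num)
        have h7 : 0 ≤ M ^ 3 := by positivity
        calc M * (M ^ 2 / 2 * r ^ 2) = M ^ 3 / 2 * r ^ 2 := by ring
          _ ≤ M ^ 4 * r := mul_le_mul (by linarith) h5 (sq_nonneg _) (by positivity)
      calc M * _ ≤ M * (N * (M ^ 2 / 2 * r ^ 2)) := mul_le_mul_of_nonneg_left h2 (by linarith)
        _ = N * (M * (M ^ 2 / 2 * r ^ 2)) := by ring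
        _ ≤ _ := by gcongr
    have := mul_le_mul_of_nonneg_left h1 (sq_nonneg (del d))
    nlinarith
  · rw [Finset.sum_sub_distrib, Fintype.card_fin, trace, trace]
    simp only [diag]
    ring

/-- The increment of the centred quadratic form of the row. -/
lemma prof_square (S : Scale N d z r) (hG : IsRegGraph N d G) (hok : G o k = true)
    (hR : InRegion A A' o d z G) (hA : A' ≤ A) (hA1 : 1 ≤ A) (hM : 2 * A + 2 ≤ M)
    (hs : 8 * del d * M ≤ 1) {p : Fin N → ℂ} (hp : TestVec o d G z r M p)
    (hpp : ‖p ⬝ᵥ grow o d G z *ᵥ p‖ ≤ M ^ 2 / 2) {t : ℝ} (ht0 : 0 ≤ t) (ht1 : t + del d ^ 2 ≤ 1) :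
    Prof (edgesOf G) (fun e =>
      ((p + (del d : ℂ) • Pi.single (moveVertex o k G e) 1) ⬝ᵥ grow o d (moveGraph o k G e) z *ᵥ
        (p + (del d : ℂ) • Pi.single (moveVertex o k G e) 1) -
          ((t + del d ^ 2 : ℝ) : ℂ) * ((grow o d (moveGraph o k G e) z).trace / N)) -
      (p ⬝ᵥ grow o d G z *ᵥ p - (t : ℂ) * ((grow o d G z).trace / N)))
      (40 * M ^ 2 * del d)
      (del d ^ 2 * (400 * M ^ 4 * r + M * ‖(grow o d G z *ᵥ p) k‖ * ‖(grow o d G z *ᵥ p) k‖))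
      (20000 * M ^ 6 * del d ^ 2 * r ^ 2) := by
  have hS := S.moveSetup hG hR hA hA1 hM hs k
  have hδ := del_pos S.one_le
  have hM1 : 1 ≤ M := by linarith
  have hr := S.r_pos
  have hδ1 : del d ≤ 1 := S.del_le.trans S.r_le
  have hN : (0 : ℝ) < N := by exact_mod_cast (by have := S.two_le; omega : 0 < N)
  have hN' : (N : ℂ) ≠ 0 := by exact_mod_cast hN.ne'
  have nδ : ‖(del d : ℂ)‖ = del d := by rw [Complex.norm_real, Real.norm_eq_abs, abs_of_pos hδ]
  set s : ℂ := (grow o d G z).trace / N with hsdef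
  have hsM : ‖s‖ ≤ M := by
    rw [hsdef, norm_div, Complex.norm_natCast, div_le_iff₀ hN]
    have h1 := hR.norm_trace_le
    have h2 : ‖(grow o d G z).trace‖ ≤ (1 + ‖z‖) * ‖(grow o d G z).trace‖ := by
      nlinarith [norm_nonneg z, norm_nonneg (grow o d G z).trace]
    nlinarith
  have q1 := prof_quad S hG hok hS hp hp hpp
  have q2 := (hS.prof_new (hp.edgeVec S hG) (ψ' := fun e => grow o d (moveGraph o k G e) z *ᵥ p)
    fun e he => grow_switchRel S hG hok he _).smul 2
  have q3 := hS.prof_diag hsM (by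
      rw [sum_edgesOf_fst hG fun a => grow o d G z a a, card_edgesOf hG, hsdef]
      simp only [trace, diag]
      push_cast
      field_simp)
    (K' := fun e => grow o d (moveGraph o k G e) z) fun e he => by
      have := grow_switchRel (z := z) S hG hok he (Pi.single e.1 1)
      intro a
      have h2 := this a
      simpa only [grow_mulVec_single] using h2
  have q4 := (prof_trace S hG hok hR hA hA1 hM hs).smul (-(t + del d ^ 2))
  have q5 := hS.prof_invalid (c := 4 * M) (by linarith)
    (f := fun _ => 2 * del d * (grow o d G z *ᵥ p) k + (del d : ℂ) ^ 2 * grow o d G z k k -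
      (del d : ℂ) ^ 2 * s) fun e _ => by
      have h1 : ‖2 * (del d : ℂ) * (grow o d G z *ᵥ p) k‖ ≤ 2 * M * del d := by
        rw [norm_mul, norm_mul, nδ]
        have := mul_le_mul_of_nonneg_left (hp.sup k) hδ.le
        simp only [RCLike.norm_ofNat]
        linarith
      have h2 : ∀ w : ℂ, ‖w‖ ≤ M → ‖(del d : ℂ) ^ 2 * w‖ ≤ M * del d := fun w hw => by
        rw [norm_mul, norm_pow, nδ]
        have h3 : del d ^ 2 ≤ del d := by nlinarith
        nlinarith [norm_nonneg w]
      have h3 := norm_sub_le (2 * (del d : ℂ) * (grow o d G z *ᵥ p) k +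
        (del d : ℂ) ^ 2 * grow o d G z k k) ((del d : ℂ) ^ 2 * s)
      have h4 := norm_add_le (2 * (del d : ℂ) * (grow o d G z *ᵥ p) k)
        ((del d : ℂ) ^ 2 * grow o d G z k k)
      have := h2 _ (hS.K_le k k)
      have := h2 _ hsM
      linarith
  have ht : |-(t + del d ^ 2)| ≤ 1 := by
    rw [abs_neg, abs_of_nonneg (by positivity)]; exact ht1
  have ht2 : (-(t + del d ^ 2)) ^ 2 ≤ 1 := by
    rw [← sq_abs]; nlinarith [abs_nonneg (-(t + del d ^ 2))]
  have hM2 : M ≤ M ^ 2 := by nlinarith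
  have hM24 : M ^ 2 ≤ M ^ 4 := pow_le_pow_right₀ hM1 (by norm_num)
  have hM4 : M ^ 3 ≤ M ^ 4 := pow_le_pow_right₀ hM1 (by norm_num)
  have hM14 : M ≤ M ^ 4 := le_self_pow₀ hM1 (by norm_num)
  have hM46 : M ^ 4 ≤ M ^ 6 := pow_le_pow_right₀ hM1 (by norm_num)
  have hM26 : M ^ 2 ≤ M ^ 6 := pow_le_pow_right₀ hM1 (by norm_num)
  have q4' := q4.mono (R' := 8 * M ^ 2 * del d) (mn' := del d ^ 2 * (81 * M ^ 4 * r))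
    (v' := 340 * M ^ 6 * del d ^ 2 * r ^ 2) (mul_le_of_le_one_left (by positivity) ht)
    (mul_le_of_le_one_left (by positivity) ht) (mul_le_of_le_one_left (by positivity) ht2)
  refine (((((q1.add q2).add q3).add q4').add q5).mono ?_ ?_ ?_).congr fun e he => ?_
  · rw [abs_of_pos (by norm_num : (0 : ℝ) < 2)]
    nlinarith
  · rw [abs_of_pos (by norm_num : (0 : ℝ) < 2)]
    have : 80 * M ^ 4 * r + 2 * (50 * M ^ 3 * r) + 16 * M ^ 2 * r + 81 * M ^ 4 * r +
        4 * (4 * M) * r ≤ 400 * M ^ 4 * r := by nlinarith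
    nlinarith [mul_le_mul_of_nonneg_left this (sq_nonneg (del d))]
  · have : 2 * (2 * (2 * (2 * (340 * M ^ 6) + 2 * (2 ^ 2 * (130 * M ^ 4))) + 2 * (9 * M ^ 2)) +
        2 * (340 * M ^ 6)) + 2 * (4 * (4 * M) ^ 2) ≤ 20000 * M ^ 6 := by
      nlinarith
    have h2 := mul_le_mul_of_nonneg_right this (by positivity : 0 ≤ del d ^ 2 * r ^ 2)
    nlinarith
  · have hG' := moveGraph_isRegGraph hG hok he
    have e1 : ∀ c : Fin N, p ⬝ᵥ grow o d (moveGraph o k G e) z *ᵥ Pi.single c 1 =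
        (grow o d (moveGraph o k G e) z *ᵥ p) c := fun c => by
      rw [dotProduct_grow_comm S hG', single_dotProduct_grow]
    rw [mulVec_add, mulVec_smul, add_dotProduct, dotProduct_add, dotProduct_add, dotProduct_smul,
      dotProduct_smul, smul_dotProduct, smul_dotProduct, e1, single_dotProduct_grow,
      single_dotProduct_grow, grow_mulVec_single]
    by_cases hv : e ∈ validEdges G o k
    · have h := moveGraph_of_mem hv
      simp only [hv, if_true, moveVertex, h, smul_eq_mul]
      push_cast
      ring
    · have h := moveGraph_of_notMem he hv
      simp only [hv, if_false, moveVertex, moveGraph, h, smul_eq_mul]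
      push_cast
      ring

end RowIncrement

/-! ### Concentration of the functionals of one row -/

section RowConcentration

open Matrix

lemma norm_le_of_re_le {x : ℂ} {c : ℝ} (h : ∀ j : Fin 4, (Complex.I ^ (j : ℕ) * x).re ≤ c) :
    ‖x‖ ≤ 2 * c := by
  have h0 := h 0
  have h1 := h 1
  have h2 := h 2
  have h3 := h 3
  simp [pow_succ] at h0 h1 h2 h3
  refine (Complex.norm_le_abs_re_add_abs_im x).trans ?_
  rcases abs_cases x.re with h | h <;> rcases abs_cases x.im with h' | h' <;> linarith

lemma exists_le_re {x : ℂ} {c : ℝ} (h : 2 * c < ‖x‖) :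
    ∃ j : Fin 4, c ≤ (Complex.I ^ (j : ℕ) * x).re := by
  by_contra! hc
  exact absurd (norm_le_of_re_le fun j => (hc j).le) (not_le.mpr h)

lemma norm_I_pow (j : ℕ) : ‖Complex.I ^ j‖ = 1 := by simp

lemma re_I_pow_mul_le (x : ℂ) (j : ℕ) : (Complex.I ^ j * x).re ≤ ‖x‖ :=
  (Complex.re_le_norm _).trans (by simp)

/-- The slots before `μ`. -/
def below (d μ : ℕ) : Finset (Fin d) := Finset.univ.filter fun ν => (ν : ℕ) < μ

/-- The slots from `μ` on. -/
def above (d μ : ℕ) : Finset (Fin d) := Finset.univ.filter fun ν => μ ≤ (ν : ℕ)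

lemma below_succ {d μ : ℕ} (h : μ < d) : below d (μ + 1) = insert ⟨μ, h⟩ (below d μ) := by
  ext ν
  simp only [below, Finset.mem_filter, Finset.mem_univ, true_and, Finset.mem_insert, Fin.ext_iff]
  omega

lemma notMem_below {d μ : ℕ} (h : μ < d) : (⟨μ, h⟩ : Fin d) ∉ below d μ := by
  simp [below]

lemma above_eq {d μ : ℕ} (h : μ < d) : above d μ = insert ⟨μ, h⟩ (above d (μ + 1)) := by
  ext ν
  simp only [above, Finset.mem_filter, Finset.mem_univ, true_and, Finset.mem_insert, Fin.ext_iff]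
  omega

lemma notMem_above {d μ : ℕ} (h : μ < d) : (⟨μ, h⟩ : Fin d) ∉ above d (μ + 1) := by
  simp [above]

lemma sum_below_succ {X : Type*} {V : Type*} [AddCommMonoid V] {d μ : ℕ} (h : μ < d)
    (F : X → V) (σ : Fin d → X) (x : X) :
    ∑ ν ∈ below d (μ + 1), F (Function.update σ ⟨μ, h⟩ x ν) = F x + ∑ ν ∈ below d μ, F (σ ν) := by
  rw [below_succ h, Finset.sum_insert (notMem_below h), Function.update_self]
  congr 1
  refine Finset.sum_congr rfl fun ν hν => ?_
  rw [Function.update_of_ne]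
  rintro rfl
  exact notMem_below h hν

lemma sum_below_update {X : Type*} {V : Type*} [AddCommMonoid V] {d μ : ℕ} (h : μ < d)
    (F : X → V) (σ : Fin d → X) (x : X) :
    ∑ ν ∈ below d μ, F (Function.update σ ⟨μ, h⟩ x ν) = ∑ ν ∈ below d μ, F (σ ν) := by
  refine Finset.sum_congr rfl fun ν hν => ?_
  rw [Function.update_of_ne]
  rintro rfl
  exact notMem_below h hν

lemma sum_above_update {X : Type*} {V : Type*} [AddCommMonoid V] {d μ : ℕ} (h : μ < d)
    (F : X → V) (σ : Fin d → X) (x : X) :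
    ∑ ν ∈ above d (μ + 1), F (Function.update σ ⟨μ, h⟩ x ν) =
      ∑ ν ∈ above d (μ + 1), F (σ ν) := by
  refine Finset.sum_congr rfl fun ν hν => ?_
  rw [Function.update_of_ne]
  rintro rfl
  exact notMem_above h hν

variable {N d : ℕ} {z : ℂ} {r M A A' : ℝ} {o k : Fin N} {G : Fin N → Fin N → Bool}

lemma move_eq (o : Fin N) (μ : Fin d) (ω : (Fin N → Fin N → Bool) × (Fin d → Fin N))
    (e : Fin N × Fin N) : move o μ ω e =
      (moveGraph o (ω.2 μ) ω.1 e, Function.update ω.2 μ (moveVertex o (ω.2 μ) ω.1 e)) := by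
  unfold move moveGraph moveVertex
  split_ifs <;> simp

/-- The part of the row indexed by the slots before `μ`. -/
def rowVec (d μ : ℕ) (σ : Fin d → Fin N) : Fin N → ℂ :=
  ∑ ν ∈ below d μ, (del d : ℂ) • Pi.single (σ ν) 1

lemma rowVec_zero (σ : Fin d → Fin N) : rowVec d 0 σ = 0 := by simp [rowVec, below]

lemma rowVec_succ {μ : ℕ} (h : μ < d) (σ : Fin d → Fin N) (x : Fin N) :
    rowVec d (μ + 1) (Function.update σ ⟨μ, h⟩ x) =
      rowVec d μ σ + (del d : ℂ) • Pi.single x 1 := by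
  rw [rowVec, sum_below_succ h (fun x : Fin N => (del d : ℂ) • (Pi.single x 1 : Fin N → ℂ)),
    add_comm, rowVec]

lemma star_rowVec (μ : ℕ) (σ : Fin d → Fin N) : star (rowVec d μ σ) = rowVec d μ σ := by
  rw [rowVec, star_sum]
  refine Finset.sum_congr rfl fun ν _ => ?_
  rw [star_smul, star_single]
  simp

lemma rowVec_full {ω : (Fin N → Fin N → Bool) × (Fin d → Fin N)} (h : IsLabelled d o ω) :
    rowVec d d ω.2 = hmat d ω.1 o := by
  obtain ⟨G, σ⟩ := ω
  obtain ⟨hG, hσ, hN⟩ := h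
  dsimp only at *
  have himg : Finset.univ.image σ = Finset.univ.filter fun j => G o j = true := by
    refine Finset.eq_of_subset_of_card_le ?_ ?_
    · intro x hx
      obtain ⟨ν, _, rfl⟩ := Finset.mem_image.mp hx
      simp [hN]
    · rw [hG.2.2 o, Finset.card_image_of_injective _ hσ]; simp
  funext a
  have hb : below d d = Finset.univ := by ext ν; simp [below]
  rw [rowVec, hb, Finset.sum_apply]
  simp only [Pi.smul_apply, smul_eq_mul]
  rw [← Finset.mul_sum, ← Finset.sum_image (s := Finset.univ) (g := σ)
    (f := fun x : Fin N => (Pi.single x (1 : ℂ) : Fin N → ℂ) a) (fun x _ y _ h => hσ h), himg]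
  simp [hmat, Pi.single_apply, Finset.sum_ite_eq]

/-- The functionals of the first slots of the row: the linear ones and the centred square. -/
def rowFun (o : Fin N) (d : ℕ) (z : ℂ) (μ : ℕ) (t : Option (Fin N))
    (ω : (Fin N → Fin N → Bool) × (Fin d → Fin N)) : ℂ :=
  match t with
  | some b => rowVec d μ ω.2 ⬝ᵥ grow o d ω.1 z *ᵥ Pi.single b 1
  | none => rowVec d μ ω.2 ⬝ᵥ grow o d ω.1 z *ᵥ rowVec d μ ω.2 -
      ((μ * del d ^ 2 : ℝ) : ℂ) * ((grow o d ω.1 z).trace / N)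

lemma rowFun_some (S : Scale N d z r) (μ : ℕ) (b : Fin N)
    {ω : (Fin N → Fin N → Bool) × (Fin d → Fin N)} (hG : IsRegGraph N d ω.1) :
    rowFun o d z μ (some b) ω = (grow o d ω.1 z *ᵥ rowVec d μ ω.2) b := by
  rw [rowFun, dotProduct_grow_comm S hG, single_dotProduct_grow]

lemma rowFun_full_some {ω : (Fin N → Fin N → Bool) × (Fin d → Fin N)}
    (h : IsLabelled d o ω) (b : Fin N) :
    rowFun o d z d (some b) ω = hvec o d ω.1 z b := by
  rw [rowFun, rowVec_full h, hvec]
  simp [dotProduct]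

lemma rowFun_full_none (S : Scale N d z r) {ω : (Fin N → Fin N → Bool) × (Fin d → Fin N)}
    (h : IsLabelled d o ω) :
    rowFun o d z d none ω = zfull o d ω.1 z - (grow o d ω.1 z).trace / N := by
  rw [rowFun, del_sq S.one_le]
  have : ∀ b, (grow o d ω.1 z *ᵥ rowVec d d ω.2) b = hvec o d ω.1 z b := fun b => by
    rw [← rowFun_some S d b h.1, rowFun_full_some h]
  simp only [dotProduct, this, zfull]
  rw [rowVec_full h]
  simp

/-- The bound for the drift of a functional when the slot of `k` is resampled. -/
def rowDrift (ρ ρ' : ℝ) (t : Option (Fin N)) (k : Fin N) : ℝ :=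
  ρ + if t = some k then ρ' else 0

lemma rowDrift_nonneg {ρ ρ' : ℝ} (h : 0 ≤ ρ) (h' : 0 ≤ ρ') (t : Option (Fin N)) (k : Fin N) :
    0 ≤ rowDrift ρ ρ' t k := by
  rw [rowDrift]; split_ifs <;> linarith

/-- Increments of the functionals of the row. -/
lemma prof_rowFun (S : Scale N d z r) {ω : (Fin N → Fin N → Bool) × (Fin d → Fin N)}
    (hω : IsLabelled d o ω) (hR : InRegion A A' o d z ω.1) (hA : A' ≤ A) (hA0 : 0 ≤ A')
    (hA1 : 1 ≤ A) (hM : 2 * A + 2 ≤ M) (hs : 8 * del d * M ≤ 1) {μ : ℕ} (hμ : μ < d) {ε : ℝ}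
    (hε : 0 ≤ ε) (hε1 : 2 * ε ≤ 1) (hY : ∀ t, ‖rowFun o d z μ t ω‖ ≤ 2 * ε)
    (t : Option (Fin N)) :
    Prof (edgesOf ω.1) (fun e => rowFun o d z (μ + 1) t (move o ⟨μ, hμ⟩ ω e) -
        rowFun o d z μ t ω)
      (40 * M ^ 2 * del d)
      (del d ^ 2 * rowDrift (400 * M ^ 4 * r + 2 * M * ε * A' + 4 * M * ε ^ 2)
        (2 * M * ε * A) t (ω.2 ⟨μ, hμ⟩))
      (del d ^ 2 * (20000 * M ^ 6 * r ^ 2)) := by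
  have hδ := del_pos S.one_le
  have hr := S.r_pos
  have hG := hω.1
  have hM1 : 1 ≤ M := by linarith
  set k := ω.2 ⟨μ, hμ⟩ with hk
  have hok : ω.1 o k = true := hω.2.2 _
  have hX : ∀ b, ‖(grow o d ω.1 z *ᵥ rowVec d μ ω.2) b‖ ≤ 2 * ε := fun b => by
    rw [← rowFun_some S μ b hG]; exact hY _
  have ht1 : μ * del d ^ 2 + del d ^ 2 ≤ 1 := by
    rw [← del_sq S.one_le]
    have : (μ : ℝ) + 1 ≤ d := by exact_mod_cast hμ
    nlinarith [sq_nonneg (del d)]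
  have ht0 : 0 ≤ μ * del d ^ 2 := by positivity
  have hN : (0 : ℝ) < N := by exact_mod_cast (by have := S.two_le; omega : 0 < N)
  have hpp : ‖rowVec d μ ω.2 ⬝ᵥ grow o d ω.1 z *ᵥ rowVec d μ ω.2‖ ≤ M ^ 2 / 2 := by
    have h1 : rowVec d μ ω.2 ⬝ᵥ grow o d ω.1 z *ᵥ rowVec d μ ω.2 = rowFun o d z μ none ω +
        ((μ * del d ^ 2 : ℝ) : ℂ) * ((grow o d ω.1 z).trace / N) := by
      rw [rowFun]; ring
    rw [h1]
    have h2 : ‖(grow o d ω.1 z).trace / N‖ ≤ A := by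
      rw [norm_div, Complex.norm_natCast, div_le_iff₀ hN]
      have := hR.norm_trace_le
      nlinarith [norm_nonneg z, norm_nonneg (grow o d ω.1 z).trace]
    refine (norm_add_le _ _).trans ?_
    rw [norm_mul, Complex.norm_real, Real.norm_eq_abs, abs_of_nonneg ht0]
    have h3 := hY none
    have h4 : μ * del d ^ 2 * ‖(grow o d ω.1 z).trace / N‖ ≤ 1 * A := by
      apply mul_le_mul _ h2 (norm_nonneg _) zero_le_one
      nlinarith [sq_nonneg (del d)]
    nlinarith
  have hp : TestVec o d ω.1 z r M (rowVec d μ ω.2) :=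
    testVec_of S hG (star_rowVec _ _) (fun a => (hX a).trans (by linarith)) hpp
  cases t with
  | some b =>
    refine ((prof_linear S hG hok hR hA hA1 hM hs hp b).mono le_rfl ?_ (le_of_eq (by ring))).congr
      fun e he => ?_
    · refine mul_le_mul_of_nonneg_left ?_ (by positivity)
      have h1 : M * ‖(grow o d ω.1 z *ᵥ rowVec d μ ω.2) k‖ * ‖grow o d ω.1 z k b‖ ≤
          M * (2 * ε) * ‖grow o d ω.1 z k b‖ := by gcongr; exact hX k
      have h2 : 0 ≤ 4 * M * ε ^ 2 := by positivity
      rw [rowDrift]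
      by_cases hkb : k = b
      · rw [if_pos (by rw [hkb])]
        have h3 := hR.le' hA k b
        have h4 : M * (2 * ε) * ‖grow o d ω.1 z k b‖ ≤ M * (2 * ε) * A := by gcongr
        have h5 : 0 ≤ 2 * M * ε * A' := by positivity
        linarith
      · rw [if_neg (fun h => hkb (Option.some.inj h).symm)]
        have h3 : ‖grow o d ω.1 z k b‖ ≤ A' := by
          have := hR.2 k b hkb
          nlinarith [norm_nonneg z, norm_nonneg (grow o d ω.1 z k b)]
        have h4 : M * (2 * ε) * ‖grow o d ω.1 z k b‖ ≤ M * (2 * ε) * A' := by gcongr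
        linarith
    · rw [move_eq]
      simp only [rowFun]
      rw [rowVec_succ]
  | none =>
    refine ((prof_square S hG hok hR hA hA1 hM hs hp hpp ht0 ht1).mono le_rfl ?_
      (le_of_eq (by ring))).congr fun e he => ?_
    · refine mul_le_mul_of_nonneg_left ?_ (by positivity)
      rw [rowDrift, if_neg (by simp)]
      have h1 : M * ‖(grow o d ω.1 z *ᵥ rowVec d μ ω.2) k‖ *
          ‖(grow o d ω.1 z *ᵥ rowVec d μ ω.2) k‖ ≤ M * (2 * ε) * (2 * ε) := by
        gcongr <;> exact hX k
      have h2 : 0 ≤ 2 * M * ε * A' := by positivity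
      nlinarith
    · rw [move_eq]
      simp only [rowFun]
      rw [rowVec_succ]
      congr 3
      push_cast
      ring

/-- Increments of the entries of the resolvent. -/
lemma prof_entry (S : Scale N d z r) (hG : IsRegGraph N d G) (hok : G o k = true)
    (hR : InRegion A A' o d z G) (hA : A' ≤ A) (hA0 : 0 ≤ A')
    (hA1 : 1 ≤ A) (hM : 2 * A + 2 ≤ M) (hs : 8 * del d * M ≤ 1) (a b : Fin N) :
    Prof (edgesOf G) (fun e => ((1 + ‖z‖ : ℝ) : ℂ) * grow o d (moveGraph o k G e) z a b -
        ((1 + ‖z‖ : ℝ) : ℂ) * grow o d G z a b)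
      (8 * M ^ 2 * del d)
      (del d ^ 2 * (80 * M ^ 4 * r + M * A' ^ 2 + if k = a ∨ k = b then M * A ^ 2 else 0))
      (del d ^ 2 * (340 * M ^ 6 * r ^ 2)) := by
  have hS := S.moveSetup hG hR hA hA1 hM hs k
  have hδ := del_pos S.one_le
  have hr := S.r_pos
  have hM1 : 1 ≤ M := by linarith
  set c := 1 + ‖z‖ with hc
  have hc1 : 1 ≤ c := by rw [hc]; linarith [norm_nonneg z]
  set s : ℂ := ((√c : ℝ) : ℂ) with hsdef
  have hss : s * s = (c : ℂ) := by
    rw [hsdef, ← Complex.ofReal_mul, Real.mul_self_sqrt (by linarith)]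
  have ns : ‖s‖ = √c := by
    rw [hsdef, Complex.norm_real, Real.norm_eq_abs, abs_of_nonneg (by positivity)]
  have hcc : √c * √c = c := Real.mul_self_sqrt (by linarith)
  have hsc : √c ≤ c := by
    have : 1 ≤ √c := by rw [Real.one_le_sqrt]; exact hc1
    nlinarith
  have vec : ∀ f : Fin N → ℂ, ∀ a : Fin N, f ⬝ᵥ (s • Pi.single a 1) = s * f a := fun f a => by
    rw [dotProduct_smul]; simp
  have gv : ∀ a x, (grow o d G z *ᵥ (s • Pi.single a 1)) x = s * grow o d G z x a := fun a x => by
    rw [mulVec_smul, Pi.smul_apply, grow_mulVec_single, smul_eq_mul]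
  have quad : ∀ G' a b, (s • Pi.single a 1 : Fin N → ℂ) ⬝ᵥ grow o d G' z *ᵥ (s • Pi.single b 1) =
      (c : ℂ) * grow o d G' z a b := fun G' a b => by
    rw [smul_dotProduct, mulVec_smul, dotProduct_smul, single_dotProduct_grow, grow_mulVec_single,
      smul_eq_mul, smul_eq_mul, ← mul_assoc, hss]
  have nquad : ∀ a b, ‖(c : ℂ) * grow o d G z a b‖ ≤ A := fun a b => by
    rw [norm_mul, Complex.norm_real, Real.norm_eq_abs, abs_of_pos (by linarith)]
    exact hR.le hA a b
  have hAM : A ≤ M ^ 2 / 2 := by nlinarith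
  have tv : ∀ a, TestVec o d G z r M (s • Pi.single a 1) := fun a => by
    refine testVec_of S hG ?_ (fun x => ?_) ?_
    · rw [star_smul, star_single, hsdef]; simp
    · rw [gv, norm_mul, ns]
      have := hR.le hA x a
      nlinarith [norm_nonneg (grow o d G z x a)]
    · rw [quad]; exact (nquad a a).trans hAM
  refine ((prof_quad S hG hok hS (tv a) (tv b) (by rw [quad]; exact (nquad a b).trans hAM)).mono
    le_rfl ?_ (le_of_eq (by ring))).congr fun e he => by rw [quad, quad]
  refine mul_le_mul_of_nonneg_left ?_ (by positivity)
  rw [gv, gv, norm_mul, norm_mul, ns]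
  have nn : ∀ a, 0 ≤ ‖grow o d G z k a‖ := fun a => norm_nonneg _
  have h1 : M * (√c * ‖grow o d G z k a‖) * (√c * ‖grow o d G z k b‖) =
      M * ((c * ‖grow o d G z k a‖) * ‖grow o d G z k b‖) := by
    linear_combination M * ‖grow o d G z k a‖ * ‖grow o d G z k b‖ * hcc
  rw [h1]
  split_ifs with hk
  · have h2 : (c * ‖grow o d G z k a‖) * ‖grow o d G z k b‖ ≤ A * A :=
      mul_le_mul (hR.le hA k a) (hR.le' hA k b) (nn b) (by linarith)
    have h3 : 0 ≤ M * A' ^ 2 := by positivity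
    have := mul_le_mul_of_nonneg_left h2 (by linarith : 0 ≤ M)
    nlinarith
  · push Not at hk
    have h4 : ‖grow o d G z k b‖ ≤ A' := by
      have := hR.2 k b hk.2
      nlinarith [norm_nonneg z, nn b]
    have h2 : (c * ‖grow o d G z k a‖) * ‖grow o d G z k b‖ ≤ A' * A' :=
      mul_le_mul (hR.2 k a hk.1) h4 (nn b) hA0
    have := mul_le_mul_of_nonneg_left h2 (by linarith : 0 ≤ M)
    nlinarith

end RowConcentration

section RowTheorem

open Matrix

variable {N d : ℕ} {z : ℂ} {r M A A' B ε ε₁ θ : ℝ} {o k : Fin N} {G : Fin N → Fin N → Bool}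

lemma Prof.exp_step {ι : Type*} {E : Finset ι} {Y' : ι → ℂ} {Y : ℂ} {R s mn v : ℝ}
    (h : Prof E (fun e => Y' e - Y) R (s * mn) (s * v)) (hθ : 0 ≤ θ) {w : ℂ} (hw : ‖w‖ = 1)
    (ε c : ℝ) :
    ∑ e ∈ E, Real.exp (θ * ((w * Y' e).re - ε) + c) ≤
      E.card * Real.exp (θ * ((w * Y).re - ε) +
        (c + θ * s * (mn + θ * v * Real.exp (θ * R)))) := by
  have h1 := h.exp_sum_le hθ hw (c + θ * ((w * Y).re - ε))
  refine le_trans (le_of_eq (Finset.sum_congr rfl fun e _ => ?_)) (h1.trans (le_of_eq ?_))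
  · congr 1
    rw [mul_sub w, Complex.sub_re]; ring
  · congr 2; ring

lemma card_filter_eq_le_one {σ : Fin d → Fin N} (hσ : Function.Injective σ) (s : Finset (Fin d))
    (b : Fin N) (c : ℝ) (hc : 0 ≤ c) : ∑ ν ∈ s, (if b = σ ν then c else 0) ≤ c := by
  rw [Finset.sum_ite, Finset.sum_const_zero, add_zero, Finset.sum_const, nsmul_eq_mul]
  have : (s.filter fun ν => b = σ ν).card ≤ 1 := by
    rw [Finset.card_le_one]
    intro x hx y hy
    rw [Finset.mem_filter] at hx hy
    exact hσ (hx.2.symm.trans hy.2)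
  have h2 : ((s.filter fun ν => b = σ ν).card : ℝ) ≤ 1 := by exact_mod_cast this
  nlinarith

/-- The supersolution of the forward equation. -/
def rowSuper (o : Fin N) (d : ℕ) (z : ℂ) (θ ε ρ ρ' : ℝ) (μ : ℕ)
    (ω : (Fin N → Fin N → Bool) × (Fin d → Fin N)) : ℝ :=
  ∑ t : Option (Fin N), ∑ j : Fin 4,
    Real.exp (θ * ((Complex.I ^ (j : ℕ) * rowFun o d z μ t ω).re - ε) +
      θ * del d ^ 2 * ∑ ν ∈ above d μ, rowDrift ρ ρ' t (ω.2 ν))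

/-- The bound for the drift of an entry when the slot of `k` is resampled. -/
def entryDrift (ρ ρ' : ℝ) (a b k : Fin N) : ℝ := ρ + if k = a ∨ k = b then ρ' else 0

/-- The supersolution of the backward equation. -/
def entrySuper (o : Fin N) (d : ℕ) (z : ℂ) (θ B ε ρ ρ' : ℝ) (μ : ℕ)
    (ω : (Fin N → Fin N → Bool) × (Fin d → Fin N)) : ℝ :=
  ∑ a : Fin N, ∑ b : Fin N, ∑ j : Fin 4,
    Real.exp (θ * ((Complex.I ^ (j : ℕ) *
        (((1 + ‖z‖ : ℝ) : ℂ) * grow o d ω.1 z a b)).re - 4 * (if a = b then B else ε)) +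
      θ * del d ^ 2 * ∑ ν ∈ below d μ, entryDrift ρ ρ' a b (ω.2 ν))

lemma rowSuper_nonneg {ρ ρ' : ℝ} (μ : ℕ) (ω : (Fin N → Fin N → Bool) × (Fin d → Fin N)) :
    0 ≤ rowSuper o d z θ ε ρ ρ' μ ω := by
  rw [rowSuper]; positivity

lemma entrySuper_nonneg {ρ ρ' : ℝ} (μ : ℕ) (ω : (Fin N → Fin N → Bool) × (Fin d → Fin N)) :
    0 ≤ entrySuper o d z θ B ε ρ ρ' μ ω := by
  rw [entrySuper]; positivity

lemma rowSuper_ge {ρ ρ' : ℝ} (t : Option (Fin N)) (j : Fin 4) (μ : ℕ)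
    (ω : (Fin N → Fin N → Bool) × (Fin d → Fin N)) :
    Real.exp (θ * ((Complex.I ^ (j : ℕ) * rowFun o d z μ t ω).re - ε) +
      θ * del d ^ 2 * ∑ ν ∈ above d μ, rowDrift ρ ρ' t (ω.2 ν)) ≤
      rowSuper o d z θ ε ρ ρ' μ ω := by
  rw [rowSuper]
  refine le_trans ?_ (Finset.single_le_sum (f := fun t : Option (Fin N) => ∑ j : Fin 4,
    Real.exp (θ * ((Complex.I ^ (j : ℕ) * rowFun o d z μ t ω).re - ε) +
      θ * del d ^ 2 * ∑ ν ∈ above d μ, rowDrift ρ ρ' t (ω.2 ν)))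
    (fun i _ => by positivity) (Finset.mem_univ t))
  exact Finset.single_le_sum (f := fun j : Fin 4 =>
    Real.exp (θ * ((Complex.I ^ (j : ℕ) * rowFun o d z μ t ω).re - ε) +
      θ * del d ^ 2 * ∑ ν ∈ above d μ, rowDrift ρ ρ' t (ω.2 ν)))
    (fun i _ => by positivity) (Finset.mem_univ j)

lemma entrySuper_ge {ρ ρ' : ℝ} (a b : Fin N) (j : Fin 4) (μ : ℕ)
    (ω : (Fin N → Fin N → Bool) × (Fin d → Fin N)) :
    Real.exp (θ * ((Complex.I ^ (j : ℕ) *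
        (((1 + ‖z‖ : ℝ) : ℂ) * grow o d ω.1 z a b)).re - 4 * (if a = b then B else ε)) +
      θ * del d ^ 2 * ∑ ν ∈ below d μ, entryDrift ρ ρ' a b (ω.2 ν)) ≤
      entrySuper o d z θ B ε ρ ρ' μ ω := by
  rw [entrySuper]
  refine le_trans ?_ (Finset.single_le_sum (f := fun a : Fin N => ∑ b : Fin N, ∑ j : Fin 4,
    Real.exp (θ * ((Complex.I ^ (j : ℕ) *
        (((1 + ‖z‖ : ℝ) : ℂ) * grow o d ω.1 z a b)).re - 4 * (if a = b then B else ε)) +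
      θ * del d ^ 2 * ∑ ν ∈ below d μ, entryDrift ρ ρ' a b (ω.2 ν)))
    (fun i _ => by positivity) (Finset.mem_univ a))
  refine le_trans ?_ (Finset.single_le_sum (f := fun b : Fin N => ∑ j : Fin 4,
    Real.exp (θ * ((Complex.I ^ (j : ℕ) *
        (((1 + ‖z‖ : ℝ) : ℂ) * grow o d ω.1 z a b)).re - 4 * (if a = b then B else ε)) +
      θ * del d ^ 2 * ∑ ν ∈ below d μ, entryDrift ρ ρ' a b (ω.2 ν)))
    (fun i _ => by positivity) (Finset.mem_univ b))
  exact Finset.single_le_sum (f := fun j : Fin 4 => Real.exp (θ * ((Complex.I ^ (j : ℕ) *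
        (((1 + ‖z‖ : ℝ) : ℂ) * grow o d ω.1 z a b)).re - 4 * (if a = b then B else ε)) +
      θ * del d ^ 2 * ∑ ν ∈ below d μ, entryDrift ρ ρ' a b (ω.2 ν)))
    (fun i _ => by positivity) (Finset.mem_univ j)

lemma rowSuper_step (S : Scale N d z r) {ω : (Fin N → Fin N → Bool) × (Fin d → Fin N)}
    (hω : IsLabelled d o ω) (hR : InRegion A A' o d z ω.1) (hA : A' ≤ A) (hA0 : 0 ≤ A')
    (hA1 : 1 ≤ A) (hM : 2 * A + 2 ≤ M) (hs : 8 * del d * M ≤ 1) {μ : ℕ} (hμ : μ < d)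
    (hε : 0 ≤ ε) (hε1 : 2 * ε ≤ 1) (hθ : 0 < θ) {ρ ρ' : ℝ}
    (hρ : 400 * M ^ 4 * r + 2 * M * ε * A' + 4 * M * ε ^ 2 +
      θ * (20000 * M ^ 6 * r ^ 2) * Real.exp (θ * (40 * M ^ 2 * del d)) = ρ)
    (hρ' : 2 * M * ε * A = ρ') (hlt : rowSuper o d z θ ε ρ ρ' μ ω < 1) :
    ∑ e ∈ edgesOf ω.1, rowSuper o d z θ ε ρ ρ' (μ + 1) (move o ⟨μ, hμ⟩ ω e) ≤
      ((N * d : ℕ) : ℝ) * rowSuper o d z θ ε ρ ρ' μ ω := by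
  have hδ := del_pos S.one_le
  have hr := S.r_pos
  have hM1 : 1 ≤ M := by linarith
  have hρ0 : 0 ≤ ρ := by rw [← hρ]; positivity
  have hρ0' : 0 ≤ ρ' := by
    rw [← hρ']
    have : 0 ≤ A := by linarith
    positivity
  have hY : ∀ t, ‖rowFun o d z μ t ω‖ ≤ 2 * ε := fun t => by
    refine norm_le_of_re_le fun j => ?_
    have h1 := (rowSuper_ge (o := o) (z := z) (θ := θ) (ε := ε) (ρ := ρ) (ρ' := ρ') t j μ
      ω).trans_lt
      hlt
    rw [Real.exp_lt_one_iff] at h1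
    have h2 : 0 ≤ θ * del d ^ 2 * ∑ ν ∈ above d μ, rowDrift ρ ρ' t (ω.2 ν) :=
      mul_nonneg (by positivity) (Finset.sum_nonneg fun ν _ => rowDrift_nonneg hρ0 hρ0' _ _)
    by_contra hc
    push Not at hc
    have : 0 < θ * ((Complex.I ^ (j : ℕ) * rowFun o d z μ t ω).re - ε) :=
      mul_pos hθ (by linarith)
    linarith
  unfold rowSuper
  rw [Finset.sum_comm, Finset.mul_sum]
  refine Finset.sum_le_sum fun t _ => ?_
  rw [Finset.sum_comm, Finset.mul_sum]
  refine Finset.sum_le_sum fun j _ => ?_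
  have h1 := (prof_rowFun S hω hR hA hA0 hA1 hM hs hμ hε hε1 hY t).exp_step hθ.le
    (norm_I_pow j) ε (θ * del d ^ 2 * ∑ ν ∈ above d (μ + 1), rowDrift ρ ρ' t (ω.2 ν))
  rw [card_edgesOf hω.1] at h1
  refine le_trans (le_of_eq (Finset.sum_congr rfl fun e _ => ?_)) (h1.trans (le_of_eq ?_))
  · congr 2
    rw [move_eq]
    dsimp only
    rw [sum_above_update hμ (rowDrift ρ ρ' t)]
  · congr 3
    rw [above_eq hμ, Finset.sum_insert (notMem_above hμ)]
    have : rowDrift (400 * M ^ 4 * r + 2 * M * ε * A' + 4 * M * ε ^ 2) (2 * M * ε * A) t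
        (ω.2 ⟨μ, hμ⟩) + θ * (20000 * M ^ 6 * r ^ 2) * Real.exp (θ * (40 * M ^ 2 * del d)) =
        rowDrift ρ ρ' t (ω.2 ⟨μ, hμ⟩) := by
      rw [rowDrift, rowDrift, ← hρ, ← hρ']; ring
    rw [this]; ring

lemma entrySuper_step (S : Scale N d z r) {ω : (Fin N → Fin N → Bool) × (Fin d → Fin N)}
    (hω : IsLabelled d o ω) (hR : InRegion A A' o d z ω.1) (hA : A' ≤ A) (hA0 : 0 ≤ A')
    (hA1 : 1 ≤ A) (hM : 2 * A + 2 ≤ M) (hs : 8 * del d * M ≤ 1) {μ : ℕ} (hμ : μ < d)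
    (hθ : 0 < θ) {ρ ρ' : ℝ}
    (hρ : 80 * M ^ 4 * r + M * A' ^ 2 +
      θ * (340 * M ^ 6 * r ^ 2) * Real.exp (θ * (8 * M ^ 2 * del d)) = ρ)
    (hρ' : M * A ^ 2 = ρ') :
    ∑ e ∈ edgesOf ω.1, entrySuper o d z θ B ε ρ ρ' μ (move o ⟨μ, hμ⟩ ω e) ≤
      ((N * d : ℕ) : ℝ) * entrySuper o d z θ B ε ρ ρ' (μ + 1) ω := by
  unfold entrySuper
  rw [Finset.sum_comm, Finset.mul_sum]
  refine Finset.sum_le_sum fun a _ => ?_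
  rw [Finset.sum_comm, Finset.mul_sum]
  refine Finset.sum_le_sum fun b _ => ?_
  rw [Finset.sum_comm, Finset.mul_sum]
  refine Finset.sum_le_sum fun j _ => ?_
  have h1 := (prof_entry S hω.1 (hω.2.2 ⟨μ, hμ⟩) hR hA hA0 hA1 hM hs a b).exp_step hθ.le
    (norm_I_pow j) (4 * (if a = b then B else ε))
    (θ * del d ^ 2 * ∑ ν ∈ below d μ, entryDrift ρ ρ' a b (ω.2 ν))
  rw [card_edgesOf hω.1] at h1
  refine le_trans (le_of_eq (Finset.sum_congr rfl fun e _ => ?_)) (h1.trans (le_of_eq ?_))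
  · rw [move_eq]
    dsimp only
    rw [sum_below_update hμ (entryDrift ρ ρ' a b)]
  · congr 3
    rw [below_succ hμ, Finset.sum_insert (notMem_below hμ)]
    have : 80 * M ^ 4 * r + M * A' ^ 2 + (if ω.2 ⟨μ, hμ⟩ = a ∨ ω.2 ⟨μ, hμ⟩ = b then M * A ^ 2
        else 0) + θ * (340 * M ^ 6 * r ^ 2) * Real.exp (θ * (8 * M ^ 2 * del d)) =
        entryDrift ρ ρ' a b (ω.2 ⟨μ, hμ⟩) := by
      rw [entryDrift, ← hρ, ← hρ']; ring
    rw [this]; ring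

lemma rowSuper_zero_le (hd : 1 ≤ d) {ω : (Fin N → Fin N → Bool) × (Fin d → Fin N)}
    (hω : IsLabelled d o ω) (hθ : 0 < θ) {ρ ρ' : ℝ} (hρ' : 0 ≤ ρ')
    (h : ρ + ρ' * del d ^ 2 ≤ ε / 2) :
    rowSuper o d z θ ε ρ ρ' 0 ω ≤ 4 * (N + 1) * Real.exp (-(θ * (ε / 2))) := by
  have key : ∀ t : Option (Fin N), ∀ j : Fin 4,
      Real.exp (θ * ((Complex.I ^ (j : ℕ) * rowFun o d z 0 t ω).re - ε) +
      θ * del d ^ 2 * ∑ ν ∈ above d 0, rowDrift ρ ρ' t (ω.2 ν)) ≤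
      Real.exp (-(θ * (ε / 2))) := by
    intro t j
    have h0 : rowFun o d z 0 t ω = 0 := by
      cases t <;> simp [rowFun, rowVec_zero]
    have h1 : ∑ ν ∈ above d 0, rowDrift ρ ρ' t (ω.2 ν) ≤ d * ρ + ρ' := by
      simp only [rowDrift]
      rw [Finset.sum_add_distrib]
      refine add_le_add ?_ ?_
      · simp [above]
      · cases t with
        | none => simp [hρ']
        | some b =>
          simp only [Option.some.injEq]
          exact card_filter_eq_le_one hω.2.1 _ b ρ' hρ'
    rw [h0, mul_zero, Complex.zero_re]
    refine Real.exp_le_exp.mpr ?_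
    have h2 := mul_le_mul_of_nonneg_left h1 (by positivity : 0 ≤ θ * del d ^ 2)
    have h3 : θ * del d ^ 2 * (d * ρ + ρ') = θ * (ρ + ρ' * del d ^ 2) := by
      linear_combination θ * ρ * del_sq hd
    have h4 := mul_le_mul_of_nonneg_left h hθ.le
    linarith
  unfold rowSuper
  refine (Finset.sum_le_sum fun t _ => Finset.sum_le_sum fun j _ => key t j).trans (le_of_eq ?_)
  simp
  ring

lemma entrySuper_full_le (hd : 1 ≤ d) {ω : (Fin N → Fin N → Bool) × (Fin d → Fin N)}
    (hω : IsLabelled d o ω) (hW : InRegion (3 * B) (3 * ε) o d z ω.1) (hεB : ε ≤ B)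
    (hθ : 0 < θ) {ρ ρ' : ℝ} (hρ' : 0 ≤ ρ') (h : ρ + 2 * ρ' * del d ^ 2 ≤ ε / 2) :
    entrySuper o d z θ B ε ρ ρ' d ω ≤ 4 * N ^ 2 * Real.exp (-(θ * (ε / 2))) := by
  have hz : 0 ≤ 1 + ‖z‖ := by positivity
  have key : ∀ a b : Fin N, ∀ j : Fin 4,
      Real.exp (θ * ((Complex.I ^ (j : ℕ) *
        (((1 + ‖z‖ : ℝ) : ℂ) * grow o d ω.1 z a b)).re - 4 * (if a = b then B else ε)) +
      θ * del d ^ 2 * ∑ ν ∈ below d d, entryDrift ρ ρ' a b (ω.2 ν)) ≤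
      Real.exp (-(θ * (ε / 2))) := by
    intro a b j
    have h0 : (Complex.I ^ (j : ℕ) * (((1 + ‖z‖ : ℝ) : ℂ) * grow o d ω.1 z a b)).re ≤
        3 * (if a = b then B else ε) := by
      refine (re_I_pow_mul_le _ _).trans ?_
      rw [norm_mul, Complex.norm_real, Real.norm_eq_abs, abs_of_nonneg hz]
      split_ifs with hab
      · subst hab; exact hW.1 a
      · exact hW.2 a b hab
    have h1 : ∑ ν ∈ below d d, entryDrift ρ ρ' a b (ω.2 ν) ≤ d * ρ + 2 * ρ' := by
      have e1 : ∀ ν, entryDrift ρ ρ' a b (ω.2 ν) ≤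
          ρ + ((if a = ω.2 ν then ρ' else 0) + if b = ω.2 ν then ρ' else 0) := by
        intro ν
        simp only [entryDrift, eq_comm (a := a), eq_comm (a := b)]
        by_cases h1 : ω.2 ν = a <;> by_cases h2 : ω.2 ν = b <;> simp [h1, h2] <;>
          (try split_ifs) <;> linarith
      refine (Finset.sum_le_sum fun ν _ => e1 ν).trans ?_
      rw [Finset.sum_add_distrib, Finset.sum_add_distrib]
      have e2 := card_filter_eq_le_one hω.2.1 (below d d) a ρ' hρ'
      have e3 := card_filter_eq_le_one hω.2.1 (below d d) b ρ' hρ'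
      have e4 : ∑ ν ∈ below d d, ρ = d * ρ := by simp [below]
      linarith
    refine Real.exp_le_exp.mpr ?_
    have h2 := mul_le_mul_of_nonneg_left h1 (by positivity : 0 ≤ θ * del d ^ 2)
    have h3 : θ * del d ^ 2 * (d * ρ + 2 * ρ') = θ * (ρ + 2 * ρ' * del d ^ 2) := by
      linear_combination θ * ρ * del_sq hd
    have h4 := mul_le_mul_of_nonneg_left h hθ.le
    have h5 : ε ≤ if a = b then B else ε := by split_ifs <;> linarith
    have h6 : θ * ((Complex.I ^ (j : ℕ) *
        (((1 + ‖z‖ : ℝ) : ℂ) * grow o d ω.1 z a b)).re - 4 * (if a = b then B else ε)) ≤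
        θ * (-ε) := mul_le_mul_of_nonneg_left (by linarith) hθ.le
    linarith
  unfold entrySuper
  refine (Finset.sum_le_sum fun a _ => Finset.sum_le_sum fun b _ =>
    Finset.sum_le_sum fun j _ => key a b j).trans (le_of_eq ?_)
  simp
  ring

lemma one_le_entrySuper {ω : (Fin N → Fin N → Bool) × (Fin d → Fin N)} (hθ : 0 < θ)
    {ρ ρ' : ℝ} (hρ : 0 ≤ ρ) (hρ' : 0 ≤ ρ') (hW : ¬ InRegion (8 * B) (8 * ε) o d z ω.1) (μ : ℕ) :
    1 ≤ entrySuper o d z θ B ε ρ ρ' μ ω := by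
  have key : ∃ a b, 2 * (4 * (if a = b then B else ε)) <
      ‖((1 + ‖z‖ : ℝ) : ℂ) * grow o d ω.1 z a b‖ := by
    have e : ∀ a b, ‖((1 + ‖z‖ : ℝ) : ℂ) * grow o d ω.1 z a b‖ =
        (1 + ‖z‖) * ‖grow o d ω.1 z a b‖ := fun a b => by
      rw [norm_mul, Complex.norm_real, Real.norm_eq_abs, abs_of_nonneg (by positivity)]
    simp only [e]
    by_contra! hc
    refine hW ⟨fun a => ?_, fun a b hab => ?_⟩
    · have := hc a a
      rw [if_pos rfl] at this
      linarith
    · have := hc a b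
      rw [if_neg hab] at this
      linarith
  obtain ⟨a, b, hab⟩ := key
  obtain ⟨j, hj⟩ := exists_le_re hab
  refine le_trans ?_ (entrySuper_ge a b j μ ω)
  rw [Real.one_le_exp_iff]
  refine add_nonneg (mul_nonneg hθ.le (by linarith)) (mul_nonneg (by positivity)
    (Finset.sum_nonneg fun ν _ => ?_))
  rw [entryDrift]
  split_ifs <;> linarith

/-- The row of `o` fails to be typical. -/
def BadRow (o : Fin N) (d : ℕ) (z : ℂ) (ε : ℝ) (G : Fin N → Fin N → Bool) : Prop :=
  (∃ b, 2 * ε < ‖hvec o d G z b‖) ∨ 2 * ε < ‖zfull o d G z - (grow o d G z).trace / N‖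

/-- In a typical graph the row of a vertex is concentrated. -/
theorem card_badRow_le (S : Scale N d z r) (o : Fin N) (hB : 1 ≤ B) (hε₁ : 0 ≤ ε₁) (hε₁B : ε₁ ≤ B)
    (hM : 16 * B + 2 ≤ M) (hs : 8 * del d * M ≤ 1) (hε : 0 ≤ ε) (hε1 : 2 * ε ≤ 1) (hθ : 0 < θ)
    (hf : 400 * M ^ 4 * r + 2 * M * ε * (8 * ε₁) + 4 * M * ε ^ 2 +
      θ * (20000 * M ^ 6 * r ^ 2) * Real.exp (θ * (40 * M ^ 2 * del d)) +
      2 * M * ε * (8 * B) * del d ^ 2 ≤ ε / 2)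
    (hg : 80 * M ^ 4 * r + M * (8 * ε₁) ^ 2 +
      θ * (340 * M ^ 6 * r ^ 2) * Real.exp (θ * (8 * M ^ 2 * del d)) +
      2 * (M * (8 * B) ^ 2) * del d ^ 2 ≤ ε₁ / 2) :
    (cardOf fun G : Fin N → Fin N → Bool => IsRegGraph N d G ∧
      (InRegion (3 * B) (3 * ε₁) o d z G ∧ BadRow o d z ε G) : ℝ) ≤
      (cardOf fun G : Fin N → Fin N → Bool => IsRegGraph N d G) *
        (4 * (N + 1) * Real.exp (-(θ * (ε / 2))) + 4 * N ^ 2 * Real.exp (-(θ * (ε₁ / 2)))) := by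
  classical
  have hr := S.r_pos
  have hδ := del_pos S.one_le
  have hM1 : 1 ≤ M := by linarith
  have hN : 0 < N := by have := S.two_le; omega
  set ρ := 400 * M ^ 4 * r + 2 * M * ε * (8 * ε₁) + 4 * M * ε ^ 2 +
      θ * (20000 * M ^ 6 * r ^ 2) * Real.exp (θ * (40 * M ^ 2 * del d)) with hρ
  set ρ' := 2 * M * ε * (8 * B) with hρ'
  set τ := 80 * M ^ 4 * r + M * (8 * ε₁) ^ 2 +
      θ * (340 * M ^ 6 * r ^ 2) * Real.exp (θ * (8 * M ^ 2 * del d)) with hτ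
  set τ' := M * (8 * B) ^ 2 with hτ'
  have hρ0 : 0 ≤ ρ := by positivity
  have hρ0' : 0 ≤ ρ' := by positivity
  have hτ0 : 0 ≤ τ := by positivity
  have hτ0' : 0 ≤ τ' := by positivity
  have main := (revMoves_move hN (by have := S.one_le; omega : 0 < d) o).card_bad_le
    (R := fun ω => InRegion (8 * B) (8 * ε₁) o d z ω.1)
    (W := fun ω => InRegion (3 * B) (3 * ε₁) o d z ω.1)
    (Bad := fun ω => BadRow o d z ε ω.1)
    (f := rowSuper o d z θ ε ρ ρ') (g := entrySuper o d z θ B ε₁ τ τ')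
    (α := 4 * (N + 1) * Real.exp (-(θ * (ε / 2))))
    (β := 4 * N ^ 2 * Real.exp (-(θ * (ε₁ / 2))))
    (fun μ ω => rowSuper_nonneg μ ω) (fun μ ω => entrySuper_nonneg μ ω) ?_ ?_ ?_ ?_ ?_ ?_ ?_ ?_ ?_
  · have h1 := card_labelled_filter (d := d) o fun G =>
      InRegion (3 * B) (3 * ε₁) o d z G ∧ BadRow o d z ε G
    have h2 := card_labelled_filter (d := d) o fun _ => True
    simp only [Finset.filter_true, and_true] at h2
    have hfac : (0 : ℝ) < d.factorial := by exact_mod_cast d.factorial_pos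
    have h3 : ((labelled d o).filter fun ω => InRegion (3 * B) (3 * ε₁) o d z ω.1 ∧
      BadRow o d z ε ω.1).card = d.factorial * cardOf fun G : Fin N → Fin N → Bool =>
        IsRegGraph N d G ∧ (InRegion (3 * B) (3 * ε₁) o d z G ∧ BadRow o d z ε G) := by
      convert h1
    rw [h3, h2] at main
    push_cast at main
    rw [mul_assoc] at main
    exact le_of_mul_le_mul_left main hfac
  · intro ω hω _ hbad
    have hl := mem_labelled.mp hω
    obtain ⟨t, ht⟩ : ∃ t, 2 * ε < ‖rowFun o d z d t ω‖ := by
      rcases hbad with ⟨b, hb⟩ | hb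
      · exact ⟨some b, by rwa [rowFun_full_some hl]⟩
      · exact ⟨none, by rwa [rowFun_full_none S hl]⟩
    obtain ⟨j, hj⟩ := exists_le_re ht
    refine le_trans ?_ (rowSuper_ge t j d ω)
    rw [Real.one_le_exp_iff]
    exact add_nonneg (mul_nonneg hθ.le (by linarith)) (mul_nonneg (by positivity)
      (Finset.sum_nonneg fun ν _ => rowDrift_nonneg hρ0 hρ0' _ _))
  · intro μ hμ ω hω hR hlt
    simp only [hμ, dif_pos]
    exact rowSuper_step S (mem_labelled.mp hω) hR (by linarith) (by linarith) (by linarith)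
      (by linarith) hs hμ hε hε1 hθ hρ.symm hρ'.symm hlt
  · intro μ _ ω _ hR
    exact one_le_entrySuper hθ hτ0 hτ0' hR μ
  · intro μ hμ ω hω hR
    simp only [hμ, dif_pos]
    exact entrySuper_step S (mem_labelled.mp hω) hR (by linarith) (by linarith) (by linarith)
      (by linarith) hs hμ hθ hτ.symm hτ'.symm
  · intro ω hω
    exact rowSuper_zero_le S.one_le (mem_labelled.mp hω) hθ hρ0' hf
  · intro ω hω hW
    exact entrySuper_full_le S.one_le (mem_labelled.mp hω) hW hε₁B hθ hτ0' hg
  · positivity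
  · positivity
  · intro ω _ hW
    exact ⟨fun a => (hW.1 a).trans (by linarith), fun a b hab => (hW.2 a b hab).trans (by linarith)⟩

end RowTheorem

/-! ### Typical graphs at different scales -/

section Typical

open Matrix

variable {N d : ℕ} {z : ℂ} {r ε ε₁ β B σ : ℝ} {o k : Fin N} {G : Fin N → Fin N → Bool}

/-- Bounds for the entries of the resolvent. -/
structure ResBounds (β B ε₁ σ : ℝ) (d : ℕ) (z : ℂ) (G : Fin N → Fin N → Bool) : Prop where
  lower : ∀ a, β ≤ (1 + ‖z‖) * ‖gfull d G z a a‖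
  upper : ∀ a, (1 + ‖z‖) * ‖gfull d G z a a‖ ≤ B
  off : ∀ a b, a ≠ b → (1 + ‖z‖) * ‖gfull d G z a b‖ ≤ ε₁
  trace : 3 ≤ ‖z‖ → ‖(gfull d G z).trace / N‖ ≤ σ

lemma ResBounds.ne_zero (h : ResBounds β B ε₁ σ d z G) (hβ : 0 < β) (a : Fin N) :
    gfull d G z a a ≠ 0 := by
  intro h0
  have := h.lower a
  rw [h0, norm_zero, mul_zero] at this
  linarith

lemma ResBounds.inRegion (h : ResBounds (1 / 40) 40 (2 * ε₁) σ d z G) (hG : IsRegGraph N d G)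
    (hN : 2 ≤ N) (hz : 0 < z.im) (h0 : 0 ≤ ε₁) (h1 : 160 * ε₁ ≤ 1) (o : Fin N) :
    InRegion (3 * 20) (3 * ε₁) o d z G := by
  have hne := h.ne_zero (by norm_num)
  have hz0 : 0 ≤ ‖z‖ := norm_nonneg z
  have key : ∀ a b, a ≠ o → b ≠ o → (1 + ‖z‖) * ‖grow o d G z a b‖ ≤
      (1 + ‖z‖) * ‖gfull d G z a b‖ + ε₁ := by
    intro a b ha hb
    rw [grow_eq hG hN hz (hne o)]
    have h2 : (1 + ‖z‖) * ‖gfull d G z a o * gfull d G z o b / gfull d G z o o‖ ≤ ε₁ := by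
      rw [norm_div, norm_mul, ← mul_div_assoc, div_le_iff₀ (norm_pos_iff.mpr (hne o))]
      have e1 := h.off a o ha
      have e2 := h.off o b hb.symm
      have e3 := h.lower o
      have n1 := norm_nonneg (gfull d G z a o)
      have n2 := norm_nonneg (gfull d G z o b)
      have e4 : ((1 + ‖z‖) * ‖gfull d G z a o‖) * ((1 + ‖z‖) * ‖gfull d G z o b‖) ≤
          (2 * ε₁) * (2 * ε₁) := mul_le_mul e1 e2 (by positivity) (by linarith)
      have e5 : (2 * ε₁) * (2 * ε₁) ≤ ε₁ * (1 / 40) := by nlinarith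
      have e6 : ε₁ * (1 / 40) ≤ ε₁ * ((1 + ‖z‖) * ‖gfull d G z o o‖) :=
        mul_le_mul_of_nonneg_left e3 h0
      have e7 : (1 + ‖z‖) * ((1 + ‖z‖) * (‖gfull d G z a o‖ * ‖gfull d G z o b‖)) ≤
          (1 + ‖z‖) * (ε₁ * ‖gfull d G z o o‖) := by nlinarith
      exact le_of_mul_le_mul_left e7 (by linarith)
    have h3 := mul_le_mul_of_nonneg_left (norm_sub_le (gfull d G z a b)
      (gfull d G z a o * gfull d G z o b / gfull d G z o o)) (by linarith : 0 ≤ 1 + ‖z‖)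
    linarith
  have zl : ∀ b, grow o d G z o b = 0 := fun b =>
    gres_apply_eq_zero hG (compl_singleton_nonempty hN o) hz (by simp) b
  have zr : ∀ b, grow o d G z b o = 0 := fun b => by rw [grow_symm hG hN hz, zl]
  refine ⟨fun a => ?_, fun a b hab => ?_⟩
  · by_cases ha : a = o
    · rw [ha, zl]; simp
    · have := key a a ha ha
      have := h.upper a
      linarith
  · by_cases ha : a = o
    · rw [ha, zl]; simp; exact h0
    · by_cases hb : b = o
      · rw [hb, zr]; simp; exact h0
      · have := key a b ha hb
        have := h.off a b hab
        linarith

/-- Consequences of the self-consistent equation. -/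
lemma selfconsistent_bounds {s g : ℂ} (hg : ‖1 + g * (z + s)‖ ≤ 1 / 1000)
    (hs : ‖1 + s * (z + s)‖ ≤ 1 / 1000) (hz : 3 ≤ ‖z‖ → ‖s‖ ≤ 1 / 2) :
    1 / 20 ≤ (1 + ‖z‖) * ‖g‖ ∧ (1 + ‖z‖) * ‖g‖ ≤ 20 ∧ (3 ≤ ‖z‖ → ‖s‖ ≤ 9 / 20) := by
  have pr : ∀ x : ℂ, ‖1 + x‖ ≤ 1 / 1000 → 999 / 1000 ≤ ‖x‖ ∧ ‖x‖ ≤ 1001 / 1000 := by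
    intro x hx
    have h1 : ‖x‖ ≤ ‖1 + x‖ + ‖(1 : ℂ)‖ := by
      have := norm_sub_le (1 + x) 1
      rwa [add_sub_cancel_left] at this
    have h2 : ‖(1 : ℂ)‖ ≤ ‖1 + x‖ + ‖x‖ := by
      have := norm_sub_le (1 + x) x
      rwa [add_sub_cancel_right] at this
    rw [norm_one] at h1 h2
    constructor <;> linarith
  obtain ⟨g1, g2⟩ := pr _ hg
  obtain ⟨s1, s2⟩ := pr _ hs
  rw [norm_mul] at g1 g2 s1 s2
  have t1 : ‖z + s‖ ≤ ‖z‖ + ‖s‖ := norm_add_le _ _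
  have t2 : ‖z‖ ≤ ‖z + s‖ + ‖s‖ := by
    have := norm_sub_le (z + s) s
    rwa [add_sub_cancel_right] at this
  have t3 : ‖s‖ ≤ ‖z + s‖ + ‖z‖ := by
    have := norm_sub_le (z + s) z
    rwa [add_sub_cancel_left] at this
  have n1 := norm_nonneg z
  have n2 := norm_nonneg g
  have n3 := norm_nonneg s
  have n4 := norm_nonneg (z + s)
  generalize ‖z + s‖ = w at *
  generalize ‖z‖ = x at *
  generalize ‖g‖ = y at *
  generalize ‖s‖ = u at *
  by_cases h3 : 3 ≤ x
  · have hu := hz h3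
    have hu2 : u ≤ 9 / 20 := by
      by_contra hc
      push Not at hc
      nlinarith
    refine ⟨?_, ?_, fun _ => hu2⟩
    · nlinarith
    · have : y * (x - 9 / 20) ≤ 1001 / 1000 := by nlinarith
      nlinarith
  · push Not at h3
    have hu : u ≤ 34 / 10 := by
      by_contra hc
      push Not at hc
      nlinarith
    have hw : 29 / 100 ≤ w := by
      by_contra hc
      push Not at hc
      nlinarith
    have hy : y ≤ 35 / 10 := by
      by_contra hc
      push Not at hc
      nlinarith
    have hy2 : 1 / 10 ≤ y := by
      by_contra hc
      push Not at hc
      nlinarith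
    refine ⟨by nlinarith, by nlinarith, fun h => absurd h (not_le.mpr h3)⟩

lemma Scale.nat_pos (S : Scale N d z r) : (0 : ℝ) < N := by
  exact_mod_cast (by have := S.two_le; omega : 0 < N)

lemma Scale.inv_nat_le (S : Scale N d z r) : (N : ℝ)⁻¹ ≤ r ^ 2 := by
  rw [inv_le_iff_one_le_mul₀ S.nat_pos]
  linarith [S.inv_le]

lemma ResBounds.diag_approx (h : ResBounds (1 / 40) 40 (2 * ε₁) σ d z G) (S : Scale N d z r)
    (hG : IsRegGraph N d G) (hbad : ¬ BadRow o d z ε G) :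
    ‖1 + gfull d G z o o * (z + (gfull d G z).trace / N)‖ ≤ 200 * r + 80 * ε := by
  have hne := h.ne_zero (by norm_num)
  have hN := S.nat_pos
  have hr := S.r_pos
  have hr1 := S.r_le
  have hz0 : 0 ≤ ‖z‖ := norm_nonneg z
  rw [BadRow, not_or, not_exists] at hbad
  have hZ : ‖zfull o d G z - (grow o d G z).trace / N‖ ≤ 2 * ε := not_lt.mp hbad.2
  have hdiag := gfull_diag hG S.two_le S.im_pos (hne o)
  have htr := norm_trace_gfull_sub_grow_le hG S.two_le S.im_pos (hne o)
  have hup := h.upper o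
  set g := gfull d G z o o with hg
  set s := (gfull d G z).trace
  set t := (grow o d G z).trace
  set Z := zfull o d G z
  have n1 : (N : ℝ)⁻¹ ≤ r := (S.inv_nat_le).trans (by nlinarith)
  have nn : ‖(N : ℂ)⁻¹‖ = (N : ℝ)⁻¹ := by simp
  have hNc : (N : ℂ) ≠ 0 := by exact_mod_cast hN.ne'
  have e : 1 + g * (z + s / N) = 2 * (N : ℂ)⁻¹ - (N : ℂ)⁻¹ * (N : ℂ)⁻¹ +
      (g * ((s - t) * (N : ℂ)⁻¹) - g * (Z - t / N) - g * (d * del d / N) +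
        g * z * (N : ℂ)⁻¹) := by
    simp only [div_eq_mul_inv] at hdiag ⊢
    linear_combination hdiag
  have ng : ‖g‖ ≤ 40 := by nlinarith [norm_nonneg g]
  have ngz : ‖g * z‖ ≤ 40 := by rw [norm_mul]; nlinarith [norm_nonneg g]
  have b1 : ‖2 * (N : ℂ)⁻¹ - (N : ℂ)⁻¹ * (N : ℂ)⁻¹‖ ≤ 3 * r := by
    refine (norm_sub_le _ _).trans ?_
    rw [norm_mul, norm_mul, nn]
    have : (0 : ℝ) ≤ (N : ℝ)⁻¹ := by positivity
    norm_num
    nlinarith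
  have b2 : ‖g * ((s - t) * (N : ℂ)⁻¹)‖ ≤ 40 * r := by
    rw [norm_mul, norm_mul, nn]
    have h2 := S.im_le
    have h3 : 1 / z.im * (N : ℝ)⁻¹ ≤ r := by
      refine le_trans ?_ (h2.trans (by nlinarith))
      rw [one_div, ← mul_inv, mul_comm, inv_eq_one_div]
      have : 0 < N * z.im := mul_pos hN S.im_pos
      gcongr
      linarith
    have h4 : ‖s - t‖ * (N : ℝ)⁻¹ ≤ r :=
      (mul_le_mul_of_nonneg_right htr (by positivity)).trans h3
    exact mul_le_mul ng h4 (by positivity) (by norm_num)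
  have b3 : ‖g * (Z - t / N)‖ ≤ 40 * (2 * ε) := by
    rw [norm_mul]
    exact mul_le_mul ng hZ (norm_nonneg _) (by norm_num)
  have b4 : ‖g * (d * del d / N)‖ ≤ 40 * r := by
    rw [norm_mul]
    refine mul_le_mul ng ?_ (norm_nonneg _) (by norm_num)
    have hδ := del_pos S.one_le
    rw [norm_div, norm_mul, Complex.norm_natCast, Complex.norm_natCast, Complex.norm_real,
      Real.norm_eq_abs, abs_of_pos hδ]
    have h5 := S.deg_le
    have h6 := mul_le_mul_of_nonneg_right h5 hδ.le
    have h7 : r * del d * del d ≤ r * 1 := by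
      rw [mul_assoc]
      refine mul_le_mul_of_nonneg_left ?_ hr.le
      have := S.del_le
      nlinarith
    calc (d : ℝ) * del d / N = d / N * del d := by ring
      _ ≤ r := by linarith
  have b5 : ‖g * z * (N : ℂ)⁻¹‖ ≤ 40 * r := by
    rw [norm_mul, nn]
    exact mul_le_mul ngz n1 (by positivity) (by norm_num)
  rw [e]
  refine (norm_add_le _ _).trans ?_
  have c1 := norm_add_le (g * ((s - t) * (N : ℂ)⁻¹) - g * (Z - t / N) - g * (d * del d / N))
    (g * z * (N : ℂ)⁻¹)
  have c2 := norm_sub_le (g * ((s - t) * (N : ℂ)⁻¹) - g * (Z - t / N)) (g * (d * del d / N))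
  have c3 := norm_sub_le (g * ((s - t) * (N : ℂ)⁻¹)) (g * (Z - t / N))
  linarith

lemma ResBounds.off_approx (h : ResBounds (1 / 40) 40 (2 * ε₁) σ d z G) (S : Scale N d z r)
    (hG : IsRegGraph N d G) (hbad : ¬ BadRow o d z ε G) {b : Fin N} (hb : b ≠ o) :
    (1 + ‖z‖) * ‖gfull d G z o b‖ ≤ 160 * ε + 80 * r := by
  have hne := h.ne_zero (by norm_num)
  have hN := S.nat_pos
  have hr := S.r_pos
  rw [BadRow, not_or, not_exists] at hbad
  have hX : ‖hvec o d G z b‖ ≤ 2 * ε := not_lt.mp (hbad.1 b)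
  have hoff := gfull_off_diag hG S.two_le S.im_pos (hne o) hb
  have n1 : (N : ℝ)⁻¹ ≤ r := (S.inv_nat_le).trans (by nlinarith [S.r_le])
  have hup := h.upper o
  have h2 : (1 : ℝ) / 2 ≤ ‖1 - (N : ℂ)⁻¹‖ := by
    have : 1 - (N : ℂ)⁻¹ = ((1 - (N : ℝ)⁻¹ : ℝ) : ℂ) := by push_cast; ring
    rw [this, Complex.norm_real]
    refine le_trans ?_ (le_abs_self _)
    have : (N : ℝ)⁻¹ ≤ 2⁻¹ := by
      have : (2 : ℝ) ≤ N := by exact_mod_cast S.two_le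
      gcongr
    norm_num at this ⊢
    linarith
  have h3 : ‖hvec o d G z b + (N : ℂ)⁻¹‖ ≤ 2 * ε + r := by
    refine (norm_add_le _ _).trans (add_le_add hX ?_)
    simpa using n1
  have h4 : ‖1 - (N : ℂ)⁻¹‖ * ‖gfull d G z o b‖ =
      ‖gfull d G z o o‖ * ‖hvec o d G z b + (N : ℂ)⁻¹‖ := by
    rw [← norm_mul, hoff, norm_mul, norm_neg]
  have hz : 0 ≤ 1 + ‖z‖ := by positivity
  have h5 : (1 + ‖z‖) * ‖gfull d G z o o‖ * ‖hvec o d G z b + (N : ℂ)⁻¹‖ ≤ 40 * (2 * ε + r) :=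
    mul_le_mul hup h3 (norm_nonneg _) (by norm_num)
  have h6 : 1 / 2 * ‖gfull d G z o b‖ ≤ ‖1 - (N : ℂ)⁻¹‖ * ‖gfull d G z o b‖ :=
    mul_le_mul_of_nonneg_right h2 (norm_nonneg _)
  nlinarith

/-- If no row is bad then the bounds improve. -/
lemma ResBounds.improve (h : ResBounds (1 / 40) 40 (2 * ε₁) (1 / 2) d z G) (S : Scale N d z r)
    (hG : IsRegGraph N d G) (hbad : ∀ o, ¬ BadRow o d z ε G)
    (h1 : 200 * r + 80 * ε ≤ 1 / 1000) (h2 : 160 * ε + 80 * r ≤ ε₁) :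
    ResBounds (1 / 20) 20 ε₁ (9 / 20) d z G := by
  have hN := S.nat_pos
  have hNc : (N : ℂ) ≠ 0 := by exact_mod_cast hN.ne'
  have hN0 : 0 < N := by exact_mod_cast hN
  set s := (gfull d G z).trace / N with hs
  have hd : ∀ a, ‖1 + gfull d G z a a * (z + s)‖ ≤ 1 / 1000 := fun a =>
    (h.diag_approx S hG (hbad a)).trans h1
  have hsum : ‖1 + s * (z + s)‖ ≤ 1 / 1000 := by
    have e : 1 + s * (z + s) = (∑ a, (1 + gfull d G z a a * (z + s))) / N := by
      rw [Finset.sum_add_distrib, ← Finset.sum_mul]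
      have : ∑ a, gfull d G z a a = s * N := by
        rw [hs, div_mul_cancel₀ _ hNc]; rfl
      rw [this]
      simp
      field_simp
    rw [e, norm_div, Complex.norm_natCast, div_le_iff₀ hN]
    refine (norm_sum_le _ _).trans ((Finset.sum_le_sum fun a _ => hd a).trans ?_)
    simp; linarith
  have key := fun a => selfconsistent_bounds (hd a) hsum h.trace
  exact ⟨fun a => (key a).1, fun a => (key a).2.1,
    fun a b hab => (h.off_approx S hG (hbad a) hab.symm).trans h2, (key ⟨0, hN0⟩).2.2⟩

end Typical

section Ladder

open Matrix

variable {N d : ℕ} {z z' : ℂ} {r ε ε₁ τ β B σ : ℝ} {o k : Fin N} {G : Fin N → Fin N → Bool}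

lemma norm_sum_mul_sq_le {ι : Type*} (s : Finset ι) (x y : ι → ℂ) :
    ‖∑ c ∈ s, x c * y c‖ ^ 2 ≤ (∑ c ∈ s, ‖x c‖ ^ 2) * ∑ c ∈ s, ‖y c‖ ^ 2 := by
  refine le_trans ?_ (Finset.sum_mul_sq_le_sq_mul_sq s (fun c => ‖x c‖) fun c => ‖y c‖)
  refine pow_le_pow_left₀ (norm_nonneg _) ((norm_sum_le _ _).trans (le_of_eq ?_)) 2
  exact Finset.sum_congr rfl fun c _ => norm_mul _ _

lemma sum_gfull_sq_le (hG : IsRegGraph N d G) (hz : 0 < z.im) (a : Fin N) :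
    ∑ b, ‖gfull d G z b a‖ ^ 2 ≤ ‖gfull d G z a a‖ / z.im := by
  rw [gfull, gres_ward_single hG (univ_nonempty_of a) hz]
  gcongr
  exact (le_abs_self _).trans (Complex.abs_im_le_norm _)

lemma norm_gfull_sub_sq_le (hG : IsRegGraph N d G) (hz : 0 < z.im) (hz' : 0 < z'.im)
    (a b : Fin N) : ‖gfull d G z a b - gfull d G z' a b‖ ^ 2 ≤
      ‖z - z'‖ ^ 2 * ((‖gfull d G z a a‖ / z.im) * (‖gfull d G z' b b‖ / z'.im)) := by
  have e := (gres_spec hG (univ_nonempty_of a) hz).sub_eq (gres_spec hG (univ_nonempty_of a) hz')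
  have e1 : (hmat d G - z' • (1 : Matrix (Fin N) (Fin N) ℂ)) - (hmat d G - z • 1) =
      (z - z') • 1 := by
    rw [sub_smul]; abel
  rw [e1, mul_smul_comm, mul_one, smul_mul_assoc] at e
  have e2 := congrFun (congrFun e a) b
  rw [Matrix.sub_apply, Matrix.smul_apply, Matrix.mul_apply, smul_eq_mul] at e2
  rw [gfull, gfull, e2, norm_mul, mul_pow]
  refine mul_le_mul_of_nonneg_left ((norm_sum_mul_sq_le _ _ _).trans ?_) (by positivity)
  refine mul_le_mul ?_ (sum_gfull_sq_le hG hz' b) (by positivity) ?_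
  · refine le_trans (le_of_eq ?_) (sum_gfull_sq_le hG hz a)
    refine Finset.sum_congr rfl fun c _ => ?_
    rw [← gfull, gfull_symm hG hz]
  · have := hz.le; positivity

lemma norm_gfull_sub_sq_le_of_scale (hG : IsRegGraph N d G) (hz' : 0 < z'.im)
    (hre : z'.re = z.re) (hτ : 0 ≤ τ) (him : z.im = (1 + τ) * z'.im) (a b : Fin N) :
    ‖gfull d G z a b - gfull d G z' a b‖ ^ 2 ≤
      τ ^ 2 * (‖gfull d G z a a‖ * ‖gfull d G z' b b‖) := by
  have hz : 0 < z.im := by rw [him]; positivity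
  have h1 : ‖z - z'‖ = τ * z'.im := by
    have : z - z' = ((τ * z'.im : ℝ) : ℂ) * Complex.I := by
      apply Complex.ext
      · simp [hre]
      · simp [him]; ring
    rw [this, norm_mul, Complex.norm_I, mul_one, Complex.norm_real, Real.norm_eq_abs,
      abs_of_nonneg (by positivity)]
  refine (norm_gfull_sub_sq_le hG hz hz' a b).trans ?_
  rw [h1, him]
  have n1 := norm_nonneg (gfull d G z a a)
  have n2 := norm_nonneg (gfull d G z' b b)
  set x := ‖gfull d G z a a‖
  set y := ‖gfull d G z' b b‖
  have e : (τ * z'.im) ^ 2 * (x / ((1 + τ) * z'.im) * (y / z'.im)) =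
      τ ^ 2 * (x * y) / (1 + τ) := by field_simp
  rw [e]
  exact div_le_self (by positivity) (by linarith)

/-- The bounds persist under a small change of the scale. -/
lemma ResBounds.change_scale (h : ResBounds (1 / 20) 20 ε₁ (9 / 20) d z G)
    (hG : IsRegGraph N d G) (hz' : 0 < z'.im) (hre : z'.re = z.re) (hτ : 0 ≤ τ)
    (him : z.im = (1 + τ) * z'.im) (hε : ε₁ ≤ 1 / 100) (hτε : 30 * τ ≤ ε₁) :
    ResBounds (1 / 40) 40 (2 * ε₁) (1 / 2) d z' G := by
  have hz : 0 < z.im := by rw [him]; positivity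
  have hk1 : ‖z'‖ ≤ ‖z‖ := by
    rw [Complex.norm_eq_sqrt_sq_add_sq, Complex.norm_eq_sqrt_sq_add_sq, hre]
    refine Real.sqrt_le_sqrt (add_le_add le_rfl ?_)
    rw [him]
    exact pow_le_pow_left₀ hz'.le (by nlinarith) 2
  have hk2 : ‖z‖ ≤ (1 + τ) * ‖z'‖ := by
    have : z = z' + ((τ * z'.im : ℝ) : ℂ) * Complex.I := by
      apply Complex.ext
      · simp [hre]
      · simp [him]; ring
    rw [this]
    refine (norm_add_le _ _).trans ?_
    rw [norm_mul, Complex.norm_I, mul_one, Complex.norm_real, Real.norm_eq_abs,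
      abs_of_nonneg (by positivity)]
    have := (le_abs_self _).trans (Complex.abs_im_le_norm z')
    nlinarith
  have hD := norm_gfull_sub_sq_le_of_scale hG hz' hre hτ him
  have n0 := norm_nonneg z'
  have hdiff : ∀ a, ‖gfull d G z a a - gfull d G z' a a‖ ≤
      τ * (‖gfull d G z a a‖ + ‖gfull d G z' a a‖) / 2 := by
    intro a
    have n1 := norm_nonneg (gfull d G z a a)
    have n2 := norm_nonneg (gfull d G z' a a)
    refine le_of_sq_le_sq ?_ (by positivity)
    refine (hD a a).trans ?_
    nlinarith [sq_nonneg (‖gfull d G z a a‖ - ‖gfull d G z' a a‖), sq_nonneg τ,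
      mul_nonneg (sq_nonneg τ) (sq_nonneg (‖gfull d G z a a‖ - ‖gfull d G z' a a‖))]
  have hle : ∀ a, ‖gfull d G z' a a‖ ≤ 102 / 100 * ‖gfull d G z a a‖ := by
    intro a
    have h1 := hdiff a
    have h2 := norm_sub_norm_le (gfull d G z' a a) (gfull d G z a a)
    rw [norm_sub_rev] at h2
    have n1 := norm_nonneg (gfull d G z a a)
    have n2 := norm_nonneg (gfull d G z' a a)
    nlinarith
  have hge : ∀ a, 98 / 100 * ‖gfull d G z a a‖ ≤ ‖gfull d G z' a a‖ := by
    intro a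
    have h1 := hdiff a
    have h2 := norm_sub_norm_le (gfull d G z a a) (gfull d G z' a a)
    have n1 := norm_nonneg (gfull d G z a a)
    have n2 := norm_nonneg (gfull d G z' a a)
    nlinarith
  have hup : ∀ a, (1 + ‖z'‖) * ‖gfull d G z' a a‖ ≤ 40 := by
    intro a
    have h1 := h.upper a
    have h2 := hle a
    have n1 := norm_nonneg (gfull d G z a a)
    have n2 := norm_nonneg (gfull d G z' a a)
    nlinarith
  refine ⟨fun a => ?_, hup, fun a b hab => ?_, fun h3 => ?_⟩
  · have h1 := h.lower a
    have h2 := hge a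
    have n1 := norm_nonneg (gfull d G z a a)
    have h3 : 1 + ‖z‖ ≤ 101 / 100 * (1 + ‖z'‖) := by nlinarith
    have h4 : (1 + ‖z‖) * ‖gfull d G z a a‖ ≤ 101 / 100 * (1 + ‖z'‖) * ‖gfull d G z a a‖ :=
      mul_le_mul_of_nonneg_right h3 n1
    nlinarith
  · have h1 := h.off a b hab
    have h2 : (1 + ‖z'‖) * ‖gfull d G z a b - gfull d G z' a b‖ ≤ ε₁ := by
      refine le_of_sq_le_sq ?_ (by linarith)
      rw [mul_pow]
      have h3 := hD a b
      have h4 : ((1 + ‖z'‖) * ‖gfull d G z a a‖) * ((1 + ‖z'‖) * ‖gfull d G z' b b‖) ≤ 20 * 40 := by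
        refine mul_le_mul ?_ (hup b) (by positivity) (by norm_num)
        refine le_trans ?_ (h.upper a)
        gcongr
      calc (1 + ‖z'‖) ^ 2 * ‖gfull d G z a b - gfull d G z' a b‖ ^ 2
          ≤ (1 + ‖z'‖) ^ 2 * (τ ^ 2 * (‖gfull d G z a a‖ * ‖gfull d G z' b b‖)) := by gcongr
        _ = τ ^ 2 * (((1 + ‖z'‖) * ‖gfull d G z a a‖) * ((1 + ‖z'‖) * ‖gfull d G z' b b‖)) := by
          ring
        _ ≤ τ ^ 2 * (20 * 40) := by gcongr
        _ ≤ ε₁ ^ 2 := by nlinarith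
    have h5 : ‖gfull d G z' a b‖ ≤ ‖gfull d G z a b‖ + ‖gfull d G z a b - gfull d G z' a b‖ := by
      have := norm_sub_le (gfull d G z a b) (gfull d G z a b - gfull d G z' a b)
      rwa [sub_sub_cancel] at this
    have n1 := norm_nonneg (gfull d G z a b)
    have h6 : (1 + ‖z'‖) * ‖gfull d G z a b‖ ≤ (1 + ‖z‖) * ‖gfull d G z a b‖ := by gcongr
    have h7 := mul_le_mul_of_nonneg_left h5 (by positivity : 0 ≤ 1 + ‖z'‖)
    linarith
  · have h1 := h.trace (h3.trans hk1)
    rcases Nat.eq_zero_or_pos N with hN | hN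
    · subst hN; simp
    have hN' : (0 : ℝ) < N := by exact_mod_cast hN
    have h2 : ‖(gfull d G z').trace / N - (gfull d G z).trace / N‖ ≤ 1 / 20 := by
      rw [← sub_div, norm_div, Complex.norm_natCast, div_le_iff₀ hN', Matrix.trace, Matrix.trace,
        ← Finset.sum_sub_distrib]
      refine (norm_sum_le _ _).trans ((Finset.sum_le_card_nsmul _ _ (1 / 20) fun a _ => ?_).trans
        (by simp [mul_comm]))
      rw [diag_apply, diag_apply, norm_sub_rev]
      refine (hdiff a).trans ?_
      have e1 := h.upper a
      have e2 := hle a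
      have n1 := norm_nonneg (gfull d G z a a)
      have : ‖gfull d G z a a‖ ≤ 20 := by nlinarith [norm_nonneg z]
      nlinarith
    have h4 := norm_add_le ((gfull d G z').trace / N - (gfull d G z).trace / N)
      ((gfull d G z).trace / N)
    rw [sub_add_cancel] at h4
    linarith

lemma sum_hmat_sq (hG : IsRegGraph N d G) (hd : 1 ≤ d) (a : Fin N) :
    ∑ k, ‖hmat d G a k‖ ^ 2 = 1 := by
  have hδ := del_pos hd
  have : ∀ k, ‖hmat d G a k‖ ^ 2 = if G a k = true then del d ^ 2 else 0 := by
    intro k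
    simp only [hmat, of_apply]
    split_ifs
    · rw [mul_one, Complex.norm_real, Real.norm_eq_abs, abs_of_pos hδ]
    · simp
  simp only [this]
  rw [Finset.sum_ite, Finset.sum_const_zero, add_zero, Finset.sum_const, hG.2.2 a, nsmul_eq_mul,
    del_sq hd]

/-- The bounds hold at large scales. -/
lemma resBounds_of_large (hG : IsRegGraph N d G) (hd : 1 ≤ d) (hε : 0 < ε₁) (hε1 : ε₁ ≤ 1 / 10)
    (hN : 4 / ε₁ ≤ N) (hz : 4 / ε₁ ≤ z.im) : ResBounds (1 / 20) 20 ε₁ (9 / 20) d z G := by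
  have h40 : 40 ≤ 4 / ε₁ := by rw [le_div_iff₀ hε]; linarith
  have hη : 0 < z.im := by linarith
  have hN0 : (0 : ℝ) < N := by linarith
  have hzη : z.im ≤ ‖z‖ := (le_abs_self _).trans (Complex.abs_im_le_norm z)
  have hz0 : 0 < ‖z‖ := by linarith
  have hηi : 1 / z.im ≤ ε₁ / 4 := by
    rw [div_le_iff₀ hη]
    rw [div_le_iff₀ hε] at hz
    linarith
  have hNi : (N : ℝ)⁻¹ ≤ ε₁ / 4 := by
    rw [inv_eq_one_div, div_le_iff₀ hN0]
    rw [div_le_iff₀ hε] at hN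
    linarith
  have hHG : ∀ a b, ‖∑ k, hmat d G a k * gfull d G z k b‖ ≤ ε₁ / 4 := by
    intro a b
    have h1 := sum_gfull_sq_le hG hη b
    have h2 : ‖gfull d G z b b‖ ^ 2 ≤ ∑ k, ‖gfull d G z k b‖ ^ 2 :=
      Finset.single_le_sum (f := fun k => ‖gfull d G z k b‖ ^ 2) (fun i _ => by positivity)
        (Finset.mem_univ b)
    have h3 : ‖gfull d G z b b‖ ≤ 1 / z.im := by
      by_contra hc
      push Not at hc
      have h4 := h2.trans h1
      rw [div_eq_mul_one_div] at h4
      have h5 : 0 < 1 / z.im := by positivity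
      nlinarith
    have h6 : ∑ k, ‖gfull d G z k b‖ ^ 2 ≤ (1 / z.im) ^ 2 := by
      refine h1.trans ?_
      rw [div_eq_mul_one_div, sq]
      gcongr
    have h7 := norm_sum_mul_sq_le Finset.univ (fun k => hmat d G a k) fun k => gfull d G z k b
    rw [sum_hmat_sq hG hd, one_mul] at h7
    exact (le_of_sq_le_sq (h7.trans h6) (by positivity)).trans hηi
  have nN : ‖(N : ℂ)⁻¹‖ = (N : ℝ)⁻¹ := by simp
  have hoff : ∀ a b, a ≠ b → ‖z‖ * ‖gfull d G z a b‖ ≤ ε₁ / 2 := by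
    intro a b hab
    have h1 := hmat_mul_gfull hG a hη a b
    rw [if_neg hab] at h1
    rw [← norm_mul, show z * gfull d G z a b = ∑ k, hmat d G a k * gfull d G z k b + (N : ℂ)⁻¹ by
      rw [h1]; ring]
    refine (norm_add_le _ _).trans ?_
    rw [nN]
    linarith [hHG a b]
  have hdiag : ∀ a, ‖z * gfull d G z a a + 1‖ ≤ ε₁ / 2 := by
    intro a
    have h1 := hmat_mul_gfull hG a hη a a
    rw [if_pos rfl] at h1
    rw [show z * gfull d G z a a + 1 = ∑ k, hmat d G a k * gfull d G z k a + (N : ℂ)⁻¹ by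
      rw [h1]; ring]
    refine (norm_add_le _ _).trans ?_
    rw [nN]
    linarith [hHG a a]
  have hlo : ∀ a, 1 / 2 ≤ ‖z‖ * ‖gfull d G z a a‖ := fun a => by
    rw [← norm_mul]
    have := norm_sub_le (z * gfull d G z a a + 1) (z * gfull d G z a a)
    rw [add_sub_cancel_left, norm_one] at this
    linarith [hdiag a]
  have hhi : ∀ a, ‖z‖ * ‖gfull d G z a a‖ ≤ 3 / 2 := fun a => by
    rw [← norm_mul]
    have := norm_sub_le (z * gfull d G z a a + 1) 1
    rw [add_sub_cancel_right, norm_one] at this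
    linarith [hdiag a]
  refine ⟨fun a => ?_, fun a => ?_, fun a b hab => ?_, fun _ => ?_⟩
  · nlinarith [hlo a, norm_nonneg (gfull d G z a a)]
  · nlinarith [hhi a, norm_nonneg (gfull d G z a a)]
  · nlinarith [hoff a b hab, norm_nonneg (gfull d G z a b)]
  · rw [norm_div, Complex.norm_natCast, div_le_iff₀ hN0, Matrix.trace]
    refine (norm_sum_le _ _).trans ((Finset.sum_le_card_nsmul _ _ (9 / 20) fun a _ => ?_).trans
        (by simp [mul_comm]))
    rw [diag_apply]
    nlinarith [hhi a, norm_nonneg (gfull d G z a a)]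

/-- Resolvent bounds control eigenvectors. -/
lemma eigenvector_le (hG : IsRegGraph N d G) (hz : 0 < z.im) {v : Fin N → ℝ}
    {lam : ℝ} (hv : ∑ i, v i ^ 2 = 1) (hA : (adjOf G).mulVec v = lam • v) (i : Fin N) :
    v i ^ 2 ≤ 2 * (‖((lam * del d : ℝ) : ℂ) - z‖ ^ 2 * (‖gfull d G z i i‖ / z.im)) + 2 / N := by
  have hN : (0 : ℝ) < N := by exact_mod_cast (Fin.pos i)
  set w : Fin N → ℂ := fun j => (v j : ℂ) with hw
  have hH : hmat d G *ᵥ w = ((lam * del d : ℝ) : ℂ) • w := by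
    funext a
    have h1 := congrFun hA a
    simp only [mulVec, dotProduct, adjOf, of_apply, Pi.smul_apply, smul_eq_mul] at h1
    have h2 : ((∑ j, (if G a j = true then (1 : ℝ) else 0) * v j : ℝ) : ℂ) =
        ((lam * v a : ℝ) : ℂ) := by rw [h1]
    push_cast at h2
    simp only [mulVec, dotProduct, hmat, of_apply, Pi.smul_apply, smul_eq_mul, hw, mul_assoc]
    rw [← Finset.mul_sum]
    have h3 : ∑ j, (if G a j = true then (1 : ℂ) else 0) * (v j : ℂ) = lam * v a := by
      rw [← h2]
      exact Finset.sum_congr rfl fun j _ => by split_ifs <;> simp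
    rw [h3]; push_cast; ring
  have hGH : gfull d G z * (hmat d G - z • 1) = prj Finset.univ := by
    have := congrArg Matrix.transpose (gfull_eq hG i hz)
    rw [transpose_mul, transpose_sub, transpose_smul, transpose_one, hmat_transpose hG,
      prj_transpose, gfull, gres_transpose hG (univ_nonempty_of i) hz] at this
    exact this
  have e1 : (prj Finset.univ *ᵥ w) i =
      (((lam * del d : ℝ) : ℂ) - z) * ∑ j, gfull d G z i j * w j := by
    rw [← hGH, ← mulVec_mulVec, sub_mulVec, hH, smul_mulVec, one_mulVec, ← sub_smul, mulVec_smul,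
      Pi.smul_apply, smul_eq_mul]
    rfl
  have e2 : (prj Finset.univ *ᵥ w) i = ((v i - (∑ j, v j) / N : ℝ) : ℂ) := by
    simp only [mulVec, dotProduct, prj_univ_apply, sub_mul, Finset.sum_sub_distrib, ite_mul,
      one_mul, zero_mul, Finset.sum_ite_eq, Finset.mem_univ, if_true, ← Finset.mul_sum, hw]
    push_cast
    ring
  have e3 : (v i - (∑ j, v j) / N) ^ 2 ≤
      ‖((lam * del d : ℝ) : ℂ) - z‖ ^ 2 * (‖gfull d G z i i‖ / z.im) := by
    have h1 : (v i - (∑ j, v j) / N) ^ 2 = ‖(prj Finset.univ *ᵥ w) i‖ ^ 2 := by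
      rw [e2, Complex.norm_real, Real.norm_eq_abs, sq_abs]
    rw [h1, e1, norm_mul, mul_pow]
    refine mul_le_mul_of_nonneg_left ((norm_sum_mul_sq_le _ _ _).trans ?_) (by positivity)
    have h2 : ∑ j, ‖w j‖ ^ 2 = 1 := by
      rw [← hv]
      refine Finset.sum_congr rfl fun j _ => ?_
      rw [hw, Complex.norm_real, Real.norm_eq_abs, sq_abs]
    rw [h2, mul_one]
    refine le_trans (le_of_eq (Finset.sum_congr rfl fun j _ => ?_)) (sum_gfull_sq_le hG hz i)
    rw [gfull_symm hG hz]
  have e4 : ((∑ j, v j) / N) ^ 2 ≤ 1 / N := by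
    have h1 := sq_sum_le_card_mul_sum_sq (s := Finset.univ) (f := v)
    rw [hv, Finset.card_univ, Fintype.card_fin, mul_one] at h1
    rw [div_pow, div_le_div_iff₀ (by positivity) hN]
    nlinarith
  have e5 : 2 / (N : ℝ) = 2 * (1 / N) := by ring
  rw [e5]
  nlinarith [sq_nonneg (v i - 2 * ((∑ j, v j) / N))]

end Ladder

section CardOf

variable {α β : Type*} [Fintype α] [Fintype β] {p q : α → Prop}

lemma cardOf_le_of_imp (h : ∀ x, p x → q x) : cardOf p ≤ cardOf q := by
  classical
  exact Finset.card_le_card fun x hx => by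
    simp only [Finset.mem_filter, Finset.mem_univ, true_and] at hx ⊢
    exact h x hx

lemma cardOf_or_le : cardOf (fun x => p x ∨ q x) ≤ cardOf p + cardOf q := by
  classical
  refine le_trans (Finset.card_le_card fun x hx => ?_) (Finset.card_union_le _ _)
  simpa only [Finset.mem_union, Finset.mem_filter, Finset.mem_univ, true_and] using hx

lemma cardOf_exists_le {ι : Type*} (s : Finset ι) (p : ι → α → Prop) :
    cardOf (fun x => ∃ i ∈ s, p i x) ≤ ∑ i ∈ s, cardOf (p i) := by
  classical
  refine le_trans (Finset.card_le_card fun x hx => ?_)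
    (Finset.card_biUnion_le (s := s) (t := fun i => @Finset.filter α (p i) (Classical.decPred _)
      Finset.univ))
  simpa only [Finset.mem_biUnion, Finset.mem_filter, Finset.mem_univ, true_and] using hx

lemma cardOf_eq_zero (h : ∀ x, ¬ p x) : cardOf p = 0 := by
  classical
  exact Finset.card_eq_zero.2 (Finset.filter_eq_empty_iff.2 fun x _ => h x)

end CardOf

section Delocalization

variable {N d : ℕ} {r ε ε₁ τ E η q : ℝ}

/-- Descending induction on the scale. -/
lemma card_not_resBounds_le (hd : 1 ≤ d) (hε : 0 < ε₁) (hε1 : 160 * ε₁ ≤ 1) (hN : 4 / ε₁ ≤ N)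
    (hr1 : 200 * r + 80 * ε ≤ 1 / 1000) (hr2 : 160 * ε + 80 * r ≤ ε₁) (hτ : 0 ≤ τ)
    (hτε : 30 * τ ≤ ε₁) {X : ℝ} (J : ℕ) : ∀ η : ℝ, 0 < η →
    (∀ η', η ≤ η' → Scale N d ⟨E, η'⟩ r) →
    (∀ η', η ≤ η' → ∀ o : Fin N, (cardOf fun G => IsRegGraph N d G ∧
      (InRegion (3 * 20) (3 * ε₁) o d ⟨E, η'⟩ G ∧ BadRow o d ⟨E, η'⟩ ε G) : ℝ) ≤ X) →
    4 / ε₁ ≤ η * (1 + τ) ^ J →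
    (cardOf fun G => IsRegGraph N d G ∧
      ¬ ResBounds (1 / 20) 20 ε₁ (9 / 20) d ⟨E, η⟩ G : ℝ) ≤ J * (N * X) := by
  induction J with
  | zero =>
    intro η _ _ _ h
    rw [cardOf_eq_zero]
    · simp
    · rintro G ⟨hG, hn⟩
      exact hn (resBounds_of_large hG hd hε (by linarith) hN (by simpa using h))
  | succ J ih =>
    intro η hη hS hX h
    have hle : η ≤ (1 + τ) * η := by nlinarith
    have h1 := ih ((1 + τ) * η) (by positivity) (fun η' h' => hS η' (hle.trans h'))
      (fun η' h' => hX η' (hle.trans h')) (by rw [pow_succ] at h; linarith)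
    have h2 : (cardOf fun G => IsRegGraph N d G ∧
        ¬ ResBounds (1 / 20) 20 ε₁ (9 / 20) d ⟨E, η⟩ G) ≤
        (cardOf fun G => IsRegGraph N d G ∧
          ¬ ResBounds (1 / 20) 20 ε₁ (9 / 20) d ⟨E, (1 + τ) * η⟩ G) +
        ∑ o : Fin N, cardOf fun G => IsRegGraph N d G ∧
          (InRegion (3 * 20) (3 * ε₁) o d ⟨E, η⟩ G ∧ BadRow o d ⟨E, η⟩ ε G) := by
      refine le_trans ?_ (cardOf_or_le.trans (Nat.add_le_add_left
        (cardOf_exists_le Finset.univ fun (o : Fin N) G => IsRegGraph N d G ∧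
          (InRegion (3 * 20) (3 * ε₁) o d ⟨E, η⟩ G ∧ BadRow o d ⟨E, η⟩ ε G)) _))
      refine cardOf_le_of_imp ?_
      rintro G ⟨hG, hn⟩
      by_cases hb : ResBounds (1 / 20) 20 ε₁ (9 / 20) d ⟨E, (1 + τ) * η⟩ G
      · right
        have h3 := hb.change_scale (z' := ⟨E, η⟩) hG hη rfl hτ rfl (by linarith) hτε
        by_contra hc
        push Not at hc
        refine hn (h3.improve (hS η le_rfl) hG (fun o hbad => ?_) hr1 hr2)
        exact hc o (Finset.mem_univ o) hG
          (h3.inRegion hG (hS η le_rfl).two_le hη hε.le hε1 o) hbad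
      · exact Or.inl ⟨hG, hb⟩
    have h3 : (∑ o : Fin N, cardOf fun G => IsRegGraph N d G ∧
        (InRegion (3 * 20) (3 * ε₁) o d ⟨E, η⟩ G ∧ BadRow o d ⟨E, η⟩ ε G) : ℝ) ≤ N * X := by
      refine (Finset.sum_le_card_nsmul _ _ X fun o _ => hX η le_rfl o).trans (by simp)
    have h4 : (cardOf fun G => IsRegGraph N d G ∧
        ¬ ResBounds (1 / 20) 20 ε₁ (9 / 20) d ⟨E, η⟩ G : ℝ) ≤ J * (N * X) + N * X := by
      refine le_trans ?_ (add_le_add h1 h3)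
      exact_mod_cast h2
    push_cast
    linarith

lemma scale_of_le (hr : 0 < r) (hr1 : r ≤ 1 / 2) (hd : 1 ≤ r ^ 2 * d)
    (hN : (d : ℝ) ^ 3 ≤ r ^ 2 * N ^ 2) (hη : 2 * (1 + |E|) ≤ N * r ^ 2 * η) :
    Scale N d ⟨E, η⟩ r := by
  have hr2 : 0 < r ^ 2 := by positivity
  have hr4 : r ^ 2 ≤ 1 / 4 := by nlinarith
  have hd4 : (4 : ℝ) ≤ d := by nlinarith
  have hd1 : 1 ≤ d := by exact_mod_cast (by linarith : (1 : ℝ) ≤ d)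
  have hN0 : (0 : ℝ) ≤ N := by positivity
  have hNr : 2 ≤ N * r ^ 2 := by
    have h1 : (1 : ℝ) ≤ (r ^ 2 * d) ^ 3 := one_le_pow₀ hd
    have h2 : (1 : ℝ) ≤ r ^ 4 * (N * r ^ 2) ^ 2 := by
      calc (1 : ℝ) ≤ (r ^ 2 * d) ^ 3 := h1
        _ = r ^ 6 * d ^ 3 := by ring
        _ ≤ r ^ 6 * (r ^ 2 * N ^ 2) := by gcongr
        _ = r ^ 4 * (N * r ^ 2) ^ 2 := by ring
    have h3 : r ^ 4 ≤ 1 / 16 := by nlinarith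
    have h4 : 16 ≤ (N * r ^ 2) ^ 2 := by nlinarith [sq_nonneg (N * r ^ 2)]
    have h5 : 0 ≤ N * r ^ 2 := by positivity
    nlinarith
  have hη0 : 0 < η := by
    by_contra hc
    push Not at hc
    have : N * r ^ 2 * η ≤ 0 := mul_nonpos_of_nonneg_of_nonpos (by positivity) hc
    linarith [abs_nonneg E]
  have hN2 : (2 : ℝ) ≤ N := by nlinarith
  have hN1 : (0 : ℝ) < N := by linarith
  have hδ := del_pos hd1
  have hδd := del_sq hd1
  refine ⟨hη0, by exact_mod_cast hN2, hd1, hr, by linarith, ?_, by linarith, ?_, ?_⟩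
  · rw [div_le_iff₀ (by positivity)]
    have h1 : ‖(⟨E, η⟩ : ℂ)‖ ≤ |E| + η := by
      refine (Complex.norm_le_abs_re_add_abs_im _).trans ?_
      simp [abs_of_pos hη0]
    have h2 : 2 * η ≤ N * r ^ 2 * η := by nlinarith
    simp only
    nlinarith
  · refine le_of_sq_le_sq ?_ hr.le
    have : d * del d ^ 2 ≤ d * r ^ 2 := by rw [hδd]; linarith
    exact le_of_mul_le_mul_left this (by linarith)
  · refine le_of_sq_le_sq ?_ (by positivity)
    rw [div_pow, div_le_iff₀ (by positivity)]
    have h0 : (0 : ℝ) < d := by linarith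
    refine le_of_mul_le_mul_left ?_ h0
    calc (d : ℝ) * d ^ 2 = d ^ 3 := by ring
      _ ≤ r ^ 2 * N ^ 2 := hN
      _ = r ^ 2 * N ^ 2 * (d * del d ^ 2) := by rw [hδd, mul_one]
      _ = d * ((r * del d) ^ 2 * N ^ 2) := by ring

end Delocalization

section Delocalization

variable {N d : ℕ} {E η q lam : ℝ} {z : ℂ} {G : Fin N → Fin N → Bool}

lemma card_badRow_le_exp (hq : 2 ≤ q) (S : Scale N d z (1 / (10 ^ 30 * q))) (o : Fin N) :
    (cardOf fun G : Fin N → Fin N → Bool => IsRegGraph N d G ∧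
      (InRegion (3 * 20) (3 * (1 / 10 ^ 6)) o d z G ∧ BadRow o d z (1 / 10 ^ 9) G) : ℝ) ≤
      (cardOf fun G : Fin N → Fin N → Bool => IsRegGraph N d G) *
        (N ^ 4 * Real.exp (-(8 * (q * Real.log q)))) := by
  have hq0 : 0 < q := by linarith
  have hl0 : 0 < Real.log q := Real.log_pos (by linarith)
  have hlq : Real.log q ≤ 2 * Real.sqrt q := by
    have h1 := Real.log_le_sub_one_of_pos (Real.sqrt_pos.2 hq0)
    rw [Real.log_sqrt hq0.le] at h1
    linarith
  set r := 1 / (10 ^ 30 * q) with hr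
  have hrq : r * q = 1 / 10 ^ 30 := by rw [hr]; field_simp
  have hr0 := S.r_pos
  have hr1 : r ≤ 1 / 10 ^ 30 := by rw [← hrq]; nlinarith
  have hδr := S.del_le
  have hδ := del_pos S.one_le
  have hδ2 : del d ^ 2 ≤ 1 / 10 ^ 30 := by nlinarith
  have hN4 : (4 : ℝ) ≤ N := by
    have := S.inv_le
    have hN := S.nat_pos
    nlinarith
  obtain ⟨θ, hθ⟩ : ∃ θ, θ = 16 * 10 ^ 9 * (q * Real.log q) := ⟨_, rfl⟩
  have hθ0 : 0 < θ := by rw [hθ]; positivity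
  have hexp : Real.exp (θ * (40 * 400 ^ 2 * del d)) ≤ Real.sqrt q := by
    rw [Real.sqrt_eq_rpow, Real.rpow_def_of_pos hq0]
    refine Real.exp_le_exp.2 ?_
    have : θ * del d ≤ 16 * 10 ^ 9 * (q * Real.log q) * r := by rw [hθ]; gcongr
    have h2 : 16 * 10 ^ 9 * (q * Real.log q) * r = 16 * 10 ^ 9 * Real.log q * (1 / 10 ^ 30) := by
      rw [← hrq]; ring
    rw [h2] at this
    linarith
  have hexp' : Real.exp (θ * (8 * 400 ^ 2 * del d)) ≤ Real.sqrt q := by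
    refine le_trans (Real.exp_le_exp.2 ?_) hexp
    gcongr
    norm_num
  have hmain : θ * r ^ 2 * Real.sqrt q ≤ 1 / 10 ^ 45 := by
    have hs := Real.mul_self_sqrt hq0.le
    have hs0 := Real.sqrt_nonneg q
    have h1 : Real.log q * Real.sqrt q ≤ 2 * q := by nlinarith
    calc θ * r ^ 2 * Real.sqrt q = 16 * 10 ^ 9 * (q * r ^ 2) * (Real.log q * Real.sqrt q) := by
          rw [hθ]; ring
      _ ≤ 16 * 10 ^ 9 * (q * r ^ 2) * (2 * q) := by gcongr
      _ = 32 * 10 ^ 9 * (r * q) ^ 2 := by ring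
      _ ≤ 1 / 10 ^ 45 := by rw [hrq]; norm_num
  have h1 := card_badRow_le (B := 20) (M := 400) (ε₁ := 1 / 10 ^ 6) (ε := 1 / 10 ^ 9) (θ := θ) S o
    (by norm_num) (by norm_num) (by norm_num) (by norm_num) (by linarith) (by norm_num)
    (by norm_num) hθ0
    (by
      have : θ * (20000 * 400 ^ 6 * r ^ 2) * Real.exp (θ * (40 * 400 ^ 2 * del d)) ≤
          20000 * 400 ^ 6 * (1 / 10 ^ 45) := by
        calc _ ≤ θ * (20000 * 400 ^ 6 * r ^ 2) * Real.sqrt q := by gcongr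
          _ = 20000 * 400 ^ 6 * (θ * r ^ 2 * Real.sqrt q) := by ring
          _ ≤ _ := by gcongr
      linarith)
    (by
      have : θ * (340 * 400 ^ 6 * r ^ 2) * Real.exp (θ * (8 * 400 ^ 2 * del d)) ≤
          340 * 400 ^ 6 * (1 / 10 ^ 45) := by
        calc _ ≤ θ * (340 * 400 ^ 6 * r ^ 2) * Real.sqrt q := by gcongr
          _ = 340 * 400 ^ 6 * (θ * r ^ 2 * Real.sqrt q) := by ring
          _ ≤ _ := by gcongr
      linarith)
  refine h1.trans ?_
  gcongr
  have e1 : θ * (1 / 10 ^ 9 / 2) = 8 * (q * Real.log q) := by rw [hθ]; ring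
  have e2 : 8 * (q * Real.log q) ≤ θ * (1 / 10 ^ 6 / 2) := by rw [← e1]; gcongr <;> norm_num
  rw [e1]
  have e3 : Real.exp (-(θ * (1 / 10 ^ 6 / 2))) ≤ Real.exp (-(8 * (q * Real.log q))) :=
    Real.exp_le_exp.2 (by linarith)
  have e4 : (4 * (N + 1) + 4 * N ^ 2 : ℝ) ≤ N ^ 4 := by
    have : (16 : ℝ) ≤ N ^ 2 := by nlinarith
    nlinarith
  calc 4 * (N + 1 : ℝ) * Real.exp (-(8 * (q * Real.log q))) +
        4 * N ^ 2 * Real.exp (-(θ * (1 / 10 ^ 6 / 2)))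
      ≤ 4 * (N + 1 : ℝ) * Real.exp (-(8 * (q * Real.log q))) +
        4 * N ^ 2 * Real.exp (-(8 * (q * Real.log q))) := by gcongr
    _ = (4 * (N + 1) + 4 * N ^ 2) * Real.exp (-(8 * (q * Real.log q))) := by ring
    _ ≤ _ := by gcongr

lemma card_not_resBounds_le_exp (hq : 2 ≤ q) (hd : 10 ^ 60 * q ^ 2 ≤ d)
    (hN : (d : ℝ) ^ 3 * (10 ^ 60 * q ^ 2) ≤ N ^ 2)
    (hη : 2 * (1 + |E|) * (10 ^ 60 * q ^ 2) = N * η) :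
    (cardOf fun G : Fin N → Fin N → Bool => IsRegGraph N d G ∧
      ¬ ResBounds (1 / 20) 20 (1 / 10 ^ 6) (9 / 20) d ⟨E, η⟩ G : ℝ) ≤
      (cardOf fun G : Fin N → Fin N → Bool => IsRegGraph N d G) *
        (N ^ 7 * Real.exp (-(8 * (q * Real.log q)))) := by
  have hq0 : 0 < q := by linarith
  have hd0 : (10 ^ 60 : ℝ) ≤ d := by nlinarith
  have hd1 : (1 : ℝ) ≤ d := by linarith
  have hd1' : 1 ≤ d := by exact_mod_cast hd1
  have hN0 : (10 ^ 60 : ℝ) ≤ N := by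
    have h1 : (d : ℝ) ^ 2 ≤ N ^ 2 := by
      refine le_trans ?_ hN
      have : (1 : ℝ) ≤ 10 ^ 60 * q ^ 2 := by nlinarith
      calc (d : ℝ) ^ 2 = d ^ 2 * 1 * 1 := by ring
        _ ≤ d ^ 2 * d * (10 ^ 60 * q ^ 2) := by gcongr
        _ = _ := by ring
    exact hd0.trans (le_of_sq_le_sq h1 (by positivity))
  have hN1 : (0 : ℝ) < N := by linarith
  set r := 1 / (10 ^ 30 * q) with hr
  have hr0 : 0 < r := by positivity
  have hrq : r * q = 1 / 10 ^ 30 := by rw [hr]; field_simp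
  have hr2 : r ^ 2 * (10 ^ 60 * q ^ 2) = 1 := by
    calc r ^ 2 * (10 ^ 60 * q ^ 2) = 10 ^ 60 * (r * q) ^ 2 := by ring
      _ = 1 := by rw [hrq]; norm_num
  have hr1 : r ≤ 1 / 10 ^ 30 := by rw [← hrq]; nlinarith
  have hη1 : 1 / N ≤ η := by
    rw [div_le_iff₀ hN1, mul_comm, ← hη]
    nlinarith [abs_nonneg E, sq_nonneg q]
  have hη0 : 0 < η := lt_of_lt_of_le (by positivity) hη1
  have hS : ∀ η', η ≤ η' → Scale N d ⟨E, η'⟩ r := by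
    intro η' h'
    refine scale_of_le hr0 (by linarith) ?_ ?_ ?_
    · calc 1 = r ^ 2 * (10 ^ 60 * q ^ 2) := hr2.symm
        _ ≤ r ^ 2 * d := by gcongr
    · calc (d : ℝ) ^ 3 = r ^ 2 * (d ^ 3 * (10 ^ 60 * q ^ 2)) := by linear_combination -d ^ 3 * hr2
        _ ≤ r ^ 2 * N ^ 2 := by gcongr
    · calc 2 * (1 + |E|) = r ^ 2 * (2 * (1 + |E|) * (10 ^ 60 * q ^ 2)) := by
            linear_combination -(2 * (1 + |E|)) * hr2
        _ = N * r ^ 2 * η := by rw [hη]; ring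
        _ ≤ N * r ^ 2 * η' := by gcongr
  have h := card_not_resBounds_le (E := E) (N := N) (d := d) (r := r) (ε := 1 / 10 ^ 9)
    (ε₁ := 1 / 10 ^ 6) (τ := 1 / 10 ^ 8) hd1' (by norm_num) (by norm_num) (by linarith)
    (by linarith) (by linarith) (by norm_num) (by norm_num) (N ^ 2) η hη0 hS
    (fun η' h' o => card_badRow_le_exp hq (hS η' h') o) (by
      have h1 := one_add_mul_le_pow (a := (1 / 10 ^ 8 : ℝ)) (by norm_num) (N ^ 2)
      calc (4 / (1 / 10 ^ 6) : ℝ) ≤ 1 / N * (1 + (N ^ 2 : ℕ) * (1 / 10 ^ 8)) := by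
            push_cast
            have : (1 / N : ℝ) * (1 + N ^ 2 * (1 / 10 ^ 8)) = 1 / N + N * (1 / 10 ^ 8) := by
              field_simp
            rw [this]
            have : (0 : ℝ) < 1 / N := by positivity
            linarith
        _ ≤ η * (1 + 1 / 10 ^ 8) ^ N ^ 2 := by gcongr)
  refine h.trans (le_of_eq ?_)
  push_cast
  ring

lemma abs_eigenvalue_le (hG : IsRegGraph N d G) {v : Fin N → ℝ} (hv : ∑ i, v i ^ 2 = 1)
    (hA : (adjOf G).mulVec v = lam • v) : |lam| ≤ d := by
  have hne : (Finset.univ : Finset (Fin N)).Nonempty := by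
    by_contra h
    rw [Finset.not_nonempty_iff_eq_empty] at h
    rw [h] at hv
    simp at hv
  obtain ⟨i, -, hi⟩ := Finset.exists_max_image Finset.univ (fun i => |v i|) hne
  have hpos : 0 < |v i| := by
    by_contra hc
    have h0 : ∀ j, v j = 0 := fun j => abs_nonpos_iff.1 ((hi j (Finset.mem_univ j)).trans
      (not_lt.1 hc))
    simp [h0] at hv
  have h1 := congrFun hA i
  simp only [Matrix.mulVec, dotProduct, adjOf, Matrix.of_apply, Pi.smul_apply, smul_eq_mul,
    ite_mul, one_mul, zero_mul] at h1
  rw [← Finset.sum_filter] at h1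
  have h2 : |lam| * |v i| ≤ d * |v i| := by
    rw [← abs_mul, ← h1]
    refine (Finset.abs_sum_le_sum_abs _ _).trans ?_
    refine (Finset.sum_le_card_nsmul _ _ |v i| fun j _ => hi j (Finset.mem_univ j)).trans ?_
    rw [hG.2.2 i, nsmul_eq_mul]
  exact le_of_mul_le_mul_right h2 hpos

/-- All normalized eigenvectors of `G` are bounded by `b` in sup norm squared. -/
def Delocalized (b : ℝ) (G : Fin N → Fin N → Bool) : Prop :=
  ∀ (v : Fin N → ℝ) (lam : ℝ), ∑ i, v i ^ 2 = 1 → (adjOf G).mulVec v = lam • v →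
    ∀ i, v i ^ 2 ≤ b

set_option maxHeartbeats 1000000 in
/-- Delocalization of the eigenvectors of random regular graphs. -/
theorem card_not_delocalized_le (hq : 2 ≤ q) (hD : 10 ^ 60 * q ^ 2 ≤ Dunif N d) :
    (cardOf fun G : Fin N → Fin N → Bool => IsRegGraph N d G ∧
      ¬ Delocalized (10 ^ 63 * q ^ 2 / N) G : ℝ) ≤
      (cardOf fun G : Fin N → Fin N → Bool => IsRegGraph N d G) *
        (N ^ 10 * Real.exp (-(8 * (q * Real.log q)))) := by
  have hq0 : 0 < q := by linarith
  have hd : 10 ^ 60 * q ^ 2 ≤ d := hD.trans (min_le_left _ _)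
  have hd0 : (10 ^ 60 : ℝ) ≤ d := by nlinarith
  have hd1 : (1 : ℝ) ≤ d := by linarith
  have hd1' : 1 ≤ d := by exact_mod_cast hd1
  have hN : (d : ℝ) ^ 3 * (10 ^ 60 * q ^ 2) ≤ N ^ 2 := by
    have := hD.trans (min_le_right _ _)
    rw [le_div_iff₀ (by positivity)] at this
    linarith
  have hN0 : (d : ℝ) ≤ N := by
    refine le_of_sq_le_sq (le_trans ?_ hN) (by positivity)
    have : (1 : ℝ) ≤ 10 ^ 60 * q ^ 2 := by nlinarith
    calc (d : ℝ) ^ 2 = d ^ 2 * 1 * 1 := by ring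
      _ ≤ d ^ 2 * d * (10 ^ 60 * q ^ 2) := by gcongr
      _ = _ := by ring
  have hN1 : (0 : ℝ) < N := by linarith
  set Q := 10 ^ 60 * q ^ 2 with hQ
  have hQ1 : (10 ^ 60 : ℝ) ≤ Q := by nlinarith
  set X : ℝ := (cardOf fun G : Fin N → Fin N → Bool => IsRegGraph N d G) *
        (N ^ 7 * Real.exp (-(8 * (q * Real.log q)))) with hX
  obtain ⟨et, het⟩ : ∃ et : ℝ → ℝ, ∀ E, et E = 2 * (1 + |E|) * Q / N := ⟨_, fun _ => rfl⟩
  have het' : ∀ E, 2 * (1 + |E|) * Q = N * et E := fun E => by rw [het]; field_simp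
  have hetp : ∀ E, 0 < et E := fun E => by rw [het]; positivity
  have h1 : (cardOf fun G : Fin N → Fin N → Bool => IsRegGraph N d G ∧
      ¬ Delocalized (10 ^ 63 * q ^ 2 / N) G) ≤
      ∑ j ∈ Finset.Icc (-(N : ℤ) ^ 2) ((N : ℤ) ^ 2),
        cardOf fun G : Fin N → Fin N → Bool => IsRegGraph N d G ∧
          ¬ ResBounds (1 / 20) 20 (1 / 10 ^ 6) (9 / 20) d ⟨(j : ℝ) / N, et ((j : ℝ) / N)⟩ G := by
    refine le_trans (cardOf_le_of_imp ?_) (cardOf_exists_le _ _)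
    rintro G ⟨hG, hn⟩
    by_contra hc
    push Not at hc
    refine hn fun v lam hv hA i => ?_
    have hlam := abs_eigenvalue_le hG hv hA
    have hδ := del_pos hd1'
    have hδ2 := del_sq hd1'
    have hμ : |lam * del d| ≤ N := by
      rw [abs_mul, abs_of_pos hδ]
      refine le_trans ?_ hN0
      have : del d ≤ 1 := by
        refine le_of_sq_le_sq ?_ zero_le_one
        nlinarith [sq_nonneg (del d)]
      nlinarith [abs_nonneg lam]
    set μ := lam * del d with hμd
    set j : ℤ := ⌊μ * N⌋ with hj
    have hj1 : (j : ℝ) ≤ μ * N := Int.floor_le _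
    have hj2 : μ * N < j + 1 := Int.lt_floor_add_one _
    have hμ1 := (abs_le.1 hμ).1
    have hμ2 := (abs_le.1 hμ).2
    have hmem : j ∈ Finset.Icc (-(N : ℤ) ^ 2) ((N : ℤ) ^ 2) := by
      rw [Finset.mem_Icc]
      constructor
      · rw [hj, Int.le_floor]; push_cast; nlinarith
      · have : (j : ℝ) ≤ (N : ℝ) ^ 2 := by nlinarith
        exact_mod_cast this
    have hres := hc j hmem hG
    set E : ℝ := (j : ℝ) / N with hE
    have hdist1 : 0 ≤ μ - E := by
      rw [hE, sub_nonneg, div_le_iff₀ hN1]; exact hj1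
    have hdist2 : μ - E ≤ 1 / N := by
      rw [hE, sub_le_iff_le_add, ← add_div, le_div_iff₀ hN1]; linarith
    have hη1 : 1 / N ≤ et E := by
      rw [het]; gcongr; nlinarith [abs_nonneg E]
    have hη := hetp E
    have hnorm : ‖((μ : ℝ) : ℂ) - ⟨E, et E⟩‖ ≤ 2 * et E := by
      refine (Complex.norm_le_abs_re_add_abs_im _).trans ?_
      simp only [Complex.sub_re, Complex.ofReal_re, Complex.sub_im, Complex.ofReal_im, zero_sub,
        abs_neg]
      rw [abs_of_nonneg hdist1, abs_of_pos hη]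
      linarith
    refine (eigenvector_le hG (z := ⟨E, et E⟩) hη hv hA i).trans ?_
    have hup := hres.upper i
    set g := ‖gfull d G ⟨E, et E⟩ i i‖ with hg
    have hg0 : 0 ≤ g := norm_nonneg _
    have hzE : |E| ≤ ‖(⟨E, et E⟩ : ℂ)‖ := Complex.abs_re_le_norm ⟨E, et E⟩
    have hg1 : (1 + |E|) * g ≤ 20 := by nlinarith
    have h2 : ‖((μ : ℝ) : ℂ) - ⟨E, et E⟩‖ ^ 2 * (g / et E) ≤ (2 * et E) ^ 2 * (g / et E) := by
      gcongr
    have h3 : (2 * et E) ^ 2 * (g / et E) = 4 * (et E * g) := by field_simp; ring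
    have h4 : et E * g ≤ 40 * Q / N := by
      rw [het, div_mul_eq_mul_div]
      refine div_le_div_of_nonneg_right ?_ hN1.le
      calc 2 * (1 + |E|) * Q * g = 2 * Q * ((1 + |E|) * g) := by ring
        _ ≤ 2 * Q * 20 := by gcongr
        _ = 40 * Q := by ring
    have h5 : 10 ^ 63 * q ^ 2 / N = 1000 * Q / N := by rw [hQ]; ring
    have h6 : (2 : ℝ) / N ≤ Q / N := by gcongr; linarith
    have h7 : 2 * (4 * (40 * Q / N)) + Q / N ≤ 1000 * Q / N := by
      have : 2 * (4 * (40 * Q / N)) + Q / N = 321 * Q / N := by ring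
      rw [this]; gcongr; norm_num
    simp only
    linarith
  have h2 : (∑ j ∈ Finset.Icc (-(N : ℤ) ^ 2) ((N : ℤ) ^ 2),
        (cardOf fun G : Fin N → Fin N → Bool => IsRegGraph N d G ∧
          ¬ ResBounds (1 / 20) 20 (1 / 10 ^ 6) (9 / 20) d ⟨(j : ℝ) / N, et ((j : ℝ) / N)⟩ G : ℝ))
      ≤ (2 * N ^ 2 + 1 : ℝ) * X := by
    refine (Finset.sum_le_card_nsmul _ _ X fun j _ =>
      card_not_resBounds_le_exp hq hd hN (het' _)).trans (le_of_eq ?_)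
    rw [Int.card_Icc, nsmul_eq_mul]
    congr 1
    have : (((N : ℤ) ^ 2 + 1 - -(N : ℤ) ^ 2).toNat : ℤ) = 2 * N ^ 2 + 1 := by
      rw [Int.toNat_of_nonneg (by linarith [sq_nonneg (N : ℤ)])]; ring
    exact_mod_cast this
  have h3 : (cardOf fun G : Fin N → Fin N → Bool => IsRegGraph N d G ∧
      ¬ Delocalized (10 ^ 63 * q ^ 2 / N) G : ℝ) ≤ (2 * N ^ 2 + 1 : ℝ) * X :=
    le_trans (by exact_mod_cast h1) h2
  refine h3.trans ?_
  have hX0 : 0 ≤ X := by positivity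
  have h4 : (2 * N ^ 2 + 1 : ℝ) ≤ N ^ 3 := by
    have : (1 : ℝ) ≤ N ^ 2 := by nlinarith
    have : (3 : ℝ) ≤ N := by linarith
    nlinarith
  refine (mul_le_mul_of_nonneg_right h4 hX0).trans (le_of_eq ?_)
  rw [hX, mul_left_comm, ← mul_assoc ((N : ℝ) ^ 3), ← pow_add]

end Delocalization

section PermConcentration

open Equiv

/-- A function with small oscillation has a subgaussian moment generating function. -/
lemma sum_exp_sub_mean_le {ι : Type*} [Fintype ι] [Nonempty ι] (m : ι → ℝ) {c : ℝ}
    (h : ∀ p p', |m p - m p'| ≤ c) (θ : ℝ) :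
    ∑ p, Real.exp (θ * (m p - (∑ p', m p') / Fintype.card ι)) ≤
      Fintype.card ι * Real.exp (θ ^ 2 * c ^ 2 / 2) := by
  have hn : (0 : ℝ) < Fintype.card ι := by exact_mod_cast Fintype.card_pos
  have h1 : ∀ p, Real.exp (θ * (m p - (∑ p', m p') / Fintype.card ι)) ≤
      ∑ p', (Fintype.card ι : ℝ)⁻¹ * Real.exp (θ * (m p - m p')) := by
    intro p
    have := convexOn_exp.map_sum_le (t := Finset.univ) (w := fun _ => (Fintype.card ι : ℝ)⁻¹)
      (p := fun p' => θ * (m p - m p')) (fun _ _ => by positivity)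
      (by simp [hn.ne']) (fun _ _ => Set.mem_univ _)
    simp only [smul_eq_mul] at this
    refine le_trans (le_of_eq ?_) this
    congr 1
    rw [← Finset.mul_sum, ← Finset.mul_sum, Finset.sum_sub_distrib, Finset.sum_const,
      Finset.card_univ, nsmul_eq_mul]
    field_simp
  have h2 : ∑ p, ∑ p', Real.exp (θ * (m p - m p')) =
      ∑ p, ∑ p', Real.cosh (θ * (m p - m p')) := by
    have e : ∑ p, ∑ p', Real.exp (θ * (m p - m p')) =
        ∑ p, ∑ p', Real.exp (-(θ * (m p - m p'))) := by
      rw [Finset.sum_comm]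
      refine Finset.sum_congr rfl fun p _ => Finset.sum_congr rfl fun p' _ => ?_
      congr 1; ring
    simp only [Real.cosh_eq, ← Finset.sum_div, Finset.sum_add_distrib, ← e]
    ring
  have h3 : ∑ p, ∑ p', Real.cosh (θ * (m p - m p')) ≤
      Fintype.card ι * (Fintype.card ι * Real.exp (θ ^ 2 * c ^ 2 / 2)) := by
    have : ∀ p p', Real.cosh (θ * (m p - m p')) ≤ Real.exp (θ ^ 2 * c ^ 2 / 2) := by
      intro p p'
      refine (Real.cosh_le_exp_half_sq _).trans (Real.exp_le_exp.2 ?_)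
      rw [mul_pow, ← sq_abs (m p - m p')]
      have := h p p'
      gcongr
    refine (Finset.sum_le_card_nsmul _ _ _ fun p _ =>
      Finset.sum_le_card_nsmul _ _ _ fun p' _ => this p p').trans (le_of_eq ?_)
    simp [Finset.card_univ]
  refine (Finset.sum_le_sum fun p _ => h1 p).trans ?_
  simp only [← Finset.mul_sum]
  rw [h2]
  refine (mul_le_mul_of_nonneg_left h3 (by positivity)).trans (le_of_eq ?_)
  field_simp

lemma sum_perm_decomposeFin {n : ℕ} (g : Perm (Fin (n + 1)) → ℝ) :
    ∑ σ, g σ = ∑ p, ∑ e, g (Perm.decomposeFin.symm (p, e)) := by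
  rw [← Fintype.sum_prod_type', Equiv.sum_comp Perm.decomposeFin.symm g]

lemma sum_decomposeFin_eq {n : ℕ} (g : Perm (Fin (n + 1)) → ℝ) (p p' : Fin (n + 1)) :
    ∑ e, g (Perm.decomposeFin.symm (p', e)) =
      ∑ e, g (swap p p' * Perm.decomposeFin.symm (p, e)) := by
  refine (Fintype.sum_bijective
    (fun e => (Perm.decomposeFin (swap p p' * Perm.decomposeFin.symm (p, e))).2) ?_ _ _
    fun e => ?_).symm
  · rw [Fintype.bijective_iff_injective_and_card]
    refine ⟨fun e e' h => ?_, rfl⟩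
    have hf : ∀ e, (Perm.decomposeFin (swap p p' * Perm.decomposeFin.symm (p, e))).1 = p' := by
      intro e
      rw [← Perm.decomposeFin_symm_apply_zero
        (Perm.decomposeFin (swap p p' * Perm.decomposeFin.symm (p, e))).1
        (Perm.decomposeFin (swap p p' * Perm.decomposeFin.symm (p, e))).2]
      simp
    have := Perm.decomposeFin.injective (Prod.ext ((hf e).trans (hf e').symm) h)
    simpa using this
  · have hf : (Perm.decomposeFin (swap p p' * Perm.decomposeFin.symm (p, e))).1 = p' := by
      rw [← Perm.decomposeFin_symm_apply_zero
        (Perm.decomposeFin (swap p p' * Perm.decomposeFin.symm (p, e))).1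
        (Perm.decomposeFin (swap p p' * Perm.decomposeFin.symm (p, e))).2]
      simp
    congr 1
    rw [← Equiv.symm_apply_apply Perm.decomposeFin
      (swap p p' * Perm.decomposeFin.symm (p, e))]
    congr 1
    simp [Prod.ext_iff, hf]

/-- Bounded differences concentration on the symmetric group. -/
theorem sum_perm_exp_le {n : ℕ} (f : Perm (Fin n) → ℝ) (c : Fin n → ℝ)
    (h : ∀ σ k l, k < l → |f (σ * swap k l) - f σ| ≤ c k) (hc : ∀ k, 0 ≤ c k) (θ : ℝ) :
    ∑ σ, Real.exp (θ * (f σ - (∑ τ, f τ) / n.factorial)) ≤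
      n.factorial * Real.exp (θ ^ 2 * (∑ k, c k ^ 2) / 2) := by
  induction n with
  | zero => simp
  | succ n ih =>
    set m : Fin (n + 1) → ℝ := fun p => (∑ e, f (Perm.decomposeFin.symm (p, e))) / n.factorial
      with hm
    have hfac : (0 : ℝ) < n.factorial := by exact_mod_cast n.factorial_pos
    have h1 : ∀ p, ∑ e, Real.exp (θ * (f (Perm.decomposeFin.symm (p, e)) - m p)) ≤
        n.factorial * Real.exp (θ ^ 2 * (∑ k : Fin n, c k.succ ^ 2) / 2) := by
      intro p
      refine ih (fun e => f (Perm.decomposeFin.symm (p, e))) (fun k => c k.succ) ?_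
        fun k => hc _
      intro e k l hkl
      have : Perm.decomposeFin.symm (p, e * swap k l) =
          Perm.decomposeFin.symm (p, e) * swap k.succ l.succ := by
        ext x
        refine Fin.cases ?_ (fun y => ?_) x
        · rw [Perm.mul_apply, swap_apply_of_ne_of_ne (Fin.succ_ne_zero k).symm
            (Fin.succ_ne_zero l).symm, Perm.decomposeFin_symm_apply_zero,
            Perm.decomposeFin_symm_apply_zero]
        · rw [Perm.decomposeFin_symm_apply_succ, Perm.mul_apply, Perm.mul_apply,
            ← (Fin.succ_injective n).map_swap, Perm.decomposeFin_symm_apply_succ]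
      rw [this]
      exact h _ _ _ (Fin.succ_lt_succ_iff.2 hkl)
    have h2 : ∀ p p', |m p - m p'| ≤ c 0 := by
      intro p p'
      rw [hm]
      simp only
      rw [sum_decomposeFin_eq f p p', ← sub_div, ← Finset.sum_sub_distrib, abs_div,
        abs_of_pos hfac, div_le_iff₀ hfac]
      refine (Finset.abs_sum_le_sum_abs _ _).trans ?_
      refine (Finset.sum_le_card_nsmul _ _ (c 0) fun e _ => ?_).trans
        (le_of_eq (by simp [Finset.card_univ, Fintype.card_perm, mul_comm]))
      by_cases hp : p = p'
      · subst hp; rw [swap_self, ← Perm.one_def, one_mul, sub_self, abs_zero]; exact hc 0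
      · set σ := Perm.decomposeFin.symm (p, e) with hσ
        have hσ0 : σ 0 = p := Perm.decomposeFin_symm_apply_zero p e
        have : swap p p' * σ = σ * swap 0 (σ⁻¹ p') := by
          rw [Equiv.mul_swap_eq_swap_mul, hσ0, ← Perm.mul_apply, mul_inv_cancel, Perm.one_apply]
        rw [this, abs_sub_comm]
        refine h _ _ _ (Fin.pos_iff_ne_zero.2 fun h0 => hp ?_)
        rw [Perm.inv_eq_iff_eq, hσ0] at h0
        exact h0.symm
    have h3 := sum_exp_sub_mean_le m h2 θ
    have hmean : (∑ τ, f τ) / (n + 1).factorial = (∑ p, m p) / Fintype.card (Fin (n + 1)) := by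
      rw [sum_perm_decomposeFin, hm, ← Finset.sum_div, Fintype.card_fin, div_div,
        Nat.factorial_succ]
      push_cast
      ring
    rw [hmean, sum_perm_decomposeFin]
    have h4 : ∀ p, ∑ e, Real.exp (θ * (f (Perm.decomposeFin.symm (p, e)) -
        (∑ p, m p) / Fintype.card (Fin (n + 1)))) ≤
        n.factorial * Real.exp (θ ^ 2 * (∑ k : Fin n, c k.succ ^ 2) / 2) *
          Real.exp (θ * (m p - (∑ p, m p) / Fintype.card (Fin (n + 1)))) := by
      intro p
      refine le_trans (le_of_eq ?_) (mul_le_mul_of_nonneg_right (h1 p) (Real.exp_nonneg _))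
      rw [Finset.sum_mul]
      refine Finset.sum_congr rfl fun e _ => ?_
      rw [← Real.exp_add]
      congr 1; ring
    refine (Finset.sum_le_sum fun p _ => h4 p).trans ?_
    rw [← Finset.mul_sum]
    refine (mul_le_mul_of_nonneg_left h3 (by positivity)).trans (le_of_eq ?_)
    rw [Fin.sum_univ_succ, Fintype.card_fin, Nat.factorial_succ, mul_add, add_div, Real.exp_add]
    push_cast
    ring

variable {n : ℕ} {V : Type*} [NormedAddCommGroup V] [InnerProductSpace ℝ V]

lemma sum_perm_norm_sq_le (a : Fin n → ℝ) (ha : ∑ i, a i = 0) (x : Fin n → V) {b : ℝ}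
    (hb : ∀ i, ‖x i‖ ≤ b) :
    ∑ σ : Perm (Fin n), ‖∑ c, a c • x (σ c)‖ ^ 2 ≤ n.factorial * (2 * b ^ 2 * ∑ i, a i ^ 2) := by
  set S : Fin n → Fin n → ℝ := fun c c' => ∑ σ : Perm (Fin n), inner ℝ (x (σ c)) (x (σ c'))
    with hS
  have hbd : ∀ c c', |S c c'| ≤ n.factorial * b ^ 2 := by
    intro c c'
    refine (Finset.abs_sum_le_sum_abs _ _).trans ?_
    refine (Finset.sum_le_card_nsmul _ _ (b ^ 2) fun σ _ => ?_).trans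
      (le_of_eq (by simp [Finset.card_univ, Fintype.card_perm]))
    refine (abs_real_inner_le_norm _ _).trans ?_
    rw [sq]
    exact mul_le_mul (hb _) (hb _) (norm_nonneg _) ((norm_nonneg _).trans (hb (σ c)))
  have hinv : ∀ (τ : Perm (Fin n)) c c', S (τ c) (τ c') = S c c' := by
    intro τ c c'
    rw [hS]
    simp only
    rw [← Equiv.sum_comp (Equiv.mulRight τ) fun σ : Perm (Fin n) => inner ℝ (x (σ c)) (x (σ c'))]
    simp
  obtain ⟨s₁, s₂, h₁, h₂, hs⟩ : ∃ s₁ s₂, |s₁| ≤ n.factorial * b ^ 2 ∧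
      |s₂| ≤ n.factorial * b ^ 2 ∧ ∀ c c', S c c' = if c = c' then s₁ else s₂ := by
    rcases isEmpty_or_nonempty (Fin n) with he | ⟨⟨k⟩⟩
    · exact ⟨0, 0, by rw [abs_zero]; positivity, by rw [abs_zero]; positivity,
        fun c => he.elim c⟩
    · by_cases hex : ∃ k', k ≠ k'
      · obtain ⟨k', hk⟩ := hex
        refine ⟨S k k, S k k', hbd _ _, hbd _ _, fun c c' => ?_⟩
        split_ifs with hc
        · subst hc
          have := hinv (swap k c) k k
          rwa [swap_apply_left] at this
        · have h3 : swap k c k' ≠ c := fun h => hk (by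
            have := congrArg (swap k c) h
            rw [swap_apply_self, swap_apply_right] at this
            exact this.symm)
          have := hinv (swap (swap k c k') c' * swap k c) k k'
          rw [Perm.mul_apply, Perm.mul_apply, swap_apply_left, swap_apply_left,
            swap_apply_of_ne_of_ne h3.symm hc] at this
          exact this
      · push Not at hex
        refine ⟨S k k, S k k, hbd _ _, hbd _ _, fun c c' => ?_⟩
        rw [← hex c, ← hex c', if_pos rfl]
  have hexp : ∑ σ : Perm (Fin n), ‖∑ c, a c • x (σ c)‖ ^ 2 =
      ∑ c, ∑ c', a c * a c' * S c c' := by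
    simp only [← real_inner_self_eq_norm_sq, sum_inner, inner_sum, inner_smul_left,
      inner_smul_right, hS, Finset.mul_sum]
    rw [Finset.sum_comm]
    refine Finset.sum_congr rfl fun c _ => ?_
    rw [Finset.sum_comm]
    refine Finset.sum_congr rfl fun c' _ => Finset.sum_congr rfl fun σ _ => ?_
    rw [real_inner_comm, conj_trivial]
    ring
  have hval : ∑ c, ∑ c', a c * a c' * S c c' = (s₁ - s₂) * ∑ c, a c ^ 2 := by
    have e : ∀ c c', a c * a c' * S c c' = s₂ * (a c * a c') +
        if c = c' then (s₁ - s₂) * (a c * a c') else 0 := by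
      intro c c'
      rw [hs]
      split_ifs <;> ring
    simp only [e, Finset.sum_add_distrib, ← Finset.mul_sum, ha, mul_zero,
      zero_add, Finset.sum_ite_eq, Finset.mem_univ, if_true, sq]
  rw [hexp, hval]
  have h3 : s₁ - s₂ ≤ n.factorial * (2 * b ^ 2) := by
    linarith [(abs_le.1 h₁).2, (abs_le.1 h₂).1]
  calc _ ≤ n.factorial * (2 * b ^ 2) * ∑ c, a c ^ 2 :=
        mul_le_mul_of_nonneg_right h3 (Finset.sum_nonneg fun _ _ => sq_nonneg _)
    _ = _ := by ring

lemma card_perm_norm_gt_le_of_antitone (a : Fin n → ℝ) (ha : ∑ i, a i = 0)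
    (hmono : ∀ k l, k < l → |a l| ≤ |a k|) (x : Fin n → V) {b t : ℝ}
    (hb0 : 0 < b) (hb : ∀ i, ‖x i‖ ≤ b) (ht : 0 ≤ t) :
    (cardOf fun σ : Perm (Fin n) => (2 + t) * b * Real.sqrt (∑ i, a i ^ 2) <
      ‖∑ c, a c • x (σ c)‖ : ℝ) ≤ n.factorial * Real.exp (-(t ^ 2 / 32)) := by
  classical
  set s := Real.sqrt (∑ i, a i ^ 2) with hs
  have hs2 : s ^ 2 = ∑ i, a i ^ 2 := Real.sq_sqrt (Finset.sum_nonneg fun _ _ => sq_nonneg _)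
  have hfac : (0 : ℝ) < n.factorial := by exact_mod_cast n.factorial_pos
  rcases (Real.sqrt_nonneg (∑ i, a i ^ 2)).eq_or_lt with h0 | h0
  · have hz : ∀ i, a i = 0 := by
      rw [← hs] at h0
      rw [← h0] at hs2
      intro i
      have := (Finset.sum_eq_zero_iff_of_nonneg (fun i _ => sq_nonneg (a i))).1
        (by rw [← hs2]; norm_num) i (Finset.mem_univ i)
      exact pow_eq_zero_iff two_ne_zero |>.1 this
    rw [cardOf_eq_zero]
    · simp only [Nat.cast_zero]; positivity
    · intro σ
      simp [hz, hs]
  rw [← hs] at h0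
  set f : Perm (Fin n) → ℝ := fun σ => ‖∑ c, a c • x (σ c)‖ with hf
  have hosc : ∀ σ k l, k < l → |f (σ * swap k l) - f σ| ≤ 4 * b * |a k| := by
    intro σ k l hkl
    refine (abs_norm_sub_norm_le _ _).trans ?_
    rw [← Finset.sum_sub_distrib, ← Finset.sum_subset (Finset.subset_univ {k, l})]
    · rw [Finset.sum_pair hkl.ne]
      simp only [Perm.mul_apply, swap_apply_left, swap_apply_right]
      have e : a k • x (σ l) - a k • x (σ k) + (a l • x (σ k) - a l • x (σ l)) =
          (a k - a l) • (x (σ l) - x (σ k)) := by module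
      rw [e, norm_smul, Real.norm_eq_abs]
      have h1 : |a k - a l| ≤ 2 * |a k| := by
        have := abs_sub (a k) (a l)
        linarith [hmono k l hkl]
      have h2 : ‖x (σ l) - x (σ k)‖ ≤ 2 * b := by
        have := norm_sub_le (x (σ l)) (x (σ k))
        linarith [hb (σ l), hb (σ k)]
      calc |a k - a l| * ‖x (σ l) - x (σ k)‖ ≤ 2 * |a k| * (2 * b) := by gcongr
        _ = _ := by ring
    · intro c _ hc
      simp only [Finset.mem_insert, Finset.mem_singleton, not_or] at hc
      rw [Perm.mul_apply, swap_apply_of_ne_of_ne hc.1 hc.2, sub_self]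
  have hmean : (∑ σ, f σ) / n.factorial ≤ 2 * (b * s) := by
    rw [div_le_iff₀ hfac]
    refine le_of_sq_le_sq ?_ (by positivity)
    have h1 := sq_sum_le_card_mul_sum_sq (s := Finset.univ) (f := f)
    rw [Finset.card_univ, Fintype.card_perm, Fintype.card_fin] at h1
    have h2 := sum_perm_norm_sq_le a ha x hb
    rw [← hs2] at h2
    calc (∑ σ, f σ) ^ 2 ≤ n.factorial * ∑ σ, f σ ^ 2 := h1
      _ ≤ n.factorial * (n.factorial * (2 * b ^ 2 * s ^ 2)) := by gcongr
      _ ≤ (2 * (b * s) * n.factorial) ^ 2 := by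
        have : 0 ≤ (b * s * n.factorial) ^ 2 := by positivity
        nlinarith
  have hexp := sum_perm_exp_le f (fun k => 4 * b * |a k|) hosc (fun k => by positivity)
    (t / (16 * (b * s)))
  have e1 : ∑ k, (4 * b * |a k|) ^ 2 = 16 * (b * s) ^ 2 := by
    simp only [mul_pow, sq_abs, ← Finset.mul_sum, hs2]
    ring
  have e2 : (t / (16 * (b * s))) ^ 2 * (16 * (b * s) ^ 2) / 2 = t ^ 2 / 32 := by
    field_simp
    ring
  rw [e1, e2] at hexp
  have h3 : (cardOf fun σ : Perm (Fin n) => (2 + t) * b * s < f σ : ℝ) * Real.exp (t ^ 2 / 16) ≤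
      ∑ σ, Real.exp (t / (16 * (b * s)) * (f σ - (∑ τ, f τ) / n.factorial)) := by
    rw [cardOf, ← nsmul_eq_mul]
    refine (Finset.card_nsmul_le_sum _ _ _ fun σ hσ => ?_).trans
      (Finset.sum_le_sum_of_subset_of_nonneg (Finset.subset_univ _) fun _ _ _ => Real.exp_nonneg _)
    simp only [Finset.mem_filter, Finset.mem_univ, true_and] at hσ
    refine Real.exp_le_exp.2 ?_
    have h4 : t * (b * s) ≤ f σ - (∑ τ, f τ) / n.factorial := by nlinarith
    calc t ^ 2 / 16 = t / (16 * (b * s)) * (t * (b * s)) := by field_simp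
      _ ≤ _ := by gcongr
  have h5 := h3.trans hexp
  have e3 : Real.exp (-(t ^ 2 / 32)) = Real.exp (t ^ 2 / 32) / Real.exp (t ^ 2 / 16) := by
    rw [← Real.exp_sub]; congr 1; ring
  rw [e3, mul_div_assoc', le_div_iff₀ (Real.exp_pos _)]
  exact h5

/-- Concentration of randomly permuted linear combinations of vectors. -/
theorem card_perm_norm_gt_le (a : Fin n → ℝ) (ha : ∑ i, a i = 0) (x : Fin n → V) {b t : ℝ}
    (hb0 : 0 < b) (hb : ∀ i, ‖x i‖ ≤ b) (ht : 0 ≤ t) :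
    (cardOf fun σ : Perm (Fin n) => (2 + t) * b * Real.sqrt (∑ i, a i ^ 2) <
      ‖∑ c, a c • x (σ c)‖ : ℝ) ≤ n.factorial * Real.exp (-(t ^ 2 / 32)) := by
  classical
  set ρ := Tuple.sort fun i => -|a i| with hρ
  have hm := Tuple.monotone_sort fun i => -|a i|
  have h := card_perm_norm_gt_le_of_antitone (fun i => a (ρ i)) (by rw [Equiv.sum_comp ρ, ha])
    (fun k l hkl => neg_le_neg_iff.1 (hm hkl.le)) x hb0 hb ht
  rw [Equiv.sum_comp ρ fun i => a i ^ 2] at h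
  refine le_trans (le_of_eq ?_) h
  congr 1
  unfold cardOf
  refine Finset.card_bij (fun σ _ => σ * ρ) ?_ (fun σ _ τ _ => mul_right_cancel) ?_
  · intro σ hσ
    simp only [Finset.mem_filter, Finset.mem_univ, true_and, Perm.mul_apply] at hσ ⊢
    rwa [Equiv.sum_comp ρ fun i => a i • x (σ i)]
  · intro σ hσ
    refine ⟨σ * ρ⁻¹, ?_, by simp⟩
    simp only [Finset.mem_filter, Finset.mem_univ, true_and, Perm.mul_apply] at hσ ⊢
    rw [← Equiv.sum_comp ρ fun c => a c • x (σ (ρ⁻¹ c))]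
    simpa only [Perm.inv_def, Equiv.symm_apply_apply] using hσ

end PermConcentration

section Eigenspaces

open Matrix

variable {N d : ℕ} {b : ℝ} {G : Fin N → Fin N → Bool}

lemma exists_orthonormal_eigenbasis {A : Matrix (Fin N) (Fin N) ℝ} (hA : A.IsHermitian) :
    ∃ (u : Matrix (Fin N) (Fin N) ℝ) (μ : Fin N → ℝ), (∀ α, A *ᵥ u α = μ α • u α) ∧
      u * uᵀ = 1 ∧ uᵀ * u = 1 := by
  have h1 : (Matrix.of fun α i => hA.eigenvectorBasis α i) *
      (Matrix.of fun α i => hA.eigenvectorBasis α i)ᵀ = 1 := by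
    ext α β
    have := orthonormal_iff_ite.1 hA.eigenvectorBasis.orthonormal α β
    rw [one_apply, ← this, mul_apply, PiLp.inner_apply]
    simp [mul_comm]
  refine ⟨Matrix.of fun α i => hA.eigenvectorBasis α i, hA.eigenvalues, fun α => ?_, h1,
    mul_eq_one_comm.1 h1⟩
  exact hA.mulVec_eigenvectorBasis α

/-- Quadratic forms in the eigenvectors are controlled by finitely many linear combinations. -/
theorem Delocalized.exists_vectors (h : Delocalized b G) (hG : IsRegGraph N d G) (hb : 0 ≤ b) :
    ∃ x : Fin N → Fin N → EuclideanSpace ℝ (Fin N × Fin N), (∀ k i, ‖x k i‖ ≤ b) ∧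
      ∀ (v : Fin N → ℝ) (lam : ℝ), ∑ i, v i ^ 2 = 1 → (adjOf G) *ᵥ v = lam • v →
        ∃ k, ∀ a : Fin N → ℝ, |∑ i, a i * v i ^ 2| ≤ ‖∑ i, a i • x k i‖ := by
  have hsymm : (adjOf G)ᵀ = adjOf G := by
    ext i j
    simp [adjOf, hG.1 i j]
  obtain ⟨u, μ, hu, h1, h2⟩ := exists_orthonormal_eigenbasis
    (A := adjOf G) (by rw [IsHermitian, conjTranspose_eq_transpose_of_trivial, hsymm])
  have hrow : ∀ α β, ∑ i, u α i * u β i = if α = β then 1 else 0 := fun α β => by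
    have := congrFun (congrFun h1 α) β
    rwa [mul_apply, one_apply] at this
  obtain ⟨y, hy⟩ : ∃ y : Fin N → Fin N → Fin N → ℝ,
      ∀ k α i, y k α i = if μ α = μ k then u α i else 0 := ⟨_, fun _ _ _ => rfl⟩
  refine ⟨fun k i => WithLp.toLp 2 fun p => y k p.1 i * y k p.2 i, fun k i => ?_,
    fun v lam hv hA => ?_⟩
  · have e1 : ‖(WithLp.toLp 2 fun p : Fin N × Fin N => y k p.1 i * y k p.2 i :
        EuclideanSpace ℝ (Fin N × Fin N))‖ = ∑ α, y k α i ^ 2 := by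
      rw [EuclideanSpace.norm_eq]
      simp only [Real.norm_eq_abs, sq_abs, mul_pow]
      rw [Fintype.sum_prod_type]
      simp only [← Finset.mul_sum, ← Finset.sum_mul]
      exact Real.sqrt_mul_self (Finset.sum_nonneg fun _ _ => sq_nonneg _)
    rw [e1]
    set P := ∑ α, y k α i ^ 2 with hP
    have hP0 : 0 ≤ P := Finset.sum_nonneg fun α _ => sq_nonneg (y k α i)
    rcases hP0.eq_or_lt with h0 | h0
    · rw [← h0]; exact hb
    have hs := Real.mul_self_sqrt h0.le
    have hs0 := Real.sqrt_pos.2 h0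
    set s := Real.sqrt P
    obtain ⟨w, hw⟩ : ∃ w : Fin N → ℝ, w = ∑ α, (y k α i / s) • u α := ⟨_, rfl⟩
    have hwi : ∀ j, w j = ∑ α, (y k α i / s) * u α j := fun j => by
      rw [hw, Finset.sum_apply]; rfl
    have hw1 : ∑ j, w j ^ 2 = 1 := by
      have : ∀ j, w j ^ 2 = ∑ α, ∑ β, (y k α i / s) * (y k β i / s) * (u α j * u β j) := by
        intro j
        rw [hwi, sq, Finset.sum_mul_sum]
        exact Finset.sum_congr rfl fun α _ => Finset.sum_congr rfl fun β _ => by ring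
      simp only [this]
      rw [Finset.sum_comm]
      have e2 : ∀ α, ∑ j, ∑ β, (y k α i / s) * (y k β i / s) * (u α j * u β j) =
          y k α i ^ 2 / (s * s) := by
        intro α
        rw [Finset.sum_comm]
        simp only [← Finset.mul_sum, hrow, mul_ite, mul_one, mul_zero, Finset.sum_ite_eq,
          Finset.mem_univ, if_true]
        ring
      simp only [e2, ← Finset.sum_div]
      rw [hs, ← hP, div_self h0.ne']
    have hwA : adjOf G *ᵥ w = μ k • w := by
      rw [hw, mulVec_sum, Finset.smul_sum]
      refine Finset.sum_congr rfl fun α _ => ?_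
      rw [mulVec_smul, hu, smul_comm]
      by_cases hk : μ α = μ k
      · rw [hk]
      · rw [hy, if_neg hk]; simp
    have hwii : w i = s := by
      have : ∀ α, (y k α i / s) * u α i = y k α i ^ 2 / s := by
        intro α
        rw [hy]
        split_ifs <;> ring
      rw [hwi]
      simp only [this, ← Finset.sum_div]
      rw [← hP, div_eq_iff hs0.ne', hs]
    have := h w (μ k) hw1 hwA i
    rwa [hwii, sq, hs] at this
  · obtain ⟨c, hc⟩ : ∃ c : Fin N → ℝ, c = u *ᵥ v := ⟨_, rfl⟩
    have hv2 : v = uᵀ *ᵥ c := by rw [hc, mulVec_mulVec, h2, one_mulVec]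
    have hvi : ∀ i, v i = ∑ α, c α * u α i := fun i => by
      conv_lhs => rw [hv2]
      simp [mulVec, dotProduct, mul_comm]
    have hc1 : ∑ α, c α ^ 2 = 1 := by
      rw [← hv]
      have e1 : c ⬝ᵥ c = v ⬝ᵥ v := by
        conv_rhs => rw [hv2]
        rw [dotProduct_mulVec, vecMul_transpose, mulVec_mulVec, h1, one_mulVec]
      simpa only [dotProduct, ← sq] using e1
    have hcz : ∀ α, μ α ≠ lam → c α = 0 := by
      intro α hα
      have e1 : u α ⬝ᵥ (adjOf G *ᵥ v) = (adjOf G *ᵥ u α) ⬝ᵥ v := by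
        rw [dotProduct_mulVec, ← mulVec_transpose, hsymm]
      rw [hA, hu, dotProduct_smul, smul_dotProduct, smul_eq_mul, smul_eq_mul] at e1
      have e2 : c α = u α ⬝ᵥ v := by rw [hc]; rfl
      rw [← e2] at e1
      by_contra hne
      exact hα (mul_right_cancel₀ hne e1).symm
    obtain ⟨k, hk⟩ : ∃ k, μ k = lam := by
      by_contra hne
      push Not at hne
      simp [fun α => hcz α (hne α)] at hc1
    refine ⟨k, fun a => ?_⟩
    have hcy : ∀ α i, c α * u α i = c α * y k α i := by
      intro α i
      rw [hy, hk]
      split_ifs with hα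
      · rfl
      · rw [hcz α hα]; ring
    obtain ⟨w, hw⟩ : ∃ w : EuclideanSpace ℝ (Fin N × Fin N),
      w = WithLp.toLp 2 fun p => c p.1 * c p.2 := ⟨_, rfl⟩
    have hwn : ‖w‖ = 1 := by
      rw [hw, EuclideanSpace.norm_eq]
      simp only [Real.norm_eq_abs, sq_abs, mul_pow]
      rw [Fintype.sum_prod_type]
      simp only [← Finset.mul_sum, hc1, mul_one, Real.sqrt_one]
    have e3 : ∑ i, a i * v i ^ 2 = inner ℝ w
        (∑ i, a i • (WithLp.toLp 2 fun p : Fin N × Fin N => y k p.1 i * y k p.2 i :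
          EuclideanSpace ℝ (Fin N × Fin N))) := by
      rw [inner_sum]
      refine Finset.sum_congr rfl fun i _ => ?_
      rw [inner_smul_right, PiLp.inner_apply, Fintype.sum_prod_type, hvi]
      congr 1
      simp only [hcy]
      rw [sq, Finset.sum_mul_sum]
      refine Finset.sum_congr rfl fun α _ => Finset.sum_congr rfl fun β _ => ?_
      simp [hw]
      ring
    rw [e3]
    refine (abs_real_inner_le_norm _ _).trans ?_
    rw [hwn, one_mul]

end Eigenspaces

section Exchangeability

open Matrix Equiv

variable {N d : ℕ} {b t T lam : ℝ} {G : Fin N → Fin N → Bool}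

lemma cardOf_eq_sum {γ : Type*} [Fintype γ] (q : γ → Prop) [DecidablePred q] :
    (cardOf q : ℝ) = ∑ x, if q x then 1 else 0 := by
  rw [cardOf, Finset.card_eq_sum_ones, Finset.sum_filter]
  push_cast
  exact Finset.sum_congr rfl fun x _ => by congr

lemma sum_cardOf_and_le {α β : Type*} [Fintype α] [Fintype β] (p : α → Prop)
    (R : β → α → Prop) {M : ℝ} (h : ∀ x, p x → (cardOf fun y => R y x : ℝ) ≤ M) :
    ∑ y, (cardOf fun x => p x ∧ R y x : ℝ) ≤ cardOf p * M := by
  classical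
  simp only [cardOf_eq_sum]
  rw [Finset.sum_comm, Finset.sum_mul]
  refine Finset.sum_le_sum fun x _ => ?_
  by_cases hx : p x
  · simp only [hx, true_and, if_true, one_mul]
    rw [← cardOf_eq_sum]
    exact h x hx
  · simp [hx]

/-- The graph `G` with its vertices relabelled by `σ`. -/
def permuteVertices (σ : Perm (Fin N)) (G : Fin N → Fin N → Bool) : Fin N → Fin N → Bool :=
  fun i j => G (σ i) (σ j)

lemma permuteVertices_symm_permuteVertices (σ : Perm (Fin N)) (G : Fin N → Fin N → Bool) :
    permuteVertices σ.symm (permuteVertices σ G) = G := by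
  funext i j
  simp [permuteVertices]

lemma permuteVertices_permuteVertices_symm (σ : Perm (Fin N)) (G : Fin N → Fin N → Bool) :
    permuteVertices σ (permuteVertices σ.symm G) = G := by
  funext i j
  simp [permuteVertices]

lemma IsRegGraph.permuteVertices (hG : IsRegGraph N d G) (σ : Perm (Fin N)) :
    IsRegGraph N d (permuteVertices σ G) := by
  refine ⟨fun i j => hG.1 _ _, fun i => hG.2.1 _, fun i => ?_⟩
  rw [← hG.2.2 (σ i)]
  refine Finset.card_bij (fun j _ => σ j) 
    (fun j hj => Finset.mem_filter.2 ⟨Finset.mem_univ _, (Finset.mem_filter.1 hj).2⟩)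
    (fun _ _ _ _ h => σ.injective h) fun j hj => ⟨σ.symm j, ?_, by simp⟩
  refine Finset.mem_filter.2 ⟨Finset.mem_univ _, ?_⟩
  simpa [_root_.permuteVertices] using (Finset.mem_filter.1 hj).2

lemma adjOf_permuteVertices_mulVec (σ : Perm (Fin N)) {v : Fin N → ℝ}
    (hv : adjOf (permuteVertices σ G) *ᵥ v = lam • v) :
    adjOf G *ᵥ (fun i => v (σ.symm i)) = lam • fun i => v (σ.symm i) := by
  funext i
  have := congrFun hv (σ.symm i)
  simp only [mulVec, dotProduct, adjOf, of_apply, permuteVertices, Pi.smul_apply,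
    apply_symm_apply] at this ⊢
  rw [← this, ← Equiv.sum_comp σ]
  simp

lemma sum_comp_symm_sq (σ : Perm (Fin N)) (a v : Fin N → ℝ) :
    ∑ i, a (σ.symm i) * v (σ.symm i) ^ 2 = ∑ i, a i * v i ^ 2 :=
  Equiv.sum_comp σ.symm fun i => a i * v i ^ 2

lemma Delocalized.of_permuteVertices {σ : Perm (Fin N)} (h : Delocalized b (permuteVertices σ G)) :
    Delocalized b G := by
  intro v lam hv hA i
  have h1 := adjOf_permuteVertices_mulVec (G := permuteVertices σ G) (lam := lam) (v := v) σ.symm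
    (by rw [permuteVertices_symm_permuteVertices]; exact hA)
  have := h _ lam ?_ h1 (σ.symm i)
  · simpa using this
  · rw [← hv]
    exact Equiv.sum_comp σ fun i => v i ^ 2

/-- Some normalized eigenvector has a quadratic form larger than `T`. -/
def HasLargeForm (a : Fin N → ℝ) (T : ℝ) (G : Fin N → Fin N → Bool) : Prop :=
  ∃ (v : Fin N → ℝ) (lam : ℝ), ∑ i, v i ^ 2 = 1 ∧ (adjOf G).mulVec v = lam • v ∧
    T < |∑ i, a i * v i ^ 2|

lemma card_hasLargeForm_permuteVertices_le (hG : IsRegGraph N d G) (h : Delocalized b G)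
    (hb : 0 < b) (ht : 0 ≤ t) {a : Fin N → ℝ} (ha : ∑ i, a i = 0) :
    (cardOf fun σ : Perm (Fin N) =>
      HasLargeForm a ((2 + t) * b * Real.sqrt (∑ i, a i ^ 2)) (permuteVertices σ G) : ℝ) ≤
      N * (N.factorial * Real.exp (-(t ^ 2 / 32))) := by
  obtain ⟨x, hx, hxv⟩ := h.exists_vectors hG hb.le
  have h1 : (cardOf fun σ : Perm (Fin N) =>
      HasLargeForm a ((2 + t) * b * Real.sqrt (∑ i, a i ^ 2)) (permuteVertices σ G)) ≤
      ∑ k, cardOf fun σ : Perm (Fin N) => (2 + t) * b * Real.sqrt (∑ i, a i ^ 2) <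
        ‖∑ c, a c • x k (σ c)‖ := by
    refine le_trans (cardOf_le_of_imp ?_) (cardOf_exists_le _ _)
    rintro σ ⟨v, lam, hv, hA, hT⟩
    obtain ⟨k, hk⟩ := hxv (fun i => v (σ.symm i)) lam
      (by rw [← hv]; exact Equiv.sum_comp σ.symm fun i => v i ^ 2)
      (adjOf_permuteVertices_mulVec σ hA)
    refine ⟨k, Finset.mem_univ k, hT.trans_le ?_⟩
    have h2 := hk fun i => a (σ.symm i)
    rw [sum_comp_symm_sq] at h2
    rw [← Equiv.sum_comp σ fun j => a (σ.symm j) • x k j] at h2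
    simpa only [symm_apply_apply] using h2
  have h2 : (∑ k : Fin N, cardOf fun σ : Perm (Fin N) =>
      (2 + t) * b * Real.sqrt (∑ i, a i ^ 2) < ‖∑ c, a c • x k (σ c)‖ : ℝ) ≤
      N * (N.factorial * Real.exp (-(t ^ 2 / 32))) := by
    refine (Finset.sum_le_card_nsmul _ _ _ fun k _ =>
      card_perm_norm_gt_le a ha (x k) hb (hx k) ht).trans ?_
    simp
  exact le_trans (by exact_mod_cast h1) h2

theorem card_delocalized_hasLargeForm_le (hb : 0 < b) (ht : 0 ≤ t) {a : Fin N → ℝ}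
    (ha : ∑ i, a i = 0) :
    (cardOf fun G : Fin N → Fin N → Bool => (IsRegGraph N d G ∧ Delocalized b G) ∧
      HasLargeForm a ((2 + t) * b * Real.sqrt (∑ i, a i ^ 2)) G : ℝ) ≤
      (cardOf fun G : Fin N → Fin N → Bool => IsRegGraph N d G) *
        (N * Real.exp (-(t ^ 2 / 32))) := by
  classical
  have hfac : (0 : ℝ) < N.factorial := by exact_mod_cast N.factorial_pos
  set T := (2 + t) * b * Real.sqrt (∑ i, a i ^ 2) with hT
  set n := cardOf fun G : Fin N → Fin N → Bool => (IsRegGraph N d G ∧ Delocalized b G) ∧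
      HasLargeForm a T G with hn
  have h1 : ∀ σ : Perm (Fin N), n ≤ cardOf fun G : Fin N → Fin N → Bool =>
      (IsRegGraph N d G ∧ Delocalized b G) ∧ HasLargeForm a T (permuteVertices σ G) := by
    intro σ
    rw [hn]
    refine Finset.card_le_card_of_injOn (permuteVertices σ.symm) (fun G hG => ?_)
      fun G _ G' _ h => ?_
    · simp only [Finset.coe_filter, Finset.mem_univ, true_and, Set.mem_ofPred_eq] at hG ⊢
      obtain ⟨⟨hG, hd⟩, hl⟩ := hG
      rw [permuteVertices_permuteVertices_symm]
      refine ⟨⟨hG.permuteVertices _, ?_⟩, hl⟩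
      rw [← permuteVertices_permuteVertices_symm σ G] at hd
      exact hd.of_permuteVertices
    · rw [← permuteVertices_permuteVertices_symm σ G, h, permuteVertices_permuteVertices_symm]
  have h2 := sum_cardOf_and_le
    (fun G : Fin N → Fin N → Bool => IsRegGraph N d G ∧ Delocalized b G)
    (fun (σ : Perm (Fin N)) G => HasLargeForm a T (permuteVertices σ G))
    fun G hG => card_hasLargeForm_permuteVertices_le hG.1 hG.2 hb ht ha
  have h3 : (N.factorial : ℝ) * n ≤ ∑ σ : Perm (Fin N), (cardOf fun G : Fin N → Fin N → Bool =>
      (IsRegGraph N d G ∧ Delocalized b G) ∧ HasLargeForm a T (permuteVertices σ G) : ℝ) := by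
    refine le_trans (le_of_eq ?_) (Finset.card_nsmul_le_sum Finset.univ _ (n : ℝ) fun σ _ => by
      exact_mod_cast h1 σ)
    simp [Finset.card_univ, Fintype.card_perm]
  have h4 : (cardOf fun G : Fin N → Fin N → Bool => IsRegGraph N d G ∧ Delocalized b G : ℝ) ≤
      cardOf fun G : Fin N → Fin N → Bool => IsRegGraph N d G := by
    exact_mod_cast cardOf_le_of_imp
      (p := fun G : Fin N → Fin N → Bool => IsRegGraph N d G ∧ Delocalized b G) fun G hG => hG.1
  have h5 := h3.trans (h2.trans (mul_le_mul_of_nonneg_right h4 (by positivity)))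
  refine le_of_mul_le_mul_left (h5.trans (le_of_eq ?_)) hfac
  ring

end Exchangeability

section Existence

lemma exists_symm_finset {N d : ℕ} [NeZero N] (hd : d < N) (he : Even (N * d)) :
    ∃ S : Finset (Fin N), S.card = d ∧ 0 ∉ S ∧ ∀ x ∈ S, -x ∈ S := by
  rcases Nat.even_or_odd' d with ⟨k, rfl | rfl⟩
  · refine ⟨(Finset.Ico 1 (k + 1) ∪ Finset.Ico (N - k) N).attachFin fun n hn => ?_, ?_, ?_,
      fun x hx => ?_⟩
    · simp only [Finset.mem_union, Finset.mem_Ico] at hn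
      omega
    · rw [Finset.card_attachFin, Finset.card_union_of_disjoint, Nat.card_Ico, Nat.card_Ico]
      · omega
      · rw [Finset.disjoint_left]
        intro n h1 h2
        simp only [Finset.mem_Ico] at h1 h2
        omega
    · simp only [Finset.mem_attachFin, Finset.mem_union, Finset.mem_Ico, Fin.val_zero]
      omega
    · have hlt := x.2
      simp only [Finset.mem_attachFin, Finset.mem_union, Finset.mem_Ico] at hx ⊢
      rw [Fin.val_neg', Nat.mod_eq_of_lt (by omega)]
      omega
  · have hN : Even N := by
      rcases Nat.even_mul.1 he with h | h
      · exact h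
      · exact absurd h (by simp)
    obtain ⟨m, rfl⟩ := hN
    refine ⟨(Finset.Ico 1 (k + 1) ∪ (Finset.Ico (m + m - k) (m + m) ∪ {m})).attachFin
      fun n hn => ?_, ?_, ?_, fun x hx => ?_⟩
    · simp only [Finset.mem_union, Finset.mem_Ico, Finset.mem_singleton] at hn
      omega
    · rw [Finset.card_attachFin, Finset.card_union_of_disjoint, Finset.card_union_of_disjoint,
        Nat.card_Ico, Nat.card_Ico, Finset.card_singleton]
      · omega
      all_goals
        rw [Finset.disjoint_left]
        intro n h1 h2
        simp only [Finset.mem_union, Finset.mem_Ico, Finset.mem_singleton] at h1 h2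
        omega
    · simp only [Finset.mem_attachFin, Finset.mem_union, Finset.mem_Ico, Finset.mem_singleton,
        Fin.val_zero]
      omega
    · have hlt := x.2
      simp only [Finset.mem_attachFin, Finset.mem_union, Finset.mem_Ico,
        Finset.mem_singleton] at hx ⊢
      rw [Fin.val_neg', Nat.mod_eq_of_lt (by omega)]
      omega

/-- Circulant graphs show that regular graphs exist. -/
lemma exists_isRegGraph {N d : ℕ} (hd : d < N) (he : Even (N * d)) :
    ∃ G : Fin N → Fin N → Bool, IsRegGraph N d G := by
  have : NeZero N := ⟨by omega⟩
  obtain ⟨S, hS, h0, hneg⟩ := exists_symm_finset hd he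
  refine ⟨fun i j => decide (j - i ∈ S), fun i j => ?_, fun i => by simp [h0], fun i => ?_⟩
  · rw [decide_eq_decide]
    exact ⟨fun h => by simpa using hneg _ h, fun h => by simpa using hneg _ h⟩
  · rw [← hS]
    exact Finset.card_bij (fun j _ => j - i) (by simp) (fun _ _ _ _ h => sub_left_injective h)
      fun j hj => ⟨j + i, by simpa using hj, by simp⟩

end Existence

section Assembly

open Real

lemma one_sub_le_unifProb {N d : ℕ} {q t : ℝ} (hd : d < N) (he : Even (N * d)) (hq : 2 ≤ q)
    (hD : 10 ^ 60 * q ^ 2 ≤ Dunif N d) (ht : 0 ≤ t) {a : Fin N → ℝ} (ha : ∑ i, a i = 0) {K : ℝ}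
    (hK : (2 + t) * (10 ^ 63 * q ^ 2 / N) ≤ K) :
    1 - exp (10 * log N - 8 * (q * log q)) - exp (log N - t ^ 2 / 32) ≤
      unifProb N d fun A => ∀ (v : Fin N → ℝ) (lam : ℝ), (∑ i, v i ^ 2) = 1 →
        A.mulVec v = lam • v → |∑ i, a i * v i ^ 2| ≤ K * √(∑ i, a i ^ 2) := by
  have hN : (0 : ℝ) < N := by exact_mod_cast (Nat.zero_le d).trans_lt hd
  have hreg : 0 < cardOf fun G : Fin N → Fin N → Bool => IsRegGraph N d G := by
    obtain ⟨G, hG⟩ := exists_isRegGraph hd he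
    exact Finset.card_pos.2 ⟨G, by simpa using hG⟩
  have e1 : exp (10 * log N - 8 * (q * log q)) = N ^ 10 * exp (-(8 * (q * log q))) := by
    rw [sub_eq_add_neg, exp_add, mul_comm (10 : ℝ), exp_mul, exp_log hN]
    norm_cast
  have e2 : exp (log N - t ^ 2 / 32) = N * exp (-(t ^ 2 / 32)) := by
    rw [sub_eq_add_neg, exp_add, exp_log hN]
  have h1 := card_not_delocalized_le hq hD
  have h2 := card_delocalized_hasLargeForm_le (d := d) (b := 10 ^ 63 * q ^ 2 / N) (by positivity)
    ht ha
  set b := 10 ^ 63 * q ^ 2 / (N : ℝ)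
  set T := (2 + t) * b * √(∑ i, a i ^ 2)
  set P : Matrix (Fin N) (Fin N) ℝ → Prop := fun A => ∀ (v : Fin N → ℝ) (lam : ℝ),
    (∑ i, v i ^ 2) = 1 → A.mulVec v = lam • v → |∑ i, a i * v i ^ 2| ≤ K * √(∑ i, a i ^ 2)
  have h3 : (cardOf fun G : Fin N → Fin N → Bool => IsRegGraph N d G) ≤
      (cardOf fun G : Fin N → Fin N → Bool => IsRegGraph N d G ∧ P (adjOf G)) +
      ((cardOf fun G : Fin N → Fin N → Bool => IsRegGraph N d G ∧ ¬ Delocalized b G) +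
      cardOf fun G : Fin N → Fin N → Bool => (IsRegGraph N d G ∧ Delocalized b G) ∧
        HasLargeForm a T G) := by
    refine le_trans (cardOf_le_of_imp fun G hG => ?_) (cardOf_or_le.trans
      (Nat.add_le_add_left cardOf_or_le _))
    by_cases hb : Delocalized b G
    · by_cases hl : HasLargeForm a T G
      · exact Or.inr (Or.inr ⟨⟨hG, hb⟩, hl⟩)
      · refine Or.inl ⟨hG, fun v lam hv hA => ?_⟩
        by_contra! hlt
        exact hl ⟨v, lam, hv, hA,
          (mul_le_mul_of_nonneg_right hK (sqrt_nonneg _)).trans_lt hlt⟩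
    · exact Or.inr (Or.inl ⟨hG, hb⟩)
  have hreg' : (0 : ℝ) < cardOf fun G : Fin N → Fin N → Bool => IsRegGraph N d G := by
    exact_mod_cast hreg
  have h3' : ((cardOf fun G : Fin N → Fin N → Bool => IsRegGraph N d G : ℕ) : ℝ) ≤
      (cardOf fun G : Fin N → Fin N → Bool => IsRegGraph N d G ∧ P (adjOf G) : ℕ) +
      ((cardOf fun G : Fin N → Fin N → Bool => IsRegGraph N d G ∧ ¬ Delocalized b G : ℕ) +
      (cardOf fun G : Fin N → Fin N → Bool => (IsRegGraph N d G ∧ Delocalized b G) ∧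
        HasLargeForm a T G : ℕ)) := by
    exact_mod_cast h3
  rw [unifProb, le_div_iff₀ hreg', e1, e2]
  linarith

lemma pow_three_log_le_sq {L ξ : ℝ} (hL : 0 ≤ L) (hξ : 0 < ξ)
    (h : 300 * L ^ 2 ≤ ξ * log ξ) : 1000 * L ^ 3 ≤ ξ ^ 2 := by
  set s := exp (log ξ / 3) with hs
  have hs3 : s ^ 3 = ξ := by
    rw [hs, ← exp_nat_mul]
    push_cast
    rw [mul_div_cancel₀ _ (by norm_num), exp_log hξ]
  have hs0 : 0 < s := exp_pos _
  have hls : log ξ ≤ 3 * s := by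
    have := add_one_le_exp (log ξ / 3)
    linarith
  have h1 : 300 * L ^ 2 ≤ 3 * s ^ 4 := by
    calc 300 * L ^ 2 ≤ ξ * (3 * s) := h.trans (mul_le_mul_of_nonneg_left hls hξ.le)
      _ = 3 * s ^ 4 := by rw [← hs3]; ring
  have h2 : 10 * L ≤ s ^ 2 := by
    refine le_of_sq_le_sq ?_ (by positivity)
    linarith
  calc 1000 * L ^ 3 = (10 * L) ^ 3 := by ring
    _ ≤ (s ^ 2) ^ 3 := pow_le_pow_left₀ (by positivity) h2 3
    _ = ξ ^ 2 := by rw [← hs3]; ring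

lemma mul_sqrt_log_le_sq {ζ : ℝ} (hζ : 1 ≤ ζ) : ζ * √(log ζ) ≤ ζ ^ 2 := by
  rw [sq]
  refine mul_le_mul_of_nonneg_left (sqrt_le_iff.2 ⟨by linarith, ?_⟩) (by linarith)
  nlinarith [log_le_sub_one_of_pos (show 0 < ζ by linarith)]

lemma bounds_of_le_Dunif {N d : ℕ} {ξ : ℝ} (hN : 0 < N) (hd : 3 ≤ d) (hξ : 0 < ξ)
    (hL : 0 ≤ ξ * log ξ) (hD : 10 ^ 63 * ξ ^ 2 ≤ Dunif N d) :
    1 ≤ ξ ∧ d < N ∧ 60 ≤ log N := by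
  have h1 : 1 ≤ ξ := by
    by_contra! h
    exact absurd hL (not_le.2 (mul_neg_of_pos_of_neg hξ (log_neg hξ h)))
  have hξ2 : 10 ^ 63 ≤ 10 ^ 63 * ξ ^ 2 := by nlinarith
  have hd1 : (10 : ℝ) ^ 63 ≤ d := hξ2.trans (hD.trans (min_le_left _ _))
  have hd0 : (0 : ℝ) < d := lt_of_lt_of_le (by norm_num) hd1
  have h2 : (10 : ℝ) ^ 63 ≤ (N : ℝ) ^ 2 / (d : ℝ) ^ 3 := hξ2.trans (hD.trans (min_le_right _ _))
  rw [le_div_iff₀ (by positivity)] at h2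
  have h3 : (d : ℝ) < N := by
    refine lt_of_pow_lt_pow_left₀ 2 (by positivity) (lt_of_lt_of_le ?_ h2)
    nlinarith [pow_pos hd0 2, pow_pos hd0 3]
  refine ⟨h1, by exact_mod_cast h3, ?_⟩
  rw [le_log_iff_exp_le (by exact_mod_cast hN)]
  have he : exp 60 = exp 1 ^ 60 := by
    rw [← exp_nat_mul]
    norm_num
  rw [he]
  calc exp 1 ^ 60 ≤ 10 ^ 60 :=
        pow_le_pow_left₀ (exp_pos _).le (exp_one_lt_d9.le.trans (by norm_num)) _
    _ ≤ (10 : ℝ) ^ 63 := by norm_num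
    _ ≤ N := hd1.trans h3.le

end Assembly

/-- **Probabilistic local quantum unique ergodicity** for the uniform model of random
`d`-regular graphs: for a deterministic function `a` with `Σ a_i = 0`, with high
probability every ℓ²-normalized eigenvector `v` of the adjacency matrix satisfies
`|Σ a_i v_i²| ≤ C (ξζ)²/N · (Σ a_i²)^{1/2}`. -/
theorem probabilistic_local_que_uniform :
    ∃ c0 C : ℝ, 0 < c0 ∧ 0 < C ∧
      ∀ N d : ℕ, 0 < N → 3 ≤ d → Even (N * d) →
        ∀ ξ : ℝ, 0 < ξ → c0 * Real.log N ^ 2 ≤ ξ * Real.log ξ →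
          c0 * ξ ^ 2 ≤ Dunif N d →
          ∀ a : Fin N → ℝ, (∑ i, a i) = 0 →
            ∀ ζ : ℝ, c0 ≤ ζ →
              1 - Real.exp (-(ξ * Real.log ξ)) -
                  Real.exp (-ζ * Real.sqrt (Real.log ζ)) ≤
                unifProb N d fun A =>
                  ∀ (v : Fin N → ℝ) (lam : ℝ), (∑ i, v i ^ 2) = 1 →
                    A.mulVec v = lam • v →
                    |∑ i, a i * v i ^ 2| ≤
                      C * ((ξ * ζ) ^ 2 / N) * Real.sqrt (∑ i, a i ^ 2) := by
  refine ⟨10 ^ 63, 10 ^ 66, by positivity, by positivity, ?_⟩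
  intro N d hN hd he ξ hξ hL hD a ha ζ hζ
  obtain ⟨hξ1, hdN, hL60⟩ := bounds_of_le_Dunif hN hd hξ (le_trans (by positivity) hL) hD
  have hN0 : (0 : ℝ) < N := by exact_mod_cast hN
  set L := Real.log N
  have hζ8 : 8 ≤ ζ := le_trans (by norm_num) hζ
  have hζs := mul_sqrt_log_le_sq (show 1 ≤ ζ by linarith)
  have hL300 : 300 * L ^ 2 ≤ ξ * Real.log ξ := by nlinarith [sq_nonneg L]
  have hLξ := pow_three_log_le_sq (by linarith) hξ hL300
  have hL3 : (3 * L) ^ 2 ≤ L ^ 3 := by nlinarith [sq_nonneg L]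
  have h3L : 3 * L ≤ ξ := by
    refine le_of_sq_le_sq ?_ hξ.le
    nlinarith [sq_nonneg L]
  rcases le_or_gt (64 * L) (ζ ^ 4) with hcase | hcase
  · have hK : (2 + ζ ^ 2) * (10 ^ 63 * ξ ^ 2 / N) ≤ 10 ^ 66 * ((ξ * ζ) ^ 2 / N) := by
      rw [← mul_div_assoc, ← mul_div_assoc]
      refine div_le_div_of_nonneg_right ?_ hN0.le
      have : (2 + ζ ^ 2) ≤ 10 ^ 3 * ζ ^ 2 := by nlinarith
      nlinarith [mul_le_mul_of_nonneg_right this (sq_nonneg ξ)]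
    refine le_trans (sub_le_sub (sub_le_sub_left (Real.exp_le_exp.2 ?_) _)
      (Real.exp_le_exp.2 ?_)) (one_sub_le_unifProb hdN he (by linarith)
      (le_trans (by nlinarith [sq_nonneg ξ]) hD) (sq_nonneg ζ) ha hK)
    · nlinarith
    · have : 64 * ζ ^ 2 ≤ ζ ^ 4 := by nlinarith [sq_nonneg ζ]
      linarith
  · have hsq : √(128 * L) ^ 2 = 128 * L := Real.sq_sqrt (by linarith)
    have hsL : √(128 * L) ≤ 12 * L := Real.sqrt_le_iff.2 ⟨by linarith, by nlinarith⟩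
    have hK : (2 + √(128 * L)) * (10 ^ 63 * (3 * L) ^ 2 / N) ≤
        10 ^ 66 * ((ξ * ζ) ^ 2 / N) := by
      rw [← mul_div_assoc, ← mul_div_assoc]
      refine div_le_div_of_nonneg_right ?_ hN0.le
      have h1 : (2 + √(128 * L)) * (10 ^ 63 * (3 * L) ^ 2) ≤
          (14 * L) * (10 ^ 63 * (3 * L) ^ 2) :=
        mul_le_mul_of_nonneg_right (by linarith) (by positivity)
      have h2 : ξ ^ 2 * 1 ≤ ξ ^ 2 * ζ ^ 2 :=
        mul_le_mul_of_nonneg_left (by nlinarith) (sq_nonneg ξ)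
      nlinarith [pow_pos (show 0 < L by linarith) 3]
    have hmain := one_sub_le_unifProb hdN he (q := 3 * L) (by linarith)
      (le_trans (mul_le_mul (by norm_num) (pow_le_pow_left₀ (by linarith) h3L 2)
        (by positivity) (by positivity)) hD) (Real.sqrt_nonneg _) ha hK
    refine le_trans ?_ hmain
    have hlog : 1 ≤ Real.log (3 * L) := by
      rw [Real.le_log_iff_exp_le (by linarith)]
      linarith [Real.exp_one_lt_d9]
    have h1 : Real.exp (10 * L - 8 * (3 * L * Real.log (3 * L))) ≤ Real.exp (-(3 * L)) :=
      Real.exp_le_exp.2 (by nlinarith)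
    have h2 : Real.exp (L - √(128 * L) ^ 2 / 32) = Real.exp (-(3 * L)) := by
      rw [hsq]
      ring_nf
    have h3 : 2 * Real.exp (-(3 * L)) ≤ Real.exp (-(2 * L)) := by
      rw [show -(2 * L) = L + -(3 * L) by ring, Real.exp_add]
      exact mul_le_mul_of_nonneg_right (by linarith [Real.add_one_le_exp L]) (Real.exp_pos _).le
    have h4 : Real.exp (-(2 * L)) ≤ Real.exp (-ζ * Real.sqrt (Real.log ζ)) := by
      refine Real.exp_le_exp.2 ?_
      have : ζ ^ 2 ≤ 2 * L := le_of_sq_le_sq (by nlinarith) (by linarith)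
      linarith
    rw [h2]
    linarith [Real.exp_pos (-(ξ * Real.log ξ))]

end
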